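/- arXiv:1807.02466 — 8 statements merged into one kernel-verified Lean document; each statement's English description precedes it below -/
import Mathlib

section
/- Let q be a polynomial with q(0) = 0, q'(0) = 0 and q''(0) = 2, and let δ ∈ ℂ with |δ| < 1. Let B denote the interior of the set {p ∈ ℂ² : F_δⁿ(p) → (0,0) as n → ∞}. Then B is nonempty, F_δ(B) ⊆ B, and there exists a holomorphic map Φ : B → ℂ (an attracting Fatou coordinate) satisfying the Abel functional equation Φ(F_δ(p)) = Φ(p) + 1 for every p ∈ B. -/
open Filter Topology Polynomial

/-- The semi-parabolic Hénon map `(z, x) ↦ (z + q (z + δ x), δ x - q (z + δ x))`. -/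
noncomputable def semiParabolicMap (q : ℂ[X]) (δ : ℂ) (p : ℂ × ℂ) : ℂ × ℂ :=
  (p.1 + q.eval (p.1 + δ * p.2), δ * p.2 - q.eval (p.1 + δ * p.2))

/-- The set of points whose forward orbit under `f` converges to `a`. -/
def attractedSet {X : Type*} [TopologicalSpace X] (f : X → X) (a : X) : Set X :=
  {p | Tendsto (fun n => f^[n] p) atTop (𝓝 a)}

theorem iterate_mem_attractedSet_iff {X : Type*} [TopologicalSpace X] {f : X → X} {a : X}
    (n : ℕ) {p : X} : f^[n] p ∈ attractedSet f a ↔ p ∈ attractedSet f a := by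
  simp only [attractedSet, Set.mem_ofPred_eq, ← Function.iterate_add_apply]
  exact tendsto_add_atTop_iff_nat (f := fun m => f^[m] p) n

theorem apply_mem_attractedSet_iff {X : Type*} [TopologicalSpace X] {f : X → X} {a : X}
    {p : X} : f p ∈ attractedSet f a ↔ p ∈ attractedSet f a :=
  iterate_mem_attractedSet_iff 1

theorem exists_eq_X_sq_mul {q : ℂ[X]} (hq0 : q.eval 0 = 0) (hq1 : q.derivative.eval 0 = 0)
    (hq2 : q.derivative.derivative.eval 0 = 2) : ∃ k : ℂ[X], q = X ^ 2 * k ∧ k.eval 0 = 1 := by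
  have h : X ^ 2 ∣ q := by
    rw [X_pow_dvd_iff]
    intro d hd
    interval_cases d
    · rwa [coeff_zero_eq_eval_zero]
    · rw [← coeff_zero_eq_eval_zero, coeff_derivative] at hq1
      simpa using hq1
  obtain ⟨k, rfl⟩ := h
  refine ⟨k, rfl, ?_⟩
  simp at hq2
  linear_combination hq2 / 2

section

variable {q k : ℂ[X]} {δ : ℂ}

theorem differentiable_semiParabolicMap : Differentiable ℂ (semiParabolicMap q δ) := by
  have h : Differentiable ℂ fun p : ℂ × ℂ => q.eval (p.1 + δ * p.2) :=
    q.differentiable.comp (by fun_prop)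
  unfold semiParabolicMap
  fun_prop

theorem natDegree_X_add_X_sq_mul_ne_zero : (X + X ^ 2 * k).natDegree ≠ 0 := by
  intro h
  have := congrArg (fun p : ℂ[X] => p.coeff 1) (eq_C_of_natDegree_eq_zero h)
  simp [coeff_X_pow_mul'] at this

theorem mapsTo_interior_attractedSet :
    Set.MapsTo (semiParabolicMap (X ^ 2 * k) δ)
      (interior (attractedSet (semiParabolicMap (X ^ 2 * k) δ) 0))
      (interior (attractedSet (semiParabolicMap (X ^ 2 * k) δ) 0)) := by
  set F := semiParabolicMap (X ^ 2 * k) δ with hF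
  set A := attractedSet F 0
  intro p hp
  rw [mem_interior]
  rcases eq_or_ne δ 0 with rfl | hδ
  · have hopen := ((X + X ^ 2 * k).isOpenQuotientMap_eval
      natDegree_X_add_X_sq_mul_ne_zero).isOpenMap
    have hslice : IsOpen {z : ℂ | (z, p.2) ∈ interior A} :=
      isOpen_interior.preimage (by fun_prop)
    have hfib : ∀ z x y, (z, x) ∈ A → (z, y) ∈ A := by
      intro z x y h
      rw [← apply_mem_attractedSet_iff] at h ⊢
      simpa [F, semiParabolicMap] using h
    refine ⟨_, ?_, (hopen _ hslice).prod isOpen_univ, ?_⟩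
    · rintro ⟨_, x⟩ ⟨⟨z, hz, rfl⟩, -⟩
      have := apply_mem_attractedSet_iff.2 (interior_subset hz)
      have h : (F (z, p.2)).1 = (X + X ^ 2 * k).eval z := by simp [F, semiParabolicMap]
      refine hfib _ (F (z, p.2)).2 _ ?_
      dsimp only
      rw [← h]
      exact this
    · exact ⟨⟨p.1, hp, by simp [F, semiParabolicMap]⟩, trivial⟩
  · let G : ℂ × ℂ → ℂ × ℂ := fun p =>
      (p.1 - (X ^ 2 * k).eval (p.1 + p.2), (p.2 + (X ^ 2 * k).eval (p.1 + p.2)) / δ)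
    have hG : Continuous G := by
      have : Continuous fun p : ℂ × ℂ => (X ^ 2 * k).eval (p.1 + p.2) :=
        (X ^ 2 * k).continuous.comp (by fun_prop)
      fun_prop
    have hFG : ∀ p, F (G p) = p := by
      intro p
      have h : (G p).1 + δ * (G p).2 = p.1 + p.2 := by
        simp only [G]; field_simp; ring
      ext1
      · simp only [F, semiParabolicMap, h]; simp [G]
      · simp only [F, semiParabolicMap, h]; simp only [G]; field_simp; ring
    have hGF : ∀ p, G (F p) = p := by
      intro p
      have h : (F p).1 + (F p).2 = p.1 + δ * p.2 := by
        simp only [F, semiParabolicMap]; ring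
      ext1
      · simp only [G, h]; simp [F, semiParabolicMap]
      · simp only [G, h]; simp only [F, semiParabolicMap]; field_simp; ring
    refine ⟨G ⁻¹' interior A, fun y hy => ?_, isOpen_interior.preimage hG, ?_⟩
    · have := apply_mem_attractedSet_iff.2 (interior_subset hy)
      rwa [hFG] at this
    · simpa [hGF] using hp

theorem exists_escape_radius (hk : k ≠ 0) (hδ : ‖δ‖ < 1) : ∃ R > 0, ∀ v w : ℂ, R ≤ ‖w‖ →
    ‖v‖ ≤ ‖w‖ → ‖w‖ ≤ ‖(1 + δ) * w + (1 - δ) * (X ^ 2 * k).eval w - δ * v‖ := by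
  have hdeg : 0 < (X * k).degree := by
    rw [degree_mul, degree_X, degree_eq_natDegree hk]
    exact_mod_cast (by omega : 0 < 1 + k.natDegree)
  have h1 : 0 < ‖1 - δ‖ := by
    have := norm_sub_norm_le 1 δ
    simp only [norm_one] at this
    linarith
  have ht := (X * k).tendsto_norm_atTop hdeg (tendsto_norm_cobounded_atTop (E := ℂ))
  have hev := ht.eventually_ge_atTop (4 / ‖1 - δ‖)
  rw [← comap_norm_atTop, eventually_comap] at hev
  obtain ⟨R, hR⟩ := eventually_atTop.1 hev
  refine ⟨max R 1, by positivity, fun v w hw hv => ?_⟩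
  have h2 := hR ‖w‖ ((le_max_left _ _).trans hw) w rfl
  rw [div_le_iff₀ h1] at h2
  have h3 : 4 * ‖w‖ ≤ ‖(1 - δ) * (X ^ 2 * k).eval w‖ := by
    have : (1 - δ) * (X ^ 2 * k).eval w = (X * k).eval w * (1 - δ) * w := by
      simp; ring
    rw [this, norm_mul, norm_mul]
    gcongr
  have h4 : ‖(1 + δ) * w - δ * v‖ ≤ 3 * ‖w‖ := by
    have e1 : ‖(1 + δ) * w‖ ≤ 2 * ‖w‖ := by
      rw [norm_mul]
      gcongr
      have := norm_add_le 1 δ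
      simp only [norm_one] at this
      linarith
    have e2 : ‖δ * v‖ ≤ 1 * ‖w‖ := by
      rw [norm_mul]; gcongr
    linarith [norm_sub_le ((1 + δ) * w) (δ * v)]
  have h5 := norm_sub_norm_le ((1 - δ) * (X ^ 2 * k).eval w) (-((1 + δ) * w - δ * v))
  rw [norm_neg] at h5
  have : (1 - δ) * (X ^ 2 * k).eval w - -((1 + δ) * w - δ * v) =
      (1 + δ) * w + (1 - δ) * (X ^ 2 * k).eval w - δ * v := by ring
  rw [this] at h5
  linarith

theorem exists_bound_iterate_fst (hk : k ≠ 0) (hδ : ‖δ‖ < 1) : ∃ C R : ℝ, ∀ p,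
    p ∈ attractedSet (semiParabolicMap (X ^ 2 * k) δ) 0 → ∀ n,
      ‖((semiParabolicMap (X ^ 2 * k) δ)^[n] p).1‖ ≤ C * max R (2 * ‖p.1‖ + 2 * ‖p.2‖) := by
  obtain ⟨R, hR0, hR⟩ := exists_escape_radius hk hδ
  set F := semiParabolicMap (X ^ 2 * k) δ with hF
  have h1 : 0 < ‖1 - δ‖ := by
    have := norm_sub_norm_le 1 δ
    simp only [norm_one] at this
    linarith
  have hv : ∀ p, (F p).1 + (F p).2 = p.1 + δ * p.2 := fun p => by
    simp only [F, semiParabolicMap]; ring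
  have hw : ∀ p, (F p).1 + δ * (F p).2 = (1 + δ) * (p.1 + δ * p.2) +
      (1 - δ) * (X ^ 2 * k).eval (p.1 + δ * p.2) - δ * (p.1 + p.2) := fun p => by
    simp only [F, semiParabolicMap]; ring
  have hesc : ∀ p, p ∈ attractedSet F 0 → ‖p.1 + p.2‖ ≤ ‖p.1 + δ * p.2‖ →
      ‖p.1 + δ * p.2‖ < R := by
    intro p hp hle
    by_contra! hge
    have hn : ∀ n, ‖(F^[n] p).1 + (F^[n] p).2‖ ≤ ‖(F^[n] p).1 + δ * (F^[n] p).2‖ ∧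
        R ≤ ‖(F^[n] p).1 + δ * (F^[n] p).2‖ := by
      intro n
      induction n with
      | zero => exact ⟨hle, hge⟩
      | succ n ih =>
        rw [Function.iterate_succ_apply', hv, hw]
        have := hR _ _ ih.2 ih.1
        exact ⟨this, ih.2.trans this⟩
    have hc : Continuous fun p : ℂ × ℂ => ‖p.1 + δ * p.2‖ := by fun_prop
    have ht : Tendsto (fun n => ‖(F^[n] p).1 + δ * (F^[n] p).2‖) atTop (𝓝 0) := by
      simpa using! (hc.tendsto 0).comp hp
    exact hR0.not_ge (ge_of_tendsto' ht fun n => (hn n).2)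
  refine ⟨2 / ‖1 - δ‖, R, fun p hp n => ?_⟩
  set T := max R (2 * ‖p.1‖ + 2 * ‖p.2‖)
  have hT0 : R ≤ T := le_max_left _ _
  have hT1 : 2 * ‖p.1‖ + 2 * ‖p.2‖ ≤ T := le_max_right _ _
  have hδ2 : ‖δ * p.2‖ ≤ ‖p.2‖ := by
    rw [norm_mul]
    exact mul_le_of_le_one_left (norm_nonneg _) hδ.le
  have key : ∀ n, ‖(F^[n] p).1 + (F^[n] p).2‖ ≤ T ∧ ‖(F^[n] p).1 + δ * (F^[n] p).2‖ ≤ T := by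
    intro n
    induction n with
    | zero =>
      have := norm_nonneg p.1
      have := norm_nonneg p.2
      rw [Function.iterate_zero_apply]
      constructor
      · linarith [norm_add_le p.1 p.2]
      · linarith [norm_add_le p.1 (δ * p.2)]
    | succ n ih =>
      rw [Function.iterate_succ_apply', hv]
      refine ⟨ih.2, ?_⟩
      by_contra! hlt
      have hmem : F (F^[n] p) ∈ attractedSet F 0 :=
        apply_mem_attractedSet_iff.2 ((iterate_mem_attractedSet_iff n).2 hp)
      have := hesc _ hmem (by rw [hv]; linarith [ih.2])
      linarith
  have h2 : (1 - δ) * (F^[n] p).1 = ((F^[n] p).1 + δ * (F^[n] p).2) -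
      δ * ((F^[n] p).1 + (F^[n] p).2) := by ring
  have h3 : ‖1 - δ‖ * ‖(F^[n] p).1‖ ≤ T + 1 * T := by
    rw [← norm_mul, h2]
    refine (norm_sub_le _ _).trans ?_
    rw [norm_mul]
    gcongr
    · exact (key n).2
    · exact (key n).1
  rw [div_mul_eq_mul_div, le_div_iff₀ h1]
  linarith

theorem tendsto_deriv_of_bounded {f : ℕ → ℂ → ℂ} {c : ℂ} {r M : ℝ} (hr : 0 < r)
    (hf : ∀ n, Differentiable ℂ (f n)) (hM : ∀ n, ∀ z ∈ Metric.sphere c r, ‖f n z‖ ≤ M)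
    (hlim : ∀ z ∈ Metric.sphere c r, Tendsto (fun n => f n z) atTop (𝓝 0)) :
    Tendsto (fun n => deriv (f n) c) atTop (𝓝 0) := by
  have hI : Tendsto (fun n => ∮ z in C(c, r), (1 / (z - c) ^ 2) • f n z) atTop
      (𝓝 (∮ _ in C(c, r), (0 : ℂ))) := by
    unfold circleIntegral
    refine intervalIntegral.tendsto_integral_filter_of_dominated_convergence
      (fun _ => r * (1 / r ^ 2 * M)) ?_ ?_ ?_ ?_
    · refine Eventually.of_forall fun n => Continuous.aestronglyMeasurable ?_
      have h := (hf n).continuous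
      have hne : ∀ t, (circleMap c r t - c) ^ 2 ≠ 0 := fun t =>
        pow_ne_zero 2 (sub_ne_zero.2 (circleMap_ne_center hr.ne'))
      simp only [deriv_circleMap]
      fun_prop (disch := exact hne _)
    · refine Eventually.of_forall fun n => Eventually.of_forall fun t _ => ?_
      have := hM n _ (circleMap_mem_sphere c hr.le t)
      simp only [deriv_circleMap, norm_smul, norm_mul, norm_div, norm_pow, circleMap_sub_center,
        norm_circleMap_zero, Complex.norm_I, mul_one, norm_one, abs_of_pos hr]
      gcongr
    · exact intervalIntegrable_const
    · refine Eventually.of_forall fun t _ => ?_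
      have h := ((hlim _ (circleMap_mem_sphere c hr.le t)).const_mul
        (1 / (circleMap c r t - c) ^ 2)).const_mul (deriv (circleMap c r) t)
      rw [mul_zero, mul_zero] at h
      simpa only [smul_eq_mul, mul_zero] using! h
  have heq : ∀ n, deriv (f n) c = (2 * Real.pi * Complex.I)⁻¹ •
      ∮ z in C(c, r), (1 / (z - c) ^ 2) • f n z := fun n => by
    rw [(hf n).differentiableOn.deriv_eq_smul_circleIntegral hr,
      inv_smul_smul₀ Complex.two_pi_I_ne_zero]
  simp only [heq]
  have h0 : (∮ _ in C(c, r), (0 : ℂ)) = 0 := by simp [circleIntegral]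
  rw [h0] at hI
  simpa only [smul_zero] using hI.const_smul (2 * Real.pi * Complex.I)⁻¹

theorem tendsto_deriv_iterate_fst (hk : k ≠ 0) (hδ : ‖δ‖ < 1) {p : ℂ × ℂ}
    (hp : p ∈ interior (attractedSet (semiParabolicMap (X ^ 2 * k) δ) 0)) :
    Tendsto (fun n => deriv
      (fun t : ℂ => ((semiParabolicMap (X ^ 2 * k) δ)^[n] (p + (t, 0))).1) 0) atTop (𝓝 0) := by
  obtain ⟨C, R, hCR⟩ := exists_bound_iterate_fst hk hδ
  set F := semiParabolicMap (X ^ 2 * k) δ with hF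
  obtain ⟨r, hr, hball⟩ := Metric.isOpen_iff.1 isOpen_interior p hp
  have hmem : ∀ t ∈ Metric.sphere (0 : ℂ) (r / 2), p + (t, 0) ∈ attractedSet F 0 := by
    intro t ht
    refine interior_subset (hball ?_)
    rw [mem_sphere_zero_iff_norm] at ht
    rw [mem_ball_iff_norm, add_sub_cancel_left, Prod.norm_def]
    simp only [norm_zero, ht]
    rw [max_eq_left (by positivity)]
    linarith
  refine tendsto_deriv_of_bounded (M := |C| * max R (2 * (‖p.1‖ + r / 2) + 2 * ‖p.2‖))
    (half_pos hr) ?_ ?_ ?_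
  · intro n
    have := differentiable_semiParabolicMap (q := X ^ 2 * k) (δ := δ) |>.iterate n
    exact (differentiable_fst.comp (this.comp (by fun_prop : Differentiable ℂ
      fun t : ℂ => p + (t, (0 : ℂ)))))
  · intro n t ht
    refine (hCR _ (hmem t ht) n).trans ?_
    rw [mem_sphere_zero_iff_norm] at ht
    have h1 : ‖(p + (t, 0)).1‖ ≤ ‖p.1‖ + r / 2 := by
      rw [← ht]; exact norm_add_le _ _
    have h2 : (p + (t, 0)).2 = p.2 := by simp
    rw [h2]
    have h3 : 0 ≤ max R (2 * ‖(p + (t, 0)).1‖ + 2 * ‖p.2‖) :=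
      le_max_of_le_right (by positivity)
    calc _ ≤ |C| * max R (2 * ‖(p + (t, 0)).1‖ + 2 * ‖p.2‖) := by
          gcongr; exact le_abs_self C
      _ ≤ _ := by gcongr
  · intro t ht
    simpa using! (continuous_fst.tendsto _).comp (hmem t ht)

theorem exists_local_bounds (k : ℂ[X]) : ∃ C > 0, ∀ w : ℂ, ‖w‖ ≤ 1 →
    ‖(X ^ 2 * k).eval w‖ ≤ C * ‖w‖ * ‖w‖ ∧ ‖(X ^ 2 * k).derivative.eval w‖ ≤ C * ‖w‖ := by
  obtain ⟨C₁, h₁⟩ := (isCompact_closedBall (0 : ℂ) 1).exists_bound_of_continuousOn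
    k.continuous.continuousOn
  obtain ⟨C₂, h₂⟩ := (isCompact_closedBall (0 : ℂ) 1).exists_bound_of_continuousOn
    (2 * k + X * k.derivative).continuous.continuousOn
  refine ⟨max (max C₁ C₂) 1, by positivity, fun w hw => ?_⟩
  have hw' : w ∈ Metric.closedBall (0 : ℂ) 1 := by simpa using hw
  constructor
  · have : (X ^ 2 * k).eval w = k.eval w * w * w := by simp; ring
    rw [this, norm_mul, norm_mul]
    gcongr
    exact (h₁ w hw').trans (by simp)
  · have : (X ^ 2 * k).derivative.eval w = (2 * k + X * k.derivative).eval w * w := by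
      simp; ring
    rw [this, norm_mul]
    gcongr
    exact (h₂ w hw').trans (by simp)

/-- If the derivative of `q` decays geometrically with small constant along an orbit, then the
derivative of the iterates in the parabolic direction stays bounded away from zero. -/
theorem half_le_norm_deriv_iterate_fst {σ c : ℝ} (hσ0 : 0 ≤ σ) (hσ1 : σ < 1) (hδσ : ‖δ‖ ≤ σ)
    (hc : c = (1 - σ) / 4) {p : ℂ × ℂ}
    (hp : ∀ n, ‖q.derivative.eval (((semiParabolicMap q δ)^[n] p).1 +
      δ * ((semiParabolicMap q δ)^[n] p).2)‖ ≤ c * σ ^ n) (n : ℕ) :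
    1 / 2 ≤ ‖deriv (fun t : ℂ => ((semiParabolicMap q δ)^[n] (p + (t, 0))).1) 0‖ := by
  set F := semiParabolicMap q δ with hF
  have key : ∀ n, ∃ a b : ℂ, HasDerivAt (fun t : ℂ => (F^[n] (p + (t, 0))).1) a 0 ∧
      HasDerivAt (fun t : ℂ => (F^[n] (p + (t, 0))).2) b 0 ∧ ‖b‖ ≤ ‖a‖ ∧
      (1 + σ ^ n) / 2 ≤ ‖a‖ := by
    intro n
    induction n with
    | zero =>
      refine ⟨1, 0, ?_, ?_, by simp, by simp⟩
      · simpa using (hasDerivAt_id (0 : ℂ)).const_add p.1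
      · simpa using hasDerivAt_const (0 : ℂ) p.2
    | succ n ih =>
      obtain ⟨a, b, ha, hb, hba, hna⟩ := ih
      have hw := ha.add (hb.const_mul δ)
      set Q := q.derivative.eval ((F^[n] p).1 + δ * (F^[n] p).2) with hQ
      have hq : HasDerivAt (fun t : ℂ => q.eval ((F^[n] (p + (t, 0))).1 +
          δ * (F^[n] (p + (t, 0))).2)) (Q * (a + δ * b)) 0 := by
        have h := q.hasDerivAt ((F^[n] p).1 + δ * (F^[n] p).2)
        refine HasDerivAt.comp (0 : ℂ) (h₂ := fun w => q.eval w) ?_ hw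
        have h0 : p + ((0 : ℂ), (0 : ℂ)) = p := by simp
        rw [h0]
        exact h
      have hQb : ‖Q‖ ≤ c * σ ^ n := hp n
      have hσn : 0 ≤ σ ^ n := pow_nonneg hσ0 n
      have hσn1 : σ ^ n ≤ 1 := pow_le_one₀ hσ0 hσ1.le
      have hb' : ‖δ * b‖ ≤ σ * ‖a‖ := by
        rw [norm_mul]; gcongr
      have hab : ‖a + δ * b‖ ≤ 2 * ‖a‖ := by
        have : σ * ‖a‖ ≤ 1 * ‖a‖ := by gcongr
        linarith [norm_add_le a (δ * b)]
      have hE : ‖Q * (a + δ * b)‖ ≤ (c * σ ^ n) * (2 * ‖a‖) := by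
        rw [norm_mul]
        exact mul_le_mul hQb hab (norm_nonneg _) ((norm_nonneg _).trans hQb)
      have hE' : (c * σ ^ n) * (2 * ‖a‖) ≤ c * 1 * (2 * ‖a‖) := by
        have : 0 ≤ c := by rw [hc]; linarith
        gcongr
      have hlow : ‖a‖ - (c * σ ^ n) * (2 * ‖a‖) ≤ ‖a + Q * (a + δ * b)‖ := by
        have := norm_sub_norm_le a (-(Q * (a + δ * b)))
        rw [norm_neg, sub_neg_eq_add] at this
        linarith
      refine ⟨a + Q * (a + δ * b), δ * b - Q * (a + δ * b), ?_, ?_, ?_, ?_⟩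
      · simp only [Function.iterate_succ_apply']
        exact ha.add hq
      · simp only [Function.iterate_succ_apply']
        exact (hb.const_mul δ).sub hq
      · refine (norm_sub_le _ _).trans (le_trans ?_ hlow)
        subst hc
        nlinarith [norm_nonneg a]
      · refine le_trans ?_ hlow
        have h1 : (1 + σ ^ n) / 2 * (1 - 2 * (c * σ ^ n)) ≤ ‖a‖ * (1 - 2 * (c * σ ^ n)) := by
          refine mul_le_mul_of_nonneg_right hna ?_
          subst hc
          nlinarith
        have h2 : (1 + σ ^ (n + 1)) / 2 ≤ (1 + σ ^ n) / 2 * (1 - 2 * (c * σ ^ n)) := by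
          subst hc
          rw [pow_succ]
          nlinarith [mul_nonneg (mul_nonneg hσn (sub_nonneg.2 hσ1.le)) (sub_nonneg.2 hσn1)]
        linarith
  obtain ⟨a, b, ha, -, -, hna⟩ := key n
  rw [ha.deriv]
  linarith [pow_nonneg hσ0 n]

/-- A point of the interior of the attracted set visits the cone `‖x‖ < ε ‖z‖` at arbitrarily
large times. -/
theorem frequently_mem_cone (hk : k ≠ 0) (hδ : ‖δ‖ < 1) {p : ℂ × ℂ}
    (hp : p ∈ interior (attractedSet (semiParabolicMap (X ^ 2 * k) δ) 0)) {ε : ℝ} (hε : 0 < ε) :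
    ∃ᶠ n in atTop, ‖((semiParabolicMap (X ^ 2 * k) δ)^[n] p).2‖ <
      ε * ‖((semiParabolicMap (X ^ 2 * k) δ)^[n] p).1‖ := by
  obtain ⟨C, hC0, hC⟩ := exists_local_bounds k
  set F := semiParabolicMap (X ^ 2 * k) δ with hF
  intro hcon
  simp only [not_lt] at hcon
  set σ := (1 + ‖δ‖) / 2 with hσ
  have hδ0 := norm_nonneg δ
  set E := 1 / ε + 1 with hE
  have hE0 : 0 < E := by positivity
  have hx : Tendsto (fun n => ‖(F^[n] p).2‖) atTop (𝓝 0) := by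
    simpa using! (continuous_snd.norm.tendsto (0 : ℂ × ℂ)).comp (interior_subset hp)
  have hsmall : ∀ η : ℝ, 0 < η → ∀ᶠ n in atTop, ‖(F^[n] p).2‖ ≤ η := fun η hη =>
    hx.eventually_le_const hη
  obtain ⟨m, hm⟩ := eventually_atTop.1 (((hcon.and (hsmall (1 / E) (by positivity))).and
    (hsmall ((σ - ‖δ‖) / (C * E * E)) (div_pos (by rw [hσ]; linarith) (by positivity)))).and
    (hsmall ((1 - σ) / 4 / (C * E)) (div_pos (by rw [hσ]; linarith) (by positivity))))
  have hw : ∀ n ≥ m, ‖(F^[n] p).1 + δ * (F^[n] p).2‖ ≤ E * ‖(F^[n] p).2‖ := by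
    intro n hn
    have h1 := (hm n hn).1.1.1
    have h2 : ‖(F^[n] p).1‖ ≤ 1 / ε * ‖(F^[n] p).2‖ := by
      rw [one_div, ← div_eq_inv_mul, le_div_iff₀ hε]; linarith
    have h3 : ‖δ * (F^[n] p).2‖ ≤ 1 * ‖(F^[n] p).2‖ := by
      rw [norm_mul]; gcongr
    rw [hE, add_mul]
    exact (norm_add_le _ _).trans (add_le_add h2 h3)
  have hw1 : ∀ n ≥ m, ‖(F^[n] p).1 + δ * (F^[n] p).2‖ ≤ 1 := by
    intro n hn
    refine (hw n hn).trans ?_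
    have := (hm n hn).1.1.2
    rw [le_div_iff₀ hE0] at this
    linarith
  have hdec : ∀ n ≥ m, ‖(F^[n + 1] p).2‖ ≤ σ * ‖(F^[n] p).2‖ := by
    intro n hn
    rw [Function.iterate_succ_apply']
    have h1 := (hC _ (hw1 n hn)).1
    have h2 := (hm n hn).1.2
    rw [le_div_iff₀ (by positivity)] at h2
    have h3 := hw n hn
    change ‖δ * (F^[n] p).2 - (X ^ 2 * k).eval ((F^[n] p).1 + δ * (F^[n] p).2)‖ ≤ _
    calc _ ≤ ‖δ‖ * ‖(F^[n] p).2‖ + C * (E * ‖(F^[n] p).2‖) * (E * ‖(F^[n] p).2‖) := by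
          refine (norm_sub_le _ _).trans ?_
          rw [norm_mul]
          gcongr
          exact h1.trans (by gcongr)
      _ = (‖δ‖ + ‖(F^[n] p).2‖ * (C * E * E)) * ‖(F^[n] p).2‖ := by ring
      _ ≤ σ * ‖(F^[n] p).2‖ := by
          gcongr
          linarith
  have hgeom : ∀ j, ‖(F^[j] (F^[m] p)).2‖ ≤ σ ^ j * ‖(F^[m] p).2‖ := by
    intro j
    induction j with
    | zero => simp
    | succ j ih =>
      rw [← Function.iterate_add_apply] at ih ⊢
      have h := hdec (j + m) (by omega)
      rw [show j + 1 + m = j + m + 1 by ring, pow_succ', mul_assoc]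
      exact h.trans (by gcongr)
  have hpm : F^[m] p ∈ interior (attractedSet F 0) :=
    (mapsTo_interior_attractedSet (k := k) (δ := δ)).iterate m hp
  have hlow := half_le_norm_deriv_iterate_fst (q := X ^ 2 * k) (δ := δ) (p := F^[m] p) (σ := σ)
    (c := (1 - σ) / 4) (by positivity) (by rw [hσ]; linarith) (by rw [hσ]; linarith) rfl (by
      intro j
      rw [← hF]
      have h1 := hw (j + m) (by omega)
      have h2 := (hC _ (hw1 (j + m) (by omega))).2
      have h3 := (hm m le_rfl).2
      rw [Function.iterate_add_apply] at h1 h2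
      refine h2.trans ?_
      rw [le_div_iff₀ (by positivity)] at h3
      calc _ ≤ C * (E * (σ ^ j * ‖(F^[m] p).2‖)) := by
            gcongr
            exact h1.trans (by gcongr; exact hgeom j)
        _ = ‖(F^[m] p).2‖ * (C * E) * σ ^ j := by ring
        _ ≤ _ := by gcongr)
  have h0 := (tendsto_deriv_iterate_fst hk hδ hpm).norm
  rw [norm_zero] at h0
  have := ge_of_tendsto' h0 hlow
  norm_num at this

/-- The factor `g` with `q (z + δ x) = z ^ 2 * g (z, x / z)` for `q = X ^ 2 * k`. -/
noncomputable def blowupFactor (k : ℂ[X]) (δ : ℂ) (a : ℂ × ℂ) : ℂ :=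
  (1 + δ * a.2) ^ 2 * k.eval (a.1 * (1 + δ * a.2))

/-- The increment of `-1 / z` under the map, as a function of `(z, x / z)`. -/
noncomputable def petalIncrement (k : ℂ[X]) (δ : ℂ) (a : ℂ × ℂ) : ℂ :=
  blowupFactor k δ a / (1 + a.1 * blowupFactor k δ a)

/-- The new slope `x / z` after one application of the map, as a function of `(z, x / z)`. -/
noncomputable def petalSlope (k : ℂ[X]) (δ : ℂ) (a : ℂ × ℂ) : ℂ :=
  δ * a.2 - a.1 * (petalIncrement k δ a * (1 + δ * a.2))

theorem contDiff_blowupFactor : ContDiff ℂ 1 (blowupFactor k δ) := by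
  have h : ContDiff ℂ 1 fun a : ℂ × ℂ => k.eval (a.1 * (1 + δ * a.2)) := by
    simpa using! (k.contDiff_aeval (𝕜 := ℂ) 1).comp
      (by fun_prop : ContDiff ℂ 1 fun a : ℂ × ℂ => a.1 * (1 + δ * a.2))
  unfold blowupFactor
  fun_prop

theorem contDiffAt_petalIncrement : ContDiffAt ℂ 1 (petalIncrement k δ) 0 := by
  have h := (contDiff_blowupFactor (k := k) (δ := δ)).contDiffAt (x := 0)
  unfold petalIncrement
  refine h.div (by fun_prop) ?_
  simp

theorem petalIncrement_zero (hk : k.eval 0 = 1) : petalIncrement k δ 0 = 1 := by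
  simp [petalIncrement, blowupFactor, hk]

theorem petalSlope_zero : petalSlope k δ 0 = 0 := by
  simp [petalSlope]

theorem exists_petal_estimates (hk : k.eval 0 = 1) (hδ : ‖δ‖ < 1) :
    ∃ ε > 0, ∃ L ≥ 0, ∃ ρ : ℝ, 0 ≤ ρ ∧ ρ < 1 ∧ ∀ a ∈ Metric.ball (0 : ℂ × ℂ) ε,
      1 + a.1 * blowupFactor k δ a ≠ 0 ∧ ‖petalIncrement k δ a - 1‖ ≤ 1 / 2 ∧
      ∀ b ∈ Metric.ball (0 : ℂ × ℂ) ε,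
        ‖petalIncrement k δ a - petalIncrement k δ b‖ ≤ L * (‖a.1 - b.1‖ + ‖a.2 - b.2‖) ∧
        ‖petalSlope k δ a - petalSlope k δ b‖ ≤ ρ * ‖a.2 - b.2‖ + 3 * ‖a.1 - b.1‖ := by
  have hH := contDiffAt_petalIncrement (k := k) (δ := δ)
  have hM : ContDiffAt ℂ 1 (fun a : ℂ × ℂ => petalIncrement k δ a * (1 + δ * a.2)) 0 := by
    fun_prop
  obtain ⟨K₁, s₁, hs₁, h₁⟩ := hH.exists_lipschitzOnWith
  obtain ⟨K₂, s₂, hs₂, h₂⟩ := hM.exists_lipschitzOnWith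
  have e₁ : ∀ᶠ a in 𝓝 (0 : ℂ × ℂ), 1 + a.1 * blowupFactor k δ a ≠ 0 := by
    have hc : ContinuousAt (fun a : ℂ × ℂ => 1 + a.1 * blowupFactor k δ a) 0 := by
      have := (contDiff_blowupFactor (k := k) (δ := δ)).continuous
      fun_prop
    exact hc.eventually_ne (by simp)
  have e₂ : ∀ᶠ a in 𝓝 (0 : ℂ × ℂ), ‖petalIncrement k δ a - 1‖ < 1 / 2 := by
    have hc : ContinuousAt (fun a => ‖petalIncrement k δ a - 1‖) 0 := by
      have := hH.continuousAt
      fun_prop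
    exact hc.eventually_lt_const (by simp [petalIncrement_zero hk])
  have e₃ : ∀ᶠ a in 𝓝 (0 : ℂ × ℂ), ‖petalIncrement k δ a * (1 + δ * a.2)‖ < 2 := by
    exact hM.continuousAt.norm.eventually_lt_const (by simp [petalIncrement_zero hk])
  obtain ⟨η, hη, hball⟩ := Metric.mem_nhds_iff.1
    (inter_mem (inter_mem hs₁ hs₂) ((e₁.and e₂).and e₃))
  have hδ1 : 0 < (1 - ‖δ‖) / 2 := by linarith
  set ε := min η (min (((1 - ‖δ‖) / 2) / (K₂ + 1)) 1) with hε
  have hε0 : 0 < ε := by positivity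
  have hεK : ε * K₂ ≤ (1 - ‖δ‖) / 2 := by
    have h : ε ≤ ((1 - ‖δ‖) / 2) / (K₂ + 1) := (min_le_right _ _).trans (min_le_left _ _)
    rw [le_div_iff₀ (by positivity)] at h
    nlinarith
  have hnorm : ∀ a b : ℂ × ℂ, ‖a - b‖ ≤ ‖a.1 - b.1‖ + ‖a.2 - b.2‖ := fun a b => by
    rw [Prod.norm_def]
    exact max_le_add_of_nonneg (norm_nonneg _) (norm_nonneg _)
  refine ⟨ε, hε0, K₁, K₁.2, (1 + ‖δ‖) / 2, by positivity, by linarith, fun a ha => ?_⟩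
  obtain ⟨⟨ha₁, ha₂⟩, ⟨ha₃, ha₄⟩, ha₅⟩ := hball (Metric.ball_subset_ball (min_le_left _ _) ha)
  refine ⟨ha₃, ha₄.le, fun b hb => ?_⟩
  obtain ⟨⟨hb₁, hb₂⟩, -⟩ := hball (Metric.ball_subset_ball (min_le_left _ _) hb)
  constructor
  · refine (h₁.norm_sub_le ha₁ hb₁).trans ?_
    gcongr
    exact hnorm a b
  · have hl := (h₂.norm_sub_le ha₂ hb₂).trans (mul_le_mul_of_nonneg_left (hnorm a b) K₂.2)
    have hb1 : ‖b.1‖ ≤ ε := (norm_fst_le b).trans (mem_ball_zero_iff.1 hb).le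
    have heq : petalSlope k δ a - petalSlope k δ b = δ * (a.2 - b.2) -
        (a.1 - b.1) * (petalIncrement k δ a * (1 + δ * a.2)) -
        b.1 * (petalIncrement k δ a * (1 + δ * a.2) - petalIncrement k δ b * (1 + δ * b.2)) := by
      simp only [petalSlope]; ring
    rw [heq]
    have t1 : ‖(a.1 - b.1) * (petalIncrement k δ a * (1 + δ * a.2))‖ ≤ ‖a.1 - b.1‖ * 2 := by
      rw [norm_mul]; gcongr
    have t2 : ‖b.1 * (petalIncrement k δ a * (1 + δ * a.2) -
        petalIncrement k δ b * (1 + δ * b.2))‖ ≤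
        (1 - ‖δ‖) / 2 * (‖a.1 - b.1‖ + ‖a.2 - b.2‖) := by
      rw [norm_mul]
      calc _ ≤ ε * (K₂ * (‖a.1 - b.1‖ + ‖a.2 - b.2‖)) :=
            mul_le_mul hb1 hl (norm_nonneg _) hε0.le
        _ = ε * K₂ * (‖a.1 - b.1‖ + ‖a.2 - b.2‖) := by ring
        _ ≤ _ := by gcongr
    have t3 := norm_sub_le (δ * (a.2 - b.2) -
      (a.1 - b.1) * (petalIncrement k δ a * (1 + δ * a.2))) (b.1 *
        (petalIncrement k δ a * (1 + δ * a.2) - petalIncrement k δ b * (1 + δ * b.2)))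
    have t4 := norm_sub_le (δ * (a.2 - b.2))
      ((a.1 - b.1) * (petalIncrement k δ a * (1 + δ * a.2)))
    rw [norm_mul δ] at t4
    nlinarith [norm_nonneg (a.1 - b.1), norm_nonneg (a.2 - b.2), norm_nonneg δ]

/-- The blown-up coordinates `(z, x / z)`. -/
noncomputable def blowup (p : ℂ × ℂ) : ℂ × ℂ := (p.1, p.2 / p.1)

section OneStep

variable {p : ℂ × ℂ}

theorem semiParabolicMap_fst_eq (hz : p.1 ≠ 0) : (semiParabolicMap (X ^ 2 * k) δ p).1 =
    p.1 * (1 + p.1 * blowupFactor k δ (blowup p)) := by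
  have h : p.1 + δ * p.2 = p.1 * (1 + δ * (p.2 / p.1)) := by field_simp
  simp only [semiParabolicMap, blowupFactor, blowup, h]
  simp
  ring

theorem neg_inv_semiParabolicMap_fst (hz : p.1 ≠ 0)
    (hD : 1 + p.1 * blowupFactor k δ (blowup p) ≠ 0) :
    -(semiParabolicMap (X ^ 2 * k) δ p).1⁻¹ = -p.1⁻¹ + petalIncrement k δ (blowup p) := by
  rw [semiParabolicMap_fst_eq hz]
  simp only [petalIncrement]
  change _ = -p.1⁻¹ + blowupFactor k δ (blowup p) / (1 + p.1 * blowupFactor k δ (blowup p))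
  field_simp
  ring

theorem semiParabolicMap_slope (hz : p.1 ≠ 0)
    (hD : 1 + p.1 * blowupFactor k δ (blowup p) ≠ 0) :
    (semiParabolicMap (X ^ 2 * k) δ p).2 / (semiParabolicMap (X ^ 2 * k) δ p).1 =
      petalSlope k δ (blowup p) := by
  have h2 : (semiParabolicMap (X ^ 2 * k) δ p).2 = p.1 * (δ * (p.2 / p.1) -
      p.1 * blowupFactor k δ (blowup p)) := by
    have h : (semiParabolicMap (X ^ 2 * k) δ p).1 + (semiParabolicMap (X ^ 2 * k) δ p).2 =
        p.1 + δ * p.2 := by simp only [semiParabolicMap]; ring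
    rw [semiParabolicMap_fst_eq hz] at h
    have h' : p.1 * (p.2 / p.1) = p.2 := by field_simp
    linear_combination h - δ * h'
  rw [h2, semiParabolicMap_fst_eq hz, mul_div_mul_left _ _ hz]
  simp only [petalSlope, petalIncrement]
  change _ = δ * (p.2 / p.1) - p.1 * (blowupFactor k δ (blowup p) /
    (1 + p.1 * blowupFactor k δ (blowup p)) * (1 + δ * (p.2 / p.1)))
  generalize blowupFactor k δ (blowup p) = g at *
  generalize p.2 / p.1 = u
  field_simp
  ring

end OneStep

/-- The cone of points close to the parabolic direction. -/
def parabolicCone (ε r : ℝ) : Set (ℂ × ℂ) := {p | ‖p.1‖ < r ∧ ‖p.2‖ < ε * ‖p.1‖}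

/-- The attracting petal, a half plane in the coordinate `-1 / z` thickened to a cone. -/
def petal (ε R : ℝ) : Set (ℂ × ℂ) := {p | R < (-p.1⁻¹).re ∧ ‖p.2‖ < ε * ‖p.1‖}

/-- One-step estimates for a map near a semi-parabolic fixed point, in the coordinates `-1 / z`
and `x / z`. -/
structure PetalEstimates (F : ℂ × ℂ → ℂ × ℂ) (ε R L ρ : ℝ) : Prop where
  eps_pos : 0 < ε
  radius_pos : 0 < R
  lipschitz_nonneg : 0 ≤ L
  rate_nonneg : 0 ≤ ρ
  rate_lt_one : ρ < 1
  cone : ∀ p ∈ parabolicCone ε R⁻¹, ‖(F p).2‖ < ε * ‖(F p).1‖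
  re_add_half_le : ∀ p ∈ parabolicCone ε R⁻¹, (-p.1⁻¹).re + 1 / 2 ≤ (-(F p).1⁻¹).re
  norm_increment_sub_one_le : ∀ p ∈ parabolicCone ε R⁻¹,
    ‖-(F p).1⁻¹ - -p.1⁻¹ - 1‖ ≤ L * (‖p.1‖ + ‖p.2 / p.1‖)
  norm_slope_le : ∀ p ∈ parabolicCone ε R⁻¹, ‖(F p).2 / (F p).1‖ ≤ ρ * ‖p.2 / p.1‖ + 3 * ‖p.1‖
  norm_increment_sub_le : ∀ p ∈ parabolicCone ε R⁻¹, ∀ p' ∈ parabolicCone ε R⁻¹,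
    ‖(-(F p).1⁻¹ - -p.1⁻¹) - (-(F p').1⁻¹ - -p'.1⁻¹)‖ ≤
      L * (‖p.1 - p'.1‖ + ‖p.2 / p.1 - p'.2 / p'.1‖)
  norm_slope_sub_le : ∀ p ∈ parabolicCone ε R⁻¹, ∀ p' ∈ parabolicCone ε R⁻¹,
    ‖(F p).2 / (F p).1 - (F p').2 / (F p').1‖ ≤
      ρ * ‖p.2 / p.1 - p'.2 / p'.1‖ + 3 * ‖p.1 - p'.1‖

theorem fst_ne_zero_of_norm_lt {ε : ℝ} {p : ℂ × ℂ} (h : ‖p.2‖ < ε * ‖p.1‖) : p.1 ≠ 0 := by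
  intro h0
  rw [h0, norm_zero, mul_zero] at h
  exact (norm_nonneg _).not_gt h

theorem norm_slope_lt {ε : ℝ} {p : ℂ × ℂ} (h : ‖p.2‖ < ε * ‖p.1‖) : ‖p.2 / p.1‖ < ε := by
  rwa [norm_div, div_lt_iff₀ (norm_pos_iff.2 (fst_ne_zero_of_norm_lt h))]

theorem exists_petalEstimates (hk : k.eval 0 = 1) (hδ : ‖δ‖ < 1) :
    ∃ ε R L ρ : ℝ, PetalEstimates (semiParabolicMap (X ^ 2 * k) δ) ε R L ρ := by
  obtain ⟨ε, hε, L, hL, ρ, hρ0, hρ1, h⟩ := exists_petal_estimates hk hδ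
  set F := semiParabolicMap (X ^ 2 * k) δ
  have h1ρ : 0 < 1 - ρ := by linarith
  have hR : (4 / ((1 - ρ) * ε))⁻¹ = (1 - ρ) * ε / 4 := inv_div _ _
  have hball : ∀ p ∈ parabolicCone ε (4 / ((1 - ρ) * ε))⁻¹,
      blowup p ∈ Metric.ball (0 : ℂ × ℂ) ε := by
    rintro p ⟨hz, hx⟩
    rw [hR] at hz
    rw [mem_ball_zero_iff, Prod.norm_def, max_lt_iff]
    refine ⟨?_, norm_slope_lt hx⟩
    simp only [blowup]
    nlinarith
  have h0 : (0 : ℂ × ℂ) ∈ Metric.ball (0 : ℂ × ℂ) ε := Metric.mem_ball_self hε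
  have hinc : ∀ p ∈ parabolicCone ε (4 / ((1 - ρ) * ε))⁻¹,
      -(F p).1⁻¹ = -p.1⁻¹ + petalIncrement k δ (blowup p) := fun p hp =>
    neg_inv_semiParabolicMap_fst (fst_ne_zero_of_norm_lt hp.2) (h _ (hball p hp)).1
  have hslope : ∀ p ∈ parabolicCone ε (4 / ((1 - ρ) * ε))⁻¹,
      (F p).2 / (F p).1 = petalSlope k δ (blowup p) := fun p hp =>
    semiParabolicMap_slope (fst_ne_zero_of_norm_lt hp.2) (h _ (hball p hp)).1
  have hslope_le : ∀ p ∈ parabolicCone ε (4 / ((1 - ρ) * ε))⁻¹,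
      ‖(F p).2 / (F p).1‖ ≤ ρ * ‖p.2 / p.1‖ + 3 * ‖p.1‖ := by
    intro p hp
    rw [hslope p hp]
    simpa [petalSlope_zero, blowup] using ((h _ (hball p hp)).2.2 0 h0).2
  refine ⟨ε, 4 / ((1 - ρ) * ε), L, ρ, hε, by positivity, hL, hρ0, hρ1, ?_, ?_, ?_, hslope_le,
    ?_, ?_⟩
  · intro p hp
    have hne : (F p).1 ≠ 0 := by
      rw [semiParabolicMap_fst_eq (fst_ne_zero_of_norm_lt hp.2)]
      exact mul_ne_zero (fst_ne_zero_of_norm_lt hp.2) (h _ (hball p hp)).1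
    rw [← div_lt_iff₀ (norm_pos_iff.2 hne), ← norm_div]
    have h1 := hslope_le p hp
    have h2 := norm_slope_lt hp.2
    have h3 := hp.1
    rw [hR] at h3
    nlinarith
  · intro p hp
    rw [hinc p hp, Complex.add_re]
    have h1 := (h _ (hball p hp)).2.1
    have h2 := (Complex.abs_re_le_norm _).trans h1
    rw [abs_le, Complex.sub_re, Complex.one_re] at h2
    linarith [h2.1]
  · intro p hp
    rw [hinc p hp, add_sub_cancel_left]
    simpa [petalIncrement_zero hk, blowup] using ((h _ (hball p hp)).2.2 0 h0).1
  · intro p hp p' hp'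
    rw [hinc p hp, hinc p' hp', add_sub_cancel_left, add_sub_cancel_left]
    exact ((h _ (hball p hp)).2.2 _ (hball p' hp')).1
  · intro p hp p' hp'
    rw [hslope p hp, hslope p' hp']
    exact ((h _ (hball p hp)).2.2 _ (hball p' hp')).2

end

theorem tendsto_zero_of_le_mul_add {a b : ℕ → ℝ} {ρ : ℝ} (hρ0 : 0 ≤ ρ) (hρ1 : ρ < 1)
    (ha : ∀ n, 0 ≤ a n) (hb : Tendsto b atTop (𝓝 0)) (h : ∀ n, a (n + 1) ≤ ρ * a n + b n) :
    Tendsto a atTop (𝓝 0) := by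
  refine tendsto_order.2 ⟨fun c hc => Eventually.of_forall fun n => hc.trans_le (ha n),
    fun c hc => ?_⟩
  have h1 : 0 < (1 - ρ) * (c / 2) := mul_pos (by linarith) (by linarith)
  obtain ⟨m, hm⟩ := eventually_atTop.1 (hb.eventually_le_const h1)
  have key : ∀ n, a (n + m) - c / 2 ≤ ρ ^ n * (a m - c / 2) := by
    intro n
    induction n with
    | zero => simp
    | succ n ih =>
      have := h (n + m)
      have := hm (n + m) (by omega)
      rw [show n + 1 + m = n + m + 1 by ring, pow_succ']
      nlinarith [mul_le_mul_of_nonneg_left ih hρ0]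
  have ht : Tendsto (fun n => ρ ^ n * (a m - c / 2)) atTop (𝓝 0) := by
    simpa using (tendsto_pow_atTop_nhds_zero_of_lt_one hρ0 hρ1).mul_const (a m - c / 2)
  have hev := ht.eventually_lt_const (half_pos hc)
  obtain ⟨N, hN⟩ := eventually_atTop.1 hev
  filter_upwards [eventually_ge_atTop (N + m)] with n hn
  obtain ⟨j, rfl⟩ : ∃ j, n = j + m := ⟨n - m, by omega⟩
  linarith [key j, hN j (by omega)]

theorem exists_summable_majorant {L ρ A₀ E₀ : ℝ} {b : ℕ → ℝ} (hL : 0 ≤ L) (hρ0 : 0 ≤ ρ)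
    (hρ1 : ρ < 1) (hA : 0 ≤ A₀) (hE : 0 ≤ E₀) (hb0 : ∀ n, 0 ≤ b n) (hb : Summable b) :
    ∃ v : ℕ → ℝ, Summable v ∧ ∀ a e : ℕ → ℝ, a 0 ≤ A₀ → e 0 ≤ E₀ →
      (∀ n, a (n + 1) ≤ a n + L * (b n * a n + e n)) →
      (∀ n, e (n + 1) ≤ ρ * e n + 3 * (b n * a n)) → ∀ n, L * (b n * a n + e n) ≤ v n := by
  obtain ⟨S, hS0, hS1, hS2⟩ : ∃ S : ℕ → ℝ × ℝ, S 0 = (A₀, E₀) ∧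
      (∀ n, (S (n + 1)).1 = (S n).1 + L * (b n * (S n).1 + (S n).2)) ∧
      ∀ n, (S (n + 1)).2 = ρ * (S n).2 + 3 * (b n * (S n).1) :=
    ⟨fun n => Nat.rec (A₀, E₀)
      (fun n s => (s.1 + L * (b n * s.1 + s.2), ρ * s.2 + 3 * (b n * s.1))) n,
      rfl, fun _ => rfl, fun _ => rfl⟩
  have hpos : ∀ n, 0 ≤ (S n).1 ∧ 0 ≤ (S n).2 := by
    intro n
    induction n with
    | zero => simpa [hS0] using ⟨hA, hE⟩
    | succ n ih =>
      have h1 := ih.1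
      have h2 := ih.2
      have h3 := hb0 n
      rw [hS1, hS2]
      constructor <;> positivity
  have h1ρ : 0 < 1 - ρ := by linarith
  set K := L / (1 - ρ) with hK
  have hK0 : 0 ≤ K := by positivity
  have hKρ : L + K * ρ = K := by rw [hK]; field_simp; ring
  have hV : ∀ n, (S n).1 + K * (S n).2 ≤
      (A₀ + K * E₀) * Real.exp ((L + 3 * K) * ∑ i ∈ Finset.range n, b i) := by
    intro n
    induction n with
    | zero => simp [hS0]
    | succ n ih =>
      rw [Finset.sum_range_succ, mul_add (L + 3 * K), Real.exp_add, ← mul_assoc]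
      have h1 : (S (n + 1)).1 + K * (S (n + 1)).2 ≤
          ((S n).1 + K * (S n).2) * ((L + 3 * K) * b n + 1) := by
        rw [hS1, hS2]
        have h2 : 0 ≤ K * (S n).2 * ((L + 3 * K) * b n) := by
          have := (hpos n).2
          have := hb0 n
          positivity
        have h3 : K * (S n).2 = L * (S n).2 + K * ρ * (S n).2 := by rw [← add_mul, hKρ]
        linarith
      refine h1.trans (mul_le_mul ih (Real.add_one_le_exp _) ?_ (by positivity))
      have := hb0 n
      positivity
  have hbound : ∀ n, (S n).1 ≤ (A₀ + K * E₀) * Real.exp ((L + 3 * K) * ∑' i, b i) := by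
    intro n
    have h2 := mul_nonneg hK0 (hpos n).2
    refine le_trans (by linarith) ((hV n).trans ?_)
    gcongr
    exact hb.sum_le_tsum _ fun i _ => hb0 i
  refine ⟨fun n => L * (b n * (S n).1 + (S n).2), ?_, ?_⟩
  · refine summable_of_sum_range_le (c := (A₀ + K * E₀) * Real.exp ((L + 3 * K) * ∑' i, b i))
      (fun n => ?_) fun n => ?_
    · have h1 := (hpos n).1
      have h2 := (hpos n).2
      have h3 := hb0 n
      positivity
    · have : ∀ n, L * (b n * (S n).1 + (S n).2) = (S (n + 1)).1 - (S n).1 := fun n => by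
        rw [hS1]; ring
      simp only [this]
      rw [Finset.sum_range_sub (fun n => (S n).1)]
      have : (S 0).1 = A₀ := by rw [hS0]
      linarith [hbound n, (hpos 0).1]
  · intro a e ha he hae hea n
    have hle : ∀ n, a n ≤ (S n).1 ∧ e n ≤ (S n).2 := by
      intro n
      induction n with
      | zero => simpa [hS0] using ⟨ha, he⟩
      | succ n ih =>
        have h3 := mul_le_mul_of_nonneg_left ih.1 (hb0 n)
        rw [hS1, hS2]
        constructor
        · refine (hae n).trans ?_
          gcongr
          exacts [ih.1, ih.2]
        · refine (hea n).trans ?_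
          gcongr
          exact ih.2
    have h3 := mul_le_mul_of_nonneg_left (hle n).1 (hb0 n)
    exact mul_le_mul_of_nonneg_left (add_le_add h3 (hle n).2) hL

theorem differentiableAt_tsum_of_norm_le {E : Type*} [NormedAddCommGroup E] [NormedSpace ℂ E]
    {f : ℕ → E → ℂ} {v : ℕ → ℝ} {c : E} {r : ℝ} (hr : 0 < r) (hv : Summable v)
    (hf : ∀ n, DifferentiableOn ℂ (f n) (Metric.ball c r))
    (hle : ∀ n, ∀ y ∈ Metric.ball c r, ‖f n y‖ ≤ v n) :
    DifferentiableAt ℂ (fun y => ∑' n, f n y) c := by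
  have hsub : ∀ y ∈ Metric.ball c (r / 2), Metric.ball y (r / 2) ⊆ Metric.ball c r := by
    intro y hy
    refine Metric.ball_subset_ball' ?_
    linarith [Metric.mem_ball.1 hy]
  have hbd : ∀ n, ∀ y ∈ Metric.ball c (r / 2), ‖fderiv ℂ (f n) y‖ ≤ 2 * v n / (r / 2) := by
    intro n y hy
    refine Complex.norm_fderiv_le_div_of_mapsTo_ball ((hf n).mono (hsub y hy)) ?_ (half_pos hr)
    intro z hz
    have h1 := hle n z (hsub y hy hz)
    have h2 := hle n y (hsub y hy (Metric.mem_ball_self (half_pos hr)))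
    rw [mem_closedBall_iff_norm]
    linarith [norm_sub_le (f n z) (f n y)]
  have hc : c ∈ Metric.ball c (r / 2) := Metric.mem_ball_self (half_pos hr)
  refine (hasFDerivAt_tsum_of_isPreconnected (u := fun n => 2 * v n / (r / 2))
    (f' := fun n => fderiv ℂ (f n)) ((hv.mul_left 2).div_const _) Metric.isOpen_ball
    (convex_ball c (r / 2)).isPreconnected ?_ hbd hc ?_ hc).differentiableAt
  · intro n y hy
    have hy' : y ∈ Metric.ball c r := hsub y hy (Metric.mem_ball_self (half_pos hr))
    exact ((hf n).differentiableAt (Metric.isOpen_ball.mem_nhds hy')).hasFDerivAt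
  · exact Summable.of_norm_bounded hv fun n => hle n c (Metric.mem_ball_self hr)

namespace PetalEstimates

variable {F : ℂ × ℂ → ℂ × ℂ} {ε R L ρ : ℝ}

theorem norm_fst_lt_inv_of_mem_petal {s : ℝ} (hs : 0 < s) {p : ℂ × ℂ} (hp : p ∈ petal ε s) :
    ‖p.1‖ < s⁻¹ := by
  have h := hp.1.trans_le ((Complex.re_le_norm _).trans_eq (by rw [norm_neg, norm_inv]))
  have hz : 0 < ‖p.1‖ := norm_pos_iff.2 (fst_ne_zero_of_norm_lt hp.2)
  exact (lt_inv_comm₀ hs hz).1 h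

theorem isOpen_petal : IsOpen (petal ε R) := by
  rw [isOpen_iff_mem_nhds]
  intro p hp
  have hz := fst_ne_zero_of_norm_lt hp.2
  have h1 : ContinuousAt (fun p : ℂ × ℂ => (-p.1⁻¹).re) p :=
    Complex.continuous_re.continuousAt.comp (continuousAt_fst.inv₀ hz).neg
  have h2 : ContinuousAt (fun p : ℂ × ℂ => ε * ‖p.1‖ - ‖p.2‖) p := by fun_prop
  filter_upwards [h1.eventually_const_lt hp.1, h2.eventually_const_lt (sub_pos.2 hp.2)]
    with y hy1 hy2
  exact ⟨hy1, sub_pos.1 hy2⟩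

variable (h : PetalEstimates F ε R L ρ)
include h

theorem mem_cone_of_mem_petal {s : ℝ} (hs : R ≤ s) {p : ℂ × ℂ} (hp : p ∈ petal ε s) :
    p ∈ parabolicCone ε R⁻¹ :=
  ⟨(norm_fst_lt_inv_of_mem_petal (h.radius_pos.trans_le hs) hp).trans_le
    (inv_anti₀ h.radius_pos hs), hp.2⟩

theorem iterate_mem_petal {p : ℂ × ℂ} (hp : p ∈ petal ε R) (n : ℕ) :
    F^[n] p ∈ petal ε (R + n / 2) := by
  induction n with
  | zero => simpa using hp
  | succ n ih =>
    have hc := h.mem_cone_of_mem_petal (by linarith [n.cast_nonneg (α := ℝ)]) ih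
    rw [Function.iterate_succ_apply']
    refine ⟨?_, h.cone _ hc⟩
    have := h.re_add_half_le _ hc
    have := ih.1
    push_cast
    linarith

theorem iterate_mem_cone {p : ℂ × ℂ} (hp : p ∈ petal ε R) (n : ℕ) :
    F^[n] p ∈ parabolicCone ε R⁻¹ :=
  h.mem_cone_of_mem_petal (by linarith [n.cast_nonneg (α := ℝ)]) (h.iterate_mem_petal hp n)

theorem norm_iterate_fst_le {p : ℂ × ℂ} (hp : p ∈ petal ε R) (n : ℕ) :
    ‖(F^[n] p).1‖ ≤ (R + n / 2)⁻¹ :=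
  (norm_fst_lt_inv_of_mem_petal (add_pos_of_pos_of_nonneg h.radius_pos (by positivity))
    (h.iterate_mem_petal hp n)).le

omit h in
theorem tendsto_inv_add_half : Tendsto (fun n : ℕ => (R + n / 2 : ℝ)⁻¹) atTop (𝓝 0) := by
  refine tendsto_inv_atTop_zero.comp (tendsto_atTop_add_const_left _ _ ?_)
  exact tendsto_natCast_atTop_atTop.atTop_div_const two_pos

theorem tendsto_norm_iterate_fst {p : ℂ × ℂ} (hp : p ∈ petal ε R) :
    Tendsto (fun n => ‖(F^[n] p).1‖) atTop (𝓝 0) :=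
  squeeze_zero (fun _ => norm_nonneg _) (h.norm_iterate_fst_le hp) tendsto_inv_add_half

theorem petal_subset_attractedSet : petal ε R ⊆ attractedSet F 0 := by
  intro p hp
  have h1 := h.tendsto_norm_iterate_fst hp
  have h2 : Tendsto (fun n => ‖(F^[n] p).2‖) atTop (𝓝 0) := by
    refine squeeze_zero (fun _ => norm_nonneg _) (fun n => (h.iterate_mem_petal hp n).2.le) ?_
    simpa using h1.const_mul ε
  exact (tendsto_zero_iff_norm_tendsto_zero.2 h1).prodMk_nhds
    (tendsto_zero_iff_norm_tendsto_zero.2 h2)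

theorem petal_subset_interior : petal ε R ⊆ interior (attractedSet F 0) :=
  interior_maximal h.petal_subset_attractedSet isOpen_petal

theorem basePoint_mem_petal : (((-(2 * R)⁻¹ : ℝ) : ℂ), (0 : ℂ)) ∈ petal ε R := by
  have := h.radius_pos
  have := h.eps_pos
  constructor
  · simp only [← Complex.ofReal_inv, ← Complex.ofReal_neg, Complex.ofReal_re, inv_neg, inv_inv,
      neg_neg]
    linarith
  · simp only [norm_zero, Complex.norm_real]
    have : ‖-(2 * R)⁻¹‖ ≠ 0 := norm_ne_zero_iff.2 (by simp; positivity)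
    positivity

theorem exists_iterate_mem_petal {p : ℂ × ℂ} (hp : p ∈ attractedSet F 0)
    (hf : ∃ᶠ n in atTop, ‖(F^[n] p).2‖ < ε * ‖(F^[n] p).1‖) : ∃ N, F^[N] p ∈ petal ε R := by
  have hz : Tendsto (fun n => ‖(F^[n] p).1‖) atTop (𝓝 0) := by
    simpa using! (continuous_fst.norm.tendsto (0 : ℂ × ℂ)).comp hp
  obtain ⟨m, hm⟩ := eventually_atTop.1 (hz.eventually_lt_const (inv_pos.2 h.radius_pos))
  obtain ⟨n₀, hn₀, hcone⟩ := frequently_atTop.1 hf m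
  have key : ∀ j : ℕ, F^[j + n₀] p ∈ parabolicCone ε R⁻¹ ∧
      (-(F^[n₀] p).1⁻¹).re + j / 2 ≤ (-(F^[j + n₀] p).1⁻¹).re := by
    intro j
    induction j with
    | zero => exact ⟨⟨hm _ (by omega), by simpa using hcone⟩, by simp⟩
    | succ j ih =>
      have hs : F^[j + 1 + n₀] p = F (F^[j + n₀] p) := by
        rw [show j + 1 + n₀ = j + n₀ + 1 by ring, Function.iterate_succ_apply']
      refine ⟨⟨hm _ (by omega), ?_⟩, ?_⟩
      · rw [hs]
        exact h.cone _ ih.1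
      · rw [hs]
        have := h.re_add_half_le _ ih.1
        push_cast
        linarith [ih.2]
  obtain ⟨j, hj⟩ := exists_nat_gt (2 * (R - (-(F^[n₀] p).1⁻¹).re))
  refine ⟨j + n₀, ?_, (key j).1.2⟩
  linarith [(key j).2]

theorem tendsto_increment {p : ℂ × ℂ} (hp : p ∈ petal ε R) :
    Tendsto (fun n => -(F^[n + 1] p).1⁻¹ - -(F^[n] p).1⁻¹) atTop (𝓝 1) := by
  have hz := h.tendsto_norm_iterate_fst hp
  have hu : Tendsto (fun n => ‖(F^[n] p).2 / (F^[n] p).1‖) atTop (𝓝 0) := by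
    refine tendsto_zero_of_le_mul_add h.rate_nonneg h.rate_lt_one (fun _ => norm_nonneg _)
      (b := fun n => 3 * ‖(F^[n] p).1‖) (by simpa using hz.const_mul 3) fun n => ?_
    rw [Function.iterate_succ_apply']
    exact h.norm_slope_le _ (h.iterate_mem_cone hp n)
  rw [tendsto_iff_norm_sub_tendsto_zero]
  refine squeeze_zero (fun _ => norm_nonneg _)
    (g := fun n => L * (‖(F^[n] p).1‖ + ‖(F^[n] p).2 / (F^[n] p).1‖)) (fun n => ?_)
    (by simpa using (hz.add hu).const_mul L)
  rw [Function.iterate_succ_apply']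
  exact h.norm_increment_sub_one_le _ (h.iterate_mem_cone hp n)

omit h in
theorem summable_inv_sq (hR : 0 < R) : Summable fun n : ℕ => ((R + n / 2 : ℝ)⁻¹) ^ 2 := by
  refine (summable_nat_add_iff 1).1 (Summable.of_nonneg_of_le (fun n => sq_nonneg _) (fun n => ?_)
    (((summable_nat_add_iff 1).2 (Real.summable_one_div_nat_pow.2 one_lt_two)).mul_left 4))
  have hn : (0 : ℝ) < ((n + 1 : ℕ) : ℝ) := by positivity
  calc ((R + ((n + 1 : ℕ) : ℝ) / 2)⁻¹) ^ 2 ≤ ((((n + 1 : ℕ) : ℝ) / 2)⁻¹) ^ 2 := by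
        gcongr
        linarith
    _ = 4 * (1 / ((n + 1 : ℕ) : ℝ) ^ 2) := by
        field_simp
        norm_num

/-- Along the orbits of two points of the petal, the differences of the coordinates `-1 / z`
converge at a summable rate depending only on their initial distance. -/
theorem exists_summable_bound {A₀ : ℝ} (hA : 0 ≤ A₀) : ∃ v : ℕ → ℝ, Summable v ∧
    ∀ p ∈ petal ε R, ∀ p' ∈ petal ε R, ‖-p.1⁻¹ - -p'.1⁻¹‖ ≤ A₀ → ∀ n,
      ‖(-(F^[n + 1] p).1⁻¹ - -(F^[n + 1] p').1⁻¹) - (-(F^[n] p).1⁻¹ - -(F^[n] p').1⁻¹)‖ ≤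
        v n := by
  obtain ⟨v, hv, hmaj⟩ := exists_summable_majorant h.lipschitz_nonneg h.rate_nonneg
    h.rate_lt_one hA (E₀ := 2 * ε) (by linarith [h.eps_pos]) (fun n => sq_nonneg _)
    (summable_inv_sq h.radius_pos)
  refine ⟨v, hv, fun p hp p' hp' hA' => ?_⟩
  have hz : ∀ n, ‖(F^[n] p).1 - (F^[n] p').1‖ ≤
      ((R + n / 2 : ℝ)⁻¹) ^ 2 * ‖-(F^[n] p).1⁻¹ - -(F^[n] p').1⁻¹‖ := by
    intro n
    have h1 := fst_ne_zero_of_norm_lt (h.iterate_mem_petal hp n).2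
    have h2 := fst_ne_zero_of_norm_lt (h.iterate_mem_petal hp' n).2
    have heq : (F^[n] p).1 - (F^[n] p').1 = (F^[n] p).1 * (F^[n] p').1 *
        (-(F^[n] p).1⁻¹ - -(F^[n] p').1⁻¹) := by
      field_simp
      ring
    conv_lhs => rw [heq]
    rw [norm_mul, norm_mul, sq]
    have := h.radius_pos
    gcongr
    exacts [h.norm_iterate_fst_le hp n, h.norm_iterate_fst_le hp' n]
  have hstep : ∀ n,
      ‖(-(F^[n + 1] p).1⁻¹ - -(F^[n + 1] p').1⁻¹) - (-(F^[n] p).1⁻¹ - -(F^[n] p').1⁻¹)‖ ≤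
      L * (((R + n / 2 : ℝ)⁻¹) ^ 2 * ‖-(F^[n] p).1⁻¹ - -(F^[n] p').1⁻¹‖ +
        ‖(F^[n] p).2 / (F^[n] p).1 - (F^[n] p').2 / (F^[n] p').1‖) := by
    intro n
    have h1 := h.norm_increment_sub_le _ (h.iterate_mem_cone hp n) _ (h.iterate_mem_cone hp' n)
    rw [← Function.iterate_succ_apply' F n p, ← Function.iterate_succ_apply' F n p',
      sub_sub_sub_comm] at h1
    refine h1.trans (mul_le_mul_of_nonneg_left ?_ h.lipschitz_nonneg)
    gcongr
    exact hz n
  intro n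
  refine (hstep n).trans (hmaj (fun n => ‖-(F^[n] p).1⁻¹ - -(F^[n] p').1⁻¹‖)
    (fun n => ‖(F^[n] p).2 / (F^[n] p).1 - (F^[n] p').2 / (F^[n] p').1‖) hA' ?_ ?_ ?_ n)
  · have h1 := norm_slope_lt hp.2
    have h2 := norm_slope_lt hp'.2
    exact (norm_sub_le _ _).trans (by
      simp only [Function.iterate_zero_apply]
      linarith)
  · intro n
    have h1 := norm_le_insert' (-(F^[n + 1] p).1⁻¹ - -(F^[n + 1] p').1⁻¹)
      (-(F^[n] p).1⁻¹ - -(F^[n] p').1⁻¹)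
    exact h1.trans (by gcongr; exact hstep n)
  · intro n
    have h1 := h.norm_slope_sub_le _ (h.iterate_mem_cone hp n) _ (h.iterate_mem_cone hp' n)
    rw [← Function.iterate_succ_apply' F n p, ← Function.iterate_succ_apply' F n p'] at h1
    exact h1.trans (by gcongr; exact hz n)

/-- On the petal, the normalized coordinates `-1 / z` along orbits converge to a holomorphic
function. -/
theorem exists_differentiableAt_limit (hF : Differentiable ℂ F) {p₀ : ℂ × ℂ}
    (hp₀ : p₀ ∈ petal ε R) : ∃ Ψ : ℂ × ℂ → ℂ, ∀ p ∈ petal ε R, DifferentiableAt ℂ Ψ p ∧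
      Tendsto (fun n => -(F^[n] p).1⁻¹ - -(F^[n] p₀).1⁻¹) atTop (𝓝 (Ψ p)) := by
  set D : ℕ → ℂ × ℂ → ℂ := fun n p => -(F^[n] p).1⁻¹ - -(F^[n] p₀).1⁻¹ with hD
  have hDdiff : ∀ n, ∀ p ∈ petal ε R, DifferentiableAt ℂ (D n) p := by
    intro n p hp
    have h1 : DifferentiableAt ℂ (fun p => (F^[n] p).1) p :=
      (differentiable_fst.comp (hF.iterate n)) p
    exact (h1.inv (fst_ne_zero_of_norm_lt (h.iterate_mem_petal hp n).2)).neg.sub_const _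
  refine ⟨fun p => D 0 p + ∑' n, (D (n + 1) p - D n p), fun p hp => ⟨?_, ?_⟩⟩
  · obtain ⟨v, hv, hle⟩ := h.exists_summable_bound (A₀ := ‖D 0 p‖ + 1) (by positivity)
    have hev : ∀ᶠ y in 𝓝 p, ‖D 0 y‖ < ‖D 0 p‖ + 1 :=
      (hDdiff 0 p hp).continuousAt.norm.eventually_lt_const (lt_add_one _)
    obtain ⟨r, hr, hball⟩ := Metric.mem_nhds_iff.1 (inter_mem (isOpen_petal.mem_nhds hp) hev)
    refine (hDdiff 0 p hp).add (differentiableAt_tsum_of_norm_le hr hv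
      (f := fun n p => D (n + 1) p - D n p) (fun n y hy => ?_) fun n y hy => ?_)
    · have hy' := (hball hy).1
      exact ((hDdiff (n + 1) y hy').sub (hDdiff n y hy')).differentiableWithinAt
    · exact hle y (hball hy).1 p₀ hp₀ (hball hy).2.le n
  · obtain ⟨v, hv, hle⟩ := h.exists_summable_bound (norm_nonneg (D 0 p))
    have hs : Summable fun n => D (n + 1) p - D n p :=
      Summable.of_norm_bounded hv (hle p hp p₀ hp₀ le_rfl)
    have ht := hs.hasSum.tendsto_sum_nat.const_add (D 0 p)
    simp only [Finset.sum_range_sub (fun n => D n p), add_sub_cancel] at ht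
    exact ht

/-- A holomorphic Fatou coordinate on an open set whose points eventually enter the petal. -/
theorem exists_fatouCoordinate (hF : Differentiable ℂ F) {B : Set (ℂ × ℂ)}
    (hB : ∀ p ∈ B, ∃ N, F^[N] p ∈ petal ε R) :
    ∃ Φ : ℂ × ℂ → ℂ, DifferentiableOn ℂ Φ B ∧ ∀ p ∈ B, Φ (F p) = Φ p + 1 := by
  set p₀ : ℂ × ℂ := (((-(2 * R)⁻¹ : ℝ) : ℂ), 0)
  have hp₀ : p₀ ∈ petal ε R := h.basePoint_mem_petal
  obtain ⟨Ψ, hΨ⟩ := h.exists_differentiableAt_limit hF hp₀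
  set D : ℕ → ℂ × ℂ → ℂ := fun n p => -(F^[n] p).1⁻¹ - -(F^[n] p₀).1⁻¹ with hD
  have hN : ∀ N p, F^[N] p ∈ petal ε R →
      Tendsto (fun n => D n p) atTop (𝓝 (Ψ (F^[N] p) - N)) := by
    intro N
    induction N with
    | zero =>
      intro p hp
      simpa only [hD, Nat.cast_zero, sub_zero, Function.iterate_zero_apply] using (hΨ p hp).2
    | succ N ih =>
      intro p hp
      rw [Function.iterate_succ_apply] at hp ⊢
      have h1 := ih (F p) hp
      have hinc : Tendsto (fun n => -(F^[n + 1] p).1⁻¹ - -(F^[n] p).1⁻¹) atTop (𝓝 1) := by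
        refine (tendsto_add_atTop_iff_nat (N + 1)).1 ((h.tendsto_increment hp).congr fun n => ?_)
        rw [← Function.iterate_succ_apply F N p, ← Function.iterate_add_apply,
          ← Function.iterate_add_apply, show n + 1 + (N + 1) = n + (N + 1) + 1 by ring]
      refine ((h1.sub hinc).congr fun n => ?_).trans_eq ?_
      · simp only [hD, Function.iterate_succ_apply]
        ring
      · push_cast
        ring_nf
  refine ⟨fun p => limUnder atTop fun n => D n p, fun p hp => ?_, fun p hp => ?_⟩
  · obtain ⟨N, hNp⟩ := hB p hp
    have hd : DifferentiableAt ℂ (fun y => Ψ (F^[N] y) - N) p :=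
      ((hΨ _ hNp).1.comp p (hF.iterate N p)).sub_const _
    refine (hd.congr_of_eventuallyEq ?_).differentiableWithinAt
    filter_upwards [(hF.iterate N).continuous.continuousAt (isOpen_petal.mem_nhds hNp)] with y hy
    exact (hN N y hy).limUnder_eq
  · obtain ⟨N, hNp⟩ := hB p hp
    have hs : F^[N + 1] p ∈ petal ε R := by
      rw [Function.iterate_succ_apply']
      have h1 := h.iterate_mem_petal hNp 1
      rw [Function.iterate_one] at h1
      exact ⟨by linarith [h1.1, Nat.cast_one (R := ℝ)], h1.2⟩
    have h1 := (hN (N + 1) p hs).limUnder_eq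
    rw [Function.iterate_succ_apply] at hs h1
    simp only [h1, (hN N (F p) hs).limUnder_eq]
    push_cast
    ring

end PetalEstimates

/-- For a polynomial `q(z) = z² + O(z³)` and `|δ| < 1`, the interior `B` of the
set of points attracted to the origin under `F_δ` (the parabolic basin) is nonempty, forward
invariant, and carries a holomorphic attracting Fatou coordinate `Φ : B → ℂ` satisfying the
Abel equation `Φ(F_δ(p)) = Φ(p) + 1` on `B`. -/
theorem stmt_4 (q : Polynomial ℂ)
    (hq0 : q.eval 0 = 0) (hq1 : q.derivative.eval 0 = 0)
    (hq2 : q.derivative.derivative.eval 0 = 2)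
    (δ : ℂ) (hδ : ‖δ‖ < 1)
    (F : ℂ × ℂ → ℂ × ℂ)
    (hF : F = fun p => (p.1 + q.eval (p.1 + δ * p.2), δ * p.2 - q.eval (p.1 + δ * p.2)))
    (B : Set (ℂ × ℂ))
    (hB : B = interior {p : ℂ × ℂ |
      Filter.Tendsto (fun n => F^[n] p) Filter.atTop (nhds ((0, 0) : ℂ × ℂ))}) :
    B.Nonempty ∧ Set.MapsTo F B B ∧
      ∃ Φ : ℂ × ℂ → ℂ, DifferentiableOn ℂ Φ B ∧ ∀ p ∈ B, Φ (F p) = Φ p + 1 := by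
  obtain ⟨k, rfl, hk⟩ := exists_eq_X_sq_mul hq0 hq1 hq2
  have hk0 : k ≠ 0 := by
    rintro rfl
    simp at hk
  replace hF : F = semiParabolicMap (X ^ 2 * k) δ := hF
  replace hB : B = interior (attractedSet F 0) := hB
  subst hF hB
  obtain ⟨ε, R, L, ρ, h⟩ := exists_petalEstimates hk hδ
  exact ⟨⟨_, h.petal_subset_interior h.basePoint_mem_petal⟩, mapsTo_interior_attractedSet,
    h.exists_fatouCoordinate differentiable_semiParabolicMap fun p hp =>
      h.exists_iterate_mem_petal (interior_subset hp)
        (frequently_mem_cone hk0 hδ hp h.eps_pos)⟩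
end

section
/- Let q be a polynomial with q(0) = 0, q'(0) = 0 and q''(0) = 2, and let δ ∈ ℂ with |δ| < 1. Then there exist R > 0 and a holomorphic map Ψ : ℂ → ℂ² (a repelling Fatou coordinate) such that F_δ(Ψ(Z)) = Ψ(Z + 1) for all Z ∈ ℂ, Ψ is injective on the half-plane {Z ∈ ℂ : Re Z < −R}, and Ψ(Z) → (0,0) as Re Z → −∞. -/
open Filter Topology

namespace FatouCoordinate

lemma mul_rpow_add_one_le {u : ℝ} (hu : 0 < u) :
    5 / 2 * (u + 1) ^ (-(7 / 2) : ℝ) ≤ u ^ (-(5 / 2) : ℝ) - (u + 1) ^ (-(5 / 2) : ℝ) := by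
  have hB := one_add_mul_self_le_rpow_one_add (s := 1 / u) (p := 5 / 2)
    (by have := one_div_pos.2 hu; linarith) (by norm_num)
  have h1 : 1 + 1 / u = (u + 1) / u := by field_simp
  rw [h1, Real.div_rpow (by linarith) hu.le] at hB
  have hU : 0 < u ^ (5 / 2 : ℝ) := Real.rpow_pos_of_pos hu _
  have hV : 0 < (u + 1) ^ (5 / 2 : ℝ) := Real.rpow_pos_of_pos (by linarith) _
  have h7 : (u + 1) ^ (-(7 / 2) : ℝ) = ((u + 1) ^ (5 / 2 : ℝ))⁻¹ * (u + 1)⁻¹ := by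
    rw [← Real.rpow_neg (by linarith), ← Real.rpow_neg_one (u + 1),
      ← Real.rpow_add (by linarith)]
    norm_num
  rw [h7, Real.rpow_neg hu.le, Real.rpow_neg (by linarith)]
  set V := (u + 1) ^ (5 / 2 : ℝ)
  set U := u ^ (5 / 2 : ℝ)
  have h2 : 1 / (u + 1) ≤ 1 / u := one_div_le_one_div_of_le hu (by linarith)
  have h3 : 1 + 5 / 2 * (u + 1)⁻¹ ≤ V / U := by
    rw [← one_div]; linarith
  have h4 := mul_le_mul_of_nonneg_left h3 (inv_pos.2 hV).le
  have h5 : V⁻¹ * (V / U) = U⁻¹ := by field_simp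
  rw [h5] at h4
  linarith

lemma sum_range_rpow_le {u : ℝ} (hu : 0 < u) (n : ℕ) :
    ∑ k ∈ Finset.range n, (u + (k + 1)) ^ (-(7 / 2) : ℝ) ≤ 2 / 5 * u ^ (-(5 / 2) : ℝ) := by
  have key : ∑ k ∈ Finset.range n, (u + (k + 1)) ^ (-(7 / 2) : ℝ) ≤
      2 / 5 * (u ^ (-(5 / 2) : ℝ) - (u + n) ^ (-(5 / 2) : ℝ)) := by
    induction n with
    | zero => simp
    | succ n ih =>
      rw [Finset.sum_range_succ]
      have := mul_rpow_add_one_le (u := u + n) (by positivity)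
      push_cast
      rw [← add_assoc u]
      linarith
  have : 0 ≤ (u + n) ^ (-(5 / 2) : ℝ) := Real.rpow_nonneg (by positivity) _
  linarith

lemma summable_rpow {u : ℝ} (hu : 0 < u) :
    Summable fun k : ℕ => (u + (k + 1)) ^ (-(7 / 2) : ℝ) :=
  summable_of_sum_range_le (fun _ => Real.rpow_nonneg (by positivity) _) (sum_range_rpow_le hu)

lemma tsum_rpow_le {u : ℝ} (hu : 0 < u) :
    ∑' k : ℕ, (u + (k + 1)) ^ (-(7 / 2) : ℝ) ≤ 2 / 5 * u ^ (-(5 / 2) : ℝ) :=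
  Real.tsum_le_of_sum_range_le (fun _ => Real.rpow_nonneg (by positivity) _) (sum_range_rpow_le hu)

lemma rpow_seven_halves {u : ℝ} (hu : 0 < u) :
    u ^ (-(7 / 2) : ℝ) = 1 / u * u ^ (-(5 / 2) : ℝ) := by
  rw [one_div, ← Real.rpow_neg_one u, ← Real.rpow_add hu]
  norm_num

/-- The open left half-plane `{Re Z < -R}`. -/
def leftHalfPlane (R : ℝ) : Set ℂ := {Z | Z.re < -R}

lemma mem_leftHalfPlane {R : ℝ} {Z : ℂ} : Z ∈ leftHalfPlane R ↔ Z.re < -R := Iff.rfl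

lemma isOpen_leftHalfPlane (R : ℝ) : IsOpen (leftHalfPlane R) :=
  isOpen_lt Complex.continuous_re continuous_const

lemma convex_leftHalfPlane (R : ℝ) : Convex ℝ (leftHalfPlane R) := convex_halfSpace_re_lt _

lemma sub_mem_leftHalfPlane {R : ℝ} {Z : ℂ} (hZ : Z ∈ leftHalfPlane R) (k : ℕ) :
    Z - k ∈ leftHalfPlane R := by
  have : (0 : ℝ) ≤ k := k.cast_nonneg
  simp only [mem_leftHalfPlane, Complex.sub_re, Complex.natCast_re] at hZ ⊢
  linarith

lemma sub_succ_mem_leftHalfPlane {R : ℝ} {Z : ℂ} (hZ : Z ∈ leftHalfPlane R) (k : ℕ) :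
    Z - (k + 1) ∈ leftHalfPlane R := by
  exact_mod_cast sub_mem_leftHalfPlane hZ (k + 1)

/-- The inverse of `h ↦ (h (Z + 1) - (1 + δ) * h Z + δ * h (Z - 1)) / (1 - δ)` on functions
decaying to the left. -/
noncomputable def shiftSum (δ : ℂ) (g : ℂ → ℂ) (Z : ℂ) : ℂ :=
  ∑' k : ℕ, (1 - δ ^ (k + 1)) * g (Z - (k + 1))

section shiftSum

variable {δ : ℂ} {R M : ℝ} {g : ℂ → ℂ}

lemma norm_shiftSum_term_le
    (hg : ∀ Z ∈ leftHalfPlane R, ‖g Z‖ ≤ M * (-Z.re) ^ (-(7 / 2) : ℝ))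
    {Z : ℂ} (hZ : Z ∈ leftHalfPlane R) (k : ℕ) :
    ‖(1 - δ ^ (k + 1)) * g (Z - (k + 1))‖ ≤
      (1 + ‖δ‖ ^ (k + 1)) * (M * (-Z.re + (k + 1)) ^ (-(7 / 2) : ℝ)) := by
  rw [norm_mul]
  gcongr
  · calc _ ≤ ‖(1 : ℂ)‖ + ‖δ ^ (k + 1)‖ := norm_sub_le _ _
      _ = _ := by simp
  · refine (hg _ (sub_succ_mem_leftHalfPlane hZ k)).trans_eq ?_
    congr 2
    simp
    ring

lemma nonneg_of_bound (hR : 1 ≤ R)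
    (hg : ∀ Z ∈ leftHalfPlane R, ‖g Z‖ ≤ M * (-Z.re) ^ (-(7 / 2) : ℝ)) : 0 ≤ M := by
  have h := (norm_nonneg _).trans (hg (-(R + 1 : ℝ) : ℂ) (by simp [mem_leftHalfPlane]))
  refine nonneg_of_mul_nonneg_left h (Real.rpow_pos_of_pos ?_ _)
  simp
  linarith

lemma shiftSum_majorant (hδ : ‖δ‖ < 1) (hM : 0 ≤ M) {u : ℝ} (hu : 0 < u) (k : ℕ) :
    (1 + ‖δ‖ ^ (k + 1)) * (M * (u + (k + 1)) ^ (-(7 / 2) : ℝ)) ≤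
      M * (u + (k + 1)) ^ (-(7 / 2) : ℝ) + M * u ^ (-(7 / 2) : ℝ) * ‖δ‖ ^ k := by
  have h1 : (u + (k + 1)) ^ (-(7 / 2) : ℝ) ≤ u ^ (-(7 / 2) : ℝ) :=
    Real.rpow_le_rpow_of_nonpos hu (by linarith [(k.cast_nonneg : (0 : ℝ) ≤ k)]) (by norm_num)
  have h2 : ‖δ‖ ^ (k + 1) ≤ ‖δ‖ ^ k := pow_le_pow_of_le_one (norm_nonneg _) hδ.le k.le_succ
  have h3 := mul_le_mul h2 (mul_le_mul_of_nonneg_left h1 hM) (by positivity) (by positivity)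
  linarith

lemma summable_shiftSum_majorant (hδ : ‖δ‖ < 1) {u : ℝ} (hu : 0 < u) :
    Summable fun k : ℕ => M * (u + (k + 1)) ^ (-(7 / 2) : ℝ) + M * u ^ (-(7 / 2) : ℝ) * ‖δ‖ ^ k :=
  ((summable_rpow hu).mul_left _).add
    ((summable_geometric_of_lt_one (norm_nonneg _) hδ).mul_left _)

lemma summable_shiftSum (hδ : ‖δ‖ < 1) (hR : 1 ≤ R)
    (hg : ∀ Z ∈ leftHalfPlane R, ‖g Z‖ ≤ M * (-Z.re) ^ (-(7 / 2) : ℝ))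
    {Z : ℂ} (hZ : Z ∈ leftHalfPlane R) :
    Summable fun k : ℕ => (1 - δ ^ (k + 1)) * g (Z - (k + 1)) := by
  have hu : 0 < -Z.re := by rw [mem_leftHalfPlane] at hZ; linarith
  exact .of_norm_bounded (summable_shiftSum_majorant hδ hu) fun k =>
    (norm_shiftSum_term_le hg hZ k).trans
      (shiftSum_majorant hδ (nonneg_of_bound hR hg) hu k)

lemma norm_shiftSum_le (hδ : ‖δ‖ < 1) (hR : 1 ≤ R) (hRδ : 20 ≤ R * (1 - ‖δ‖))
    (hg : ∀ Z ∈ leftHalfPlane R, ‖g Z‖ ≤ M * (-Z.re) ^ (-(7 / 2) : ℝ))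
    {Z : ℂ} (hZ : Z ∈ leftHalfPlane R) :
    ‖shiftSum δ g Z‖ ≤ 9 / 20 * M * (-Z.re) ^ (-(5 / 2) : ℝ) := by
  have hM := nonneg_of_bound hR hg
  rw [mem_leftHalfPlane] at hZ
  have hu : 0 < -Z.re := by linarith
  have h1 : ‖shiftSum δ g Z‖ ≤ ∑' k : ℕ, (M * (-Z.re + (k + 1)) ^ (-(7 / 2) : ℝ) +
      M * (-Z.re) ^ (-(7 / 2) : ℝ) * ‖δ‖ ^ k) :=
    tsum_of_norm_bounded (summable_shiftSum_majorant hδ hu).hasSum fun k =>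
      (norm_shiftSum_term_le hg hZ k).trans (shiftSum_majorant hδ hM hu k)
  rw [Summable.tsum_add ((summable_rpow hu).mul_left _)
    ((summable_geometric_of_lt_one (norm_nonneg _) hδ).mul_left _), tsum_mul_left, tsum_mul_left,
    tsum_geometric_of_lt_one (norm_nonneg _) hδ, rpow_seven_halves hu] at h1
  have h2 := mul_le_mul_of_nonneg_left (tsum_rpow_le hu) hM
  have h3 : 1 / -Z.re * (1 - ‖δ‖)⁻¹ ≤ 1 / 20 := by
    rw [one_div, ← mul_inv, ← one_div]
    refine one_div_le_one_div_of_le (by norm_num) (hRδ.trans ?_)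
    exact mul_le_mul_of_nonneg_right (by linarith) (by linarith)
  have h4 := mul_le_mul_of_nonneg_left h3
    (mul_nonneg hM (Real.rpow_nonneg hu.le (-(5 / 2) : ℝ)))
  linarith

lemma differentiableOn_shiftSum (hδ : ‖δ‖ < 1) (hR : 1 ≤ R)
    (hg : ∀ Z ∈ leftHalfPlane R, ‖g Z‖ ≤ M * (-Z.re) ^ (-(7 / 2) : ℝ))
    (hd : DifferentiableOn ℂ g (leftHalfPlane R)) :
    DifferentiableOn ℂ (shiftSum δ g) (leftHalfPlane R) := by
  have hR0 : 0 < R := by linarith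
  have hM := nonneg_of_bound hR hg
  refine Complex.differentiableOn_tsum_of_summable_norm (summable_shiftSum_majorant (M := M) hδ hR0)
    (fun k => ?_) (isOpen_leftHalfPlane R) fun k Z hZ => ?_
  · exact (DifferentiableOn.comp hd (by fun_prop) fun Z hZ => sub_succ_mem_leftHalfPlane hZ k).const_mul _
  · refine (norm_shiftSum_term_le hg hZ k).trans (le_trans ?_ (shiftSum_majorant hδ hM hR0 k))
    rw [mem_leftHalfPlane] at hZ
    have : (R + (k + 1)) ≤ (-Z.re + (k + 1)) := by linarith
    gcongr _ * (_ * ?_)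
    exact Real.rpow_le_rpow_of_nonpos (by positivity) this (by norm_num)

lemma shiftSum_recurrence (hδ : ‖δ‖ < 1) (hR : 1 ≤ R)
    (hg : ∀ Z ∈ leftHalfPlane R, ‖g Z‖ ≤ M * (-Z.re) ^ (-(7 / 2) : ℝ))
    {Z : ℂ} (hZ : Z + 1 ∈ leftHalfPlane R) :
    shiftSum δ g (Z + 1) - (1 + δ) * shiftSum δ g Z + δ * shiftSum δ g (Z - 1) =
      (1 - δ) * g Z := by
  have hZ0 : Z ∈ leftHalfPlane R := by simpa using sub_mem_leftHalfPlane hZ 1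
  have hZ1 : Z - 1 ∈ leftHalfPlane R := by simpa using sub_mem_leftHalfPlane hZ0 1
  have s1 := summable_shiftSum hδ hR hg hZ
  have s0 := summable_shiftSum hδ hR hg hZ0
  have sm := summable_shiftSum hδ hR hg hZ1
  have e1 : shiftSum δ g (Z + 1) =
      (1 - δ) * g Z + ∑' k : ℕ, (1 - δ ^ (k + 2)) * g (Z - (k + 1)) := by
    rw [shiftSum, s1.tsum_eq_zero_add]
    congr 1
    · simp
    · refine tsum_congr fun k => ?_
      push_cast
      ring_nf
  have hcast : ∀ k : ℕ, (1 - δ ^ (k + 1)) * g (Z - 1 - (k + 1)) =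
      (1 - δ ^ (k + 1)) * g (Z - (((k + 1 : ℕ) : ℂ) + 1)) := fun k => by
    push_cast
    ring_nf
  have sm' : Summable fun k : ℕ => (1 - δ ^ k) * g (Z - (k + 1)) := by
    rw [← summable_nat_add_iff 1]
    exact sm.congr hcast
  have em : shiftSum δ g (Z - 1) = ∑' k : ℕ, (1 - δ ^ k) * g (Z - (k + 1)) := by
    rw [sm'.tsum_eq_zero_add, shiftSum]
    simp only [pow_zero, sub_self, zero_mul, zero_add]
    exact tsum_congr hcast
  have s1' : Summable fun k : ℕ => (1 - δ ^ (k + 2)) * g (Z - (k + 1)) := by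
    refine ((s0.mul_left (1 + δ)).sub (sm'.mul_left δ)).congr fun k => ?_
    ring
  rw [e1, em, shiftSum, ← tsum_mul_left, ← tsum_mul_left, add_sub_assoc,
    ← s1'.tsum_sub (s0.mul_left _), add_assoc,
    ← (s1'.sub (s0.mul_left _)).tsum_add (sm'.mul_left _)]
  rw [add_eq_left]
  convert tsum_zero with k
  ring

lemma shiftSum_sub (hδ : ‖δ‖ < 1) (hR : 1 ≤ R) {M' : ℝ} {g' : ℂ → ℂ}
    (hg : ∀ Z ∈ leftHalfPlane R, ‖g Z‖ ≤ M * (-Z.re) ^ (-(7 / 2) : ℝ))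
    (hg' : ∀ Z ∈ leftHalfPlane R, ‖g' Z‖ ≤ M' * (-Z.re) ^ (-(7 / 2) : ℝ))
    {Z : ℂ} (hZ : Z ∈ leftHalfPlane R) :
    shiftSum δ (g - g') Z = shiftSum δ g Z - shiftSum δ g' Z := by
  rw [shiftSum, shiftSum, shiftSum,
    ← (summable_shiftSum hδ hR hg hZ).tsum_sub (summable_shiftSum hδ hR hg' hZ)]
  simp [mul_sub]

end shiftSum

section fixedPoint

/-- Bounded perturbations in the weight `|Re Z| ^ (-5/2)`. -/
structure IsAdmissible (R K : ℝ) (h : ℂ → ℂ) : Prop where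
  differentiableOn : DifferentiableOn ℂ h (leftHalfPlane R)
  bound : ∀ Z ∈ leftHalfPlane R, ‖h Z‖ ≤ K * (-Z.re) ^ (-(5 / 2) : ℝ)

variable {δ : ℂ} {R C : ℝ} {G : ℂ → ℂ → ℂ}

lemma norm_nonlinearity_le (hR : 1 ≤ R)
    (h0 : ∀ Z ∈ leftHalfPlane R, ‖G Z 0‖ ≤ C * (-Z.re) ^ (-(7 / 2) : ℝ))
    (hlip : ∀ Z ∈ leftHalfPlane R, ∀ a b : ℂ, ‖a‖ ≤ 45 * C * (-Z.re) ^ (-(5 / 2) : ℝ) →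
      ‖b‖ ≤ 45 * C * (-Z.re) ^ (-(5 / 2) : ℝ) → ‖G Z a - G Z b‖ ≤ 11 / 5 / (-Z.re) * ‖a - b‖)
    {h : ℂ → ℂ} (hh : IsAdmissible R (45 * C) h) :
    ∀ Z ∈ leftHalfPlane R, ‖G Z (h Z)‖ ≤ 100 * C * (-Z.re) ^ (-(7 / 2) : ℝ) := by
  intro Z hZ
  have hC := nonneg_of_bound hR h0
  have hu : 0 < -Z.re := by rw [mem_leftHalfPlane] at hZ; linarith
  have h2 := hlip Z hZ (h Z) 0 (hh.bound Z hZ) (by rw [norm_zero]; positivity)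
  have h3 := norm_add_le (G Z (h Z) - G Z 0) (G Z 0)
  rw [sub_add_cancel] at h3
  rw [sub_zero] at h2
  have h4 := mul_le_mul_of_nonneg_left (hh.bound Z hZ) (by positivity : 0 ≤ 11 / 5 / (-Z.re))
  have h5 := h0 Z hZ
  rw [rpow_seven_halves hu] at h5 ⊢
  have h6 : 11 / 5 / (-Z.re) * (45 * C * (-Z.re) ^ (-(5 / 2) : ℝ)) =
    99 * C * (1 / (-Z.re) * (-Z.re) ^ (-(5 / 2) : ℝ)) := by ring
  linarith

lemma norm_nonlinearity_sub_le (hR : 1 ≤ R)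
    (hlip : ∀ Z ∈ leftHalfPlane R, ∀ a b : ℂ, ‖a‖ ≤ 45 * C * (-Z.re) ^ (-(5 / 2) : ℝ) →
      ‖b‖ ≤ 45 * C * (-Z.re) ^ (-(5 / 2) : ℝ) → ‖G Z a - G Z b‖ ≤ 11 / 5 / (-Z.re) * ‖a - b‖)
    {h h' : ℂ → ℂ} (hh : IsAdmissible R (45 * C) h) (hh' : IsAdmissible R (45 * C) h') {N : ℝ}
    (hN : ∀ Z ∈ leftHalfPlane R, ‖h Z - h' Z‖ ≤ N * (-Z.re) ^ (-(5 / 2) : ℝ)) :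
    ∀ Z ∈ leftHalfPlane R, ‖G Z (h Z) - G Z (h' Z)‖ ≤
      11 / 5 * N * (-Z.re) ^ (-(7 / 2) : ℝ) := by
  intro Z hZ
  have hu : 0 < -Z.re := by rw [mem_leftHalfPlane] at hZ; linarith
  refine (hlip Z hZ _ _ (hh.bound Z hZ) (hh'.bound Z hZ)).trans ?_
  refine (mul_le_mul_of_nonneg_left (hN Z hZ) (by positivity)).trans_eq ?_
  rw [rpow_seven_halves hu]
  ring

theorem exists_recurrence_solution (hδ : ‖δ‖ < 1) (hR : 1 ≤ R) (hRδ : 20 ≤ R * (1 - ‖δ‖))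
    (hdiff : ∀ h : ℂ → ℂ, DifferentiableOn ℂ h (leftHalfPlane R) →
      DifferentiableOn ℂ (fun Z => G Z (h Z)) (leftHalfPlane R))
    (h0 : ∀ Z ∈ leftHalfPlane R, ‖G Z 0‖ ≤ C * (-Z.re) ^ (-(7 / 2) : ℝ))
    (hlip : ∀ Z ∈ leftHalfPlane R, ∀ a b : ℂ, ‖a‖ ≤ 45 * C * (-Z.re) ^ (-(5 / 2) : ℝ) →
      ‖b‖ ≤ 45 * C * (-Z.re) ^ (-(5 / 2) : ℝ) → ‖G Z a - G Z b‖ ≤ 11 / 5 / (-Z.re) * ‖a - b‖) :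
    ∃ h : ℂ → ℂ, IsAdmissible R (45 * C) h ∧ ∀ Z, Z + 1 ∈ leftHalfPlane R →
      h (Z + 1) - (1 + δ) * h Z + δ * h (Z - 1) = (1 - δ) * G Z (h Z) := by
  have hC := nonneg_of_bound hR h0
  have hpos : ∀ Z ∈ leftHalfPlane R, 0 < -Z.re := fun Z hZ => by
    rw [mem_leftHalfPlane] at hZ; linarith
  set Φ : (ℂ → ℂ) → ℂ → ℂ := fun h => shiftSum δ fun Z => G Z (h Z) with hΦ
  have hbd := fun h => norm_nonlinearity_le (h := h) hR h0 hlip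
  have hmaps : ∀ h, IsAdmissible R (45 * C) h → IsAdmissible R (45 * C) (Φ h) := fun h hh =>
    ⟨differentiableOn_shiftSum hδ hR (hbd h hh) (hdiff h hh.differentiableOn), fun Z hZ =>
      (norm_shiftSum_le hδ hR hRδ (hbd h hh) hZ).trans_eq (by ring)⟩
  have hcontr : ∀ h h', IsAdmissible R (45 * C) h → IsAdmissible R (45 * C) h' → ∀ N : ℝ,
      (∀ Z ∈ leftHalfPlane R, ‖h Z - h' Z‖ ≤ N * (-Z.re) ^ (-(5 / 2) : ℝ)) →
      ∀ Z ∈ leftHalfPlane R, ‖Φ h Z - Φ h' Z‖ ≤ 99 / 100 * N * (-Z.re) ^ (-(5 / 2) : ℝ) := by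
    intro h h' hh hh' N hN Z hZ
    rw [hΦ, ← shiftSum_sub hδ hR (hbd h hh) (hbd h' hh') hZ]
    exact (norm_shiftSum_le hδ hR hRδ (norm_nonlinearity_sub_le hR hlip hh hh' hN) hZ).trans_eq
      (by ring)
  set a : ℕ → ℂ → ℂ := fun n => Φ^[n] 0 with ha
  have ha_succ : ∀ n, a (n + 1) = Φ (a n) := fun n => Function.iterate_succ_apply' _ _ _
  have ha_adm : ∀ n, IsAdmissible R (45 * C) (a n) := by
    intro n
    induction n with
    | zero =>
      refine ⟨differentiableOn_const 0, fun Z hZ => ?_⟩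
      have := hpos Z hZ
      simp only [ha, Function.iterate_zero, id, Pi.zero_apply, norm_zero]
      positivity
    | succ n ih => rw [ha_succ]; exact hmaps _ ih
  have hstep : ∀ n, ∀ Z ∈ leftHalfPlane R, ‖a n Z - a (n + 1) Z‖ ≤
      45 * C * (99 / 100) ^ n * (-Z.re) ^ (-(5 / 2) : ℝ) := by
    intro n
    induction n with
    | zero =>
      intro Z hZ
      have := (ha_adm 1).bound Z hZ
      simpa [ha] using this
    | succ n ih =>
      intro Z hZ
      rw [ha_succ n, ha_succ (n + 1)]
      refine (hcontr _ _ (ha_adm n) (ha_adm (n + 1)) _ ih Z hZ).trans_eq ?_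
      ring
  have hdist : ∀ Z ∈ leftHalfPlane R, ∀ n, dist (a n Z) (a (n + 1) Z) ≤
      45 * C * (-Z.re) ^ (-(5 / 2) : ℝ) * (99 / 100) ^ n := fun Z hZ n => by
    rw [dist_eq_norm]
    exact (hstep n Z hZ).trans_eq (by ring)
  have hlim : ∀ Z, ∃ l, Z ∈ leftHalfPlane R → Tendsto (fun n => a n Z) atTop (𝓝 l) := by
    intro Z
    by_cases hZ : Z ∈ leftHalfPlane R
    · obtain ⟨l, hl⟩ := cauchySeq_tendsto_of_complete
        (cauchySeq_of_le_geometric _ _ (by norm_num) (hdist Z hZ))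
      exact ⟨l, fun _ => hl⟩
    · exact ⟨0, fun h => absurd h hZ⟩
  choose h hh using hlim
  have hclose : ∀ n, ∀ Z ∈ leftHalfPlane R, ‖a n Z - h Z‖ ≤
      4500 * C * (99 / 100) ^ n * (-Z.re) ^ (-(5 / 2) : ℝ) := fun n Z hZ => by
    rw [← dist_eq_norm]
    refine (dist_le_of_le_geometric_of_tendsto _ _ (by norm_num) (hdist Z hZ) (hh Z hZ) n).trans_eq
      ?_
    ring
  have hgeom : Tendsto (fun n : ℕ => 4500 * C * (99 / 100 : ℝ) ^ n) atTop (𝓝 0) := by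
    simpa using (tendsto_pow_atTop_nhds_zero_of_lt_one (by norm_num : (0 : ℝ) ≤ 99 / 100)
      (by norm_num)).const_mul (4500 * C)
  have hunif : TendstoUniformlyOn a h atTop (leftHalfPlane R) := by
    rw [Metric.tendstoUniformlyOn_iff]
    intro ε hε
    filter_upwards [hgeom.eventually_lt_const hε] with n hn Z hZ
    rw [dist_comm, dist_eq_norm]
    refine (hclose n Z hZ).trans_lt (lt_of_le_of_lt ?_ hn)
    refine mul_le_of_le_one_right (by positivity) ?_
    rw [mem_leftHalfPlane] at hZ
    exact Real.rpow_le_one_of_one_le_of_nonpos (by linarith) (by norm_num)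
  have hadm : IsAdmissible R (45 * C) h :=
    ⟨hunif.tendstoLocallyUniformlyOn.differentiableOn
      (.of_forall fun n => (ha_adm n).differentiableOn) (isOpen_leftHalfPlane R), fun Z hZ =>
      le_of_tendsto (hh Z hZ).norm (.of_forall fun n => (ha_adm n).bound Z hZ)⟩
  have hfix : ∀ Z ∈ leftHalfPlane R, Φ h Z = h Z := by
    intro Z hZ
    refine tendsto_nhds_unique ?_ ((tendsto_add_atTop_iff_nat 1).2 (hh Z hZ))
    rw [tendsto_iff_norm_sub_tendsto_zero]
    refine squeeze_zero (fun _ => norm_nonneg _) (fun n => ?_)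
      (by simpa using (hgeom.const_mul (99 / 100)).mul_const ((-Z.re) ^ (-(5 / 2) : ℝ)))
    rw [ha_succ]
    exact hcontr _ _ (ha_adm n) hadm _ (hclose n) Z hZ
  refine ⟨h, hadm, fun Z hZ => ?_⟩
  have hZ0 : Z ∈ leftHalfPlane R := by simpa using sub_mem_leftHalfPlane hZ 1
  have hZ1 : Z - 1 ∈ leftHalfPlane R := by simpa using sub_mem_leftHalfPlane hZ0 1
  have := shiftSum_recurrence hδ hR (hbd h hadm) hZ
  change Φ h (Z + 1) - (1 + δ) * Φ h Z + δ * Φ h (Z - 1) = _ at this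
  rwa [hfix _ hZ, hfix _ hZ0, hfix _ hZ1] at this

end fixedPoint

section approximateSolution

lemma eventually_comap_re_atBot {P : ℂ → Prop} :
    (∀ᶠ Z in comap Complex.re atBot, P Z) ↔ ∃ R : ℝ, ∀ Z ∈ leftHalfPlane R, P Z := by
  rw [(atBot_basis_Iio.comap Complex.re).eventually_iff]
  constructor
  · rintro ⟨a, -, h⟩
    exact ⟨-a, fun Z hZ => h (by simpa [mem_leftHalfPlane] using hZ)⟩
  · rintro ⟨R, h⟩
    exact ⟨-R, trivial, fun Z hZ => h Z hZ⟩

lemma tendsto_rpow_neg_re {s : ℝ} (hs : 0 < s) :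
    Tendsto (fun Z : ℂ => (-Z.re) ^ (-s)) (comap Complex.re atBot) (𝓝 0) :=
  (tendsto_rpow_neg_atTop hs).comp (tendsto_neg_atBot_atTop.comp tendsto_comap)

lemma neg_re_le_norm (Z : ℂ) : -Z.re ≤ ‖Z‖ := by
  simpa using Complex.re_le_norm (-Z)

lemma norm_rpow_le {Z : ℂ} (hZ : Z.re < 0) {s : ℝ} (hs : 0 ≤ s) :
    ‖Z‖ ^ (-s) ≤ (-Z.re) ^ (-s) :=
  Real.rpow_le_rpow_of_nonpos (by linarith) (neg_re_le_norm Z) (by linarith)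

lemma norm_inv_le {Z : ℂ} (hZ : Z.re < 0) : ‖Z⁻¹‖ ≤ 1 / (-Z.re) := by
  rw [norm_inv, ← one_div]
  exact one_div_le_one_div_of_le (by linarith) (neg_re_le_norm Z)

lemma one_add_norm_log_neg_le {Z : ℂ} (hZ : Z.re ≤ -1) :
    1 + ‖Complex.log (-Z)‖ ≤ 9 * ‖Z‖ ^ (1 / 4 : ℝ) := by
  have h1 : 1 ≤ ‖Z‖ := by linarith [neg_re_le_norm Z]
  have h2 : 1 ≤ ‖Z‖ ^ (1 / 4 : ℝ) := Real.one_le_rpow h1 (by norm_num)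
  have h3 := Real.log_le_rpow_div (norm_nonneg Z) (by norm_num : (0 : ℝ) < 1 / 4)
  have h4 := Complex.norm_le_abs_re_add_abs_im (Complex.log (-Z))
  rw [Complex.log_re, Complex.log_im, norm_neg, abs_of_nonneg (Real.log_nonneg h1)] at h4
  have h5 := Complex.abs_arg_le_pi (-Z)
  have h6 := Real.pi_lt_d2
  linarith

lemma norm_log_neg_mul_inv_le {Z : ℂ} (hZ : Z.re ≤ -1) :
    ‖Complex.log (-Z) * Z⁻¹‖ ≤ 9 * (-Z.re) ^ (-(3 / 4) : ℝ) := by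
  have h0 : 0 < ‖Z‖ := by linarith [neg_re_le_norm Z]
  have h1 := one_add_norm_log_neg_le hZ
  have h2 : ‖Complex.log (-Z)‖ ≤ 9 * ‖Z‖ ^ (1 / 4 : ℝ) := by linarith
  rw [norm_mul, norm_inv]
  refine (mul_le_mul_of_nonneg_right h2 (by positivity)).trans ?_
  rw [← Real.rpow_neg_one ‖Z‖, mul_assoc, ← Real.rpow_add h0]
  norm_num only
  have := norm_rpow_le (Z := Z) (by linarith) (by norm_num : (0 : ℝ) ≤ 3 / 4)
  norm_num only at this ⊢
  linarith

lemma norm_inv_pow_four_mul_log_sq_le {Z : ℂ} (hZ : Z.re ≤ -1) :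
    ‖Z⁻¹‖ ^ 4 * (1 + ‖Complex.log (-Z)‖) ^ 2 ≤ 81 * (-Z.re) ^ (-(7 / 2) : ℝ) := by
  have h0 : 0 < ‖Z‖ := by linarith [neg_re_le_norm Z]
  have h1 := pow_le_pow_left₀ (by positivity) (one_add_norm_log_neg_le hZ) 2
  have h2 := norm_rpow_le (Z := Z) (by linarith) (by norm_num : (0 : ℝ) ≤ 7 / 2)
  have h3 : ‖Z⁻¹‖ ^ 4 * (9 * ‖Z‖ ^ (1 / 4 : ℝ)) ^ 2 = 81 * ‖Z‖ ^ (-(7 / 2) : ℝ) := by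
    rw [norm_inv, ← Real.rpow_neg_one, ← Real.rpow_natCast, ← Real.rpow_mul h0.le, mul_pow,
      ← Real.rpow_natCast (‖Z‖ ^ (1 / 4 : ℝ)), ← Real.rpow_mul h0.le, mul_left_comm,
      ← Real.rpow_add h0]
    norm_num
  calc _ ≤ ‖Z⁻¹‖ ^ 4 * (9 * ‖Z‖ ^ (1 / 4 : ℝ)) ^ 2 := by gcongr
    _ ≤ _ := by rw [h3]; linarith

lemma log_mul_one_add {x τ : ℂ} (hx : 0 < x.re) (hτ : ‖τ‖ < 1) :
    Complex.log (x * (1 + τ)) = Complex.log x + Complex.log (1 + τ) := by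
  have h1 : 0 < (1 + τ).re := by
    have := (abs_le.1 (Complex.abs_re_le_norm τ)).1
    simp
    linarith
  have h2 := abs_lt.1 (Complex.abs_arg_lt_pi_div_two_iff.2 (.inl hx))
  have h3 := abs_lt.1 (Complex.abs_arg_lt_pi_div_two_iff.2 (.inl h1))
  refine Complex.log_mul ?_ ?_ ⟨by linarith, by linarith⟩
  · rintro rfl; simp at hx
  · intro h; simp [h] at h1

lemma norm_inv_one_add_le {τ : ℂ} (hτ : ‖τ‖ ≤ 1 / 2) : ‖(1 + τ)⁻¹‖ ≤ 2 := by
  have h1 := norm_sub_le (1 + τ) τ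
  rw [add_sub_cancel_right, norm_one] at h1
  rw [norm_inv, inv_le_comm₀ (by linarith) (by norm_num)]
  linarith

lemma one_add_ne_zero_of_norm_le {τ : ℂ} (hτ : ‖τ‖ ≤ 1 / 2) : 1 + τ ≠ 0 := by
  intro h
  rw [add_eq_zero_iff_eq_neg'.1 h, norm_neg, norm_one] at hτ
  norm_num at hτ

lemma norm_div_one_add_sub_le {τ : ℂ} (hτ : ‖τ‖ ≤ 1 / 2) :
    ‖τ * (1 + τ)⁻¹ - (τ - τ ^ 2 + τ ^ 3)‖ ≤ 2 * ‖τ‖ ^ 4 := by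
  have h : τ * (1 + τ)⁻¹ - (τ - τ ^ 2 + τ ^ 3) = -((1 + τ)⁻¹ * τ ^ 4) := by
    have := one_add_ne_zero_of_norm_le hτ
    field_simp
    ring
  rw [h, norm_neg, norm_mul, norm_pow]
  gcongr
  exact norm_inv_one_add_le hτ

lemma norm_log_term_sub_le {τ : ℂ} (hτ : ‖τ‖ ≤ 1 / 2) (L : ℂ) :
    ‖(L + Complex.log (1 + τ)) * (τ * (1 + τ)⁻¹) ^ 2 - (L * τ ^ 2 - 2 * L * τ ^ 3 + τ ^ 3)‖ ≤
      16 * (‖τ‖ ^ 4 * (1 + ‖L‖)) := by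
  set l := Complex.log (1 + τ) - τ with hl
  have hl' : ‖l‖ ≤ ‖τ‖ ^ 2 := by
    refine (Complex.norm_log_one_add_sub_self_le (by linarith)).trans ?_
    have : (1 - ‖τ‖)⁻¹ ≤ 2 := by
      rw [inv_le_comm₀ (by linarith) (by norm_num)]
      linarith
    nlinarith [sq_nonneg ‖τ‖]
  have hs := norm_inv_one_add_le hτ
  have h : (L + Complex.log (1 + τ)) * (τ * (1 + τ)⁻¹) ^ 2 -
      (L * τ ^ 2 - 2 * L * τ ^ 3 + τ ^ 3) =
      τ ^ 4 * (L * (3 + 2 * τ) - (2 + τ)) * (1 + τ)⁻¹ ^ 2 + l * τ ^ 2 * (1 + τ)⁻¹ ^ 2 := by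
    have := one_add_ne_zero_of_norm_le hτ
    rw [show Complex.log (1 + τ) = τ + l by rw [hl]; ring]
    field_simp
    ring
  rw [h]
  have h3 : ‖3 + 2 * τ‖ ≤ 4 := by
    refine (norm_add_le _ _).trans ?_
    rw [norm_mul]
    norm_num
    linarith
  have h2 : ‖2 + τ‖ ≤ 3 := by
    refine (norm_add_le _ _).trans ?_
    norm_num
    linarith
  have h4 : ‖L * (3 + 2 * τ) - (2 + τ)‖ ≤ ‖L‖ * 4 + 3 := by
    refine (norm_sub_le _ _).trans ?_
    rw [norm_mul]
    gcongr
  calc _ ≤ ‖τ‖ ^ 4 * (‖L‖ * 4 + 3) * 2 ^ 2 + ‖τ‖ ^ 2 * ‖τ‖ ^ 2 * 2 ^ 2 := by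
        refine (norm_add_le _ _).trans ?_
        rw [norm_mul, norm_mul, norm_mul, norm_mul, norm_pow, norm_pow, norm_pow]
        gcongr
    _ = _ := by ring

/-- The truncated asymptotic expansion of the inverse Fatou coordinate. -/
noncomputable def approxSol (A Z : ℂ) : ℂ := -Z⁻¹ + A * Complex.log (-Z) * Z⁻¹ ^ 2

lemma norm_approxSol_shift_le (A : ℂ) {Z ε : ℂ} (hε : ε = 1 ∨ ε = -1) (hZ : Z.re < -2) :
    ‖approxSol A (Z + ε) - (-Z⁻¹ + ε * Z⁻¹ ^ 2 - Z⁻¹ ^ 3 + A * (Complex.log (-Z) * Z⁻¹ ^ 2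
      - 2 * ε * Complex.log (-Z) * Z⁻¹ ^ 3 + ε * Z⁻¹ ^ 3))‖ ≤
      (2 + 16 * ‖A‖) * (‖Z⁻¹‖ ^ 4 * (1 + ‖Complex.log (-Z)‖)) := by
  have hε2 : ε ^ 2 = 1 := by rcases hε with rfl | rfl <;> norm_num
  have hεn : ‖ε‖ = 1 := by rcases hε with rfl | rfl <;> simp
  have hZ0 : Z ≠ 0 := by rintro rfl; norm_num at hZ
  have ht : ‖Z⁻¹‖ ≤ 1 / 2 := (norm_inv_le (by linarith)).trans
    (one_div_le_one_div_of_le (by norm_num) (by linarith))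
  set L := Complex.log (-Z)
  set t := Z⁻¹ with ht_def
  have hτ : ‖ε * t‖ = ‖t‖ := by rw [norm_mul, hεn, one_mul]
  have hlog : Complex.log (-(Z + ε)) = L + Complex.log (1 + ε * t) := by
    rw [← log_mul_one_add (by simp; linarith) (by rw [hτ]; linarith)]
    congr 1
    rw [ht_def]
    field_simp
  have h1 := norm_div_one_add_sub_le (hτ.trans_le ht)
  have h2 := norm_log_term_sub_le (hτ.trans_le ht) L
  rw [hτ] at h1 h2
  set s := (1 + ε * t)⁻¹ with hs
  have hinv : (Z + ε)⁻¹ = t * s := by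
    rw [hs, ht_def, ← mul_inv]
    congr 1
    field_simp
  set e1 := ε * t * s - (ε * t - (ε * t) ^ 2 + (ε * t) ^ 3) with he1
  set e2 := (L + Complex.log (1 + ε * t)) * (ε * t * s) ^ 2 -
    (L * (ε * t) ^ 2 - 2 * L * (ε * t) ^ 3 + (ε * t) ^ 3) with he2
  have h : approxSol A (Z + ε) - (-t + ε * t ^ 2 - t ^ 3 + A * (L * t ^ 2
      - 2 * ε * L * t ^ 3 + ε * t ^ 3)) = -ε * e1 + A * e2 := by
    rw [approxSol, hlog, hinv, he1, he2]
    linear_combination (t * s - t + ε * t ^ 2 - t ^ 3 * (ε ^ 2 + 1) -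
      A * ((L + Complex.log (1 + ε * t)) * (t * s) ^ 2 - L * t ^ 2 + 2 * ε * L * t ^ 3
        - ε * t ^ 3)) * hε2
  rw [h]
  have hL := norm_nonneg L
  calc _ ≤ ‖e1‖ + ‖A‖ * ‖e2‖ := by
        refine (norm_add_le _ _).trans ?_
        rw [norm_mul, norm_mul, norm_neg, hεn, one_mul]
    _ ≤ 2 * ‖t‖ ^ 4 + ‖A‖ * (16 * (‖t‖ ^ 4 * (1 + ‖L‖))) := by gcongr
    _ ≤ _ := by nlinarith [mul_nonneg (pow_nonneg (norm_nonneg t) 4) hL]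

end approximateSolution

section polynomial

open Polynomial

lemma exists_eval_eq {q : ℂ[X]} (hq0 : q.eval 0 = 0) (hq1 : q.derivative.eval 0 = 0)
    (hq2 : q.derivative.derivative.eval 0 = 2) :
    ∃ (b : ℂ) (r : ℂ[X]), ∀ w, q.eval w = w ^ 2 + b * w ^ 3 + w ^ 4 * r.eval w := by
  have c0 : q.coeff 0 = 0 := by rw [coeff_zero_eq_eval_zero, hq0]
  have c1 : q.coeff 1 = 0 := by
    rw [← coeff_zero_eq_eval_zero, coeff_derivative] at hq1
    simpa using hq1
  have c2 : q.coeff 2 = 1 := by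
    rw [← coeff_zero_eq_eval_zero, coeff_derivative, coeff_derivative] at hq2
    norm_num at hq2
    exact hq2
  refine ⟨q.coeff 3, q.divX.divX.divX.divX, fun w => ?_⟩
  have e : q = (((q.divX.divX.divX.divX * X + C (q.coeff 3)) * X + C (q.coeff 2)) * X +
      C (q.coeff 1)) * X + C (q.coeff 0) := by
    have h3 := divX_mul_X_add q.divX.divX.divX
    have h2 := divX_mul_X_add q.divX.divX
    have h1 := divX_mul_X_add q.divX
    have h0 := divX_mul_X_add q
    simp only [coeff_divX] at h3 h2 h1
    norm_num only at h3 h2 h1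
    rw [h3, h2, h1, h0]
  have e' := congrArg (eval w) e
  rw [c0, c1, c2] at e'
  simp only [eval_add, eval_mul, eval_X, eval_C] at e'
  rw [e']
  ring

lemma exists_lipschitz_near_zero {q : ℂ[X]} (hq1 : q.derivative.eval 0 = 0)
    (hq2 : q.derivative.derivative.eval 0 = 2) :
    ∃ ρ₀ > 0, ∀ ρ ≤ ρ₀, ∀ a b : ℂ, ‖a‖ ≤ ρ → ‖b‖ ≤ ρ →
      ‖q.eval a - q.eval b‖ ≤ 21 / 10 * ρ * ‖a - b‖ := by
  have hc : q.derivative.divX.eval 0 = 2 := by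
    rw [← coeff_zero_eq_eval_zero, coeff_derivative] at hq2
    rw [← coeff_zero_eq_eval_zero, coeff_divX]
    simpa using hq2
  have ht : Tendsto (fun w => ‖q.derivative.divX.eval w‖) (𝓝 0) (𝓝 2) := by
    have := (q.derivative.divX.continuous.tendsto 0).norm
    rwa [hc, Complex.norm_ofNat] at this
  obtain ⟨ε, hε, h⟩ := Metric.eventually_nhds_iff_ball.1
    (ht.eventually_le_const (by norm_num : (2 : ℝ) < 21 / 10))
  refine ⟨ε / 2, by positivity, fun ρ hρ a b ha hb => ?_⟩
  refine Convex.norm_image_sub_le_of_norm_deriv_le (s := Metric.closedBall (0 : ℂ) ρ)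
    (fun w _ => q.differentiableAt) (fun w hw => ?_) (convex_closedBall _ _)
    (by simpa using hb) (by simpa using ha)
  rw [mem_closedBall_zero_iff] at hw
  rw [Polynomial.deriv, ← divX_mul_X_add q.derivative, coeff_zero_eq_eval_zero, hq1]
  simp only [C_0, add_zero, eval_mul, eval_X, norm_mul]
  exact mul_le_mul (h w (by rw [mem_ball_zero_iff]; linarith)) hw (norm_nonneg _) (by norm_num)

end polynomial

section residual

lemma norm_quadratic_remainder_le {A b t L c : ℂ} (hy : ‖A * L * t‖ ≤ 1) :
    ‖((-t + A * L * t ^ 2) ^ 2 + b * (-t + A * L * t ^ 2) ^ 3 + (-t + A * L * t ^ 2) ^ 4 * c) -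
      (t ^ 2 - 2 * A * L * t ^ 3 - b * t ^ 3)‖ ≤
      (‖A‖ ^ 2 + 7 * ‖b‖ * ‖A‖ + 16 * ‖c‖) * (‖t‖ ^ 4 * (1 + ‖L‖) ^ 2) := by
  set y := A * L * t with hy_def
  have h : ((-t + A * L * t ^ 2) ^ 2 + b * (-t + A * L * t ^ 2) ^ 3 +
      (-t + A * L * t ^ 2) ^ 4 * c) - (t ^ 2 - 2 * A * L * t ^ 3 - b * t ^ 3) =
      t ^ 4 * (A ^ 2 * L ^ 2 + b * A * L * (3 - 3 * y + y ^ 2) + (1 - y) ^ 4 * c) := by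
    rw [hy_def]
    ring
  have h1 : ‖3 - 3 * y + y ^ 2‖ ≤ 7 := by
    refine (norm_add_le _ _).trans ?_
    have := norm_sub_le 3 (3 * y)
    rw [norm_mul, Complex.norm_ofNat] at this
    rw [norm_pow]
    nlinarith [norm_nonneg y]
  have h2 : ‖1 - y‖ ≤ 2 := by
    refine (norm_sub_le _ _).trans ?_
    rw [norm_one]
    linarith
  have h3 : ‖A ^ 2 * L ^ 2 + b * A * L * (3 - 3 * y + y ^ 2) + (1 - y) ^ 4 * c‖ ≤
      (‖A‖ ^ 2 + 7 * ‖b‖ * ‖A‖ + 16 * ‖c‖) * (1 + ‖L‖) ^ 2 := by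
    have h4 : ‖A ^ 2 * L ^ 2 + b * A * L * (3 - 3 * y + y ^ 2) + (1 - y) ^ 4 * c‖ ≤
        ‖A‖ ^ 2 * ‖L‖ ^ 2 + ‖b‖ * ‖A‖ * ‖L‖ * 7 + 2 ^ 4 * ‖c‖ := by
      refine le_trans norm_add₃_le ?_
      simp only [norm_mul, norm_pow]
      gcongr
    have hL := norm_nonneg L
    have e1 : ‖L‖ ^ 2 ≤ (1 + ‖L‖) ^ 2 := by nlinarith
    have e2 : ‖L‖ ≤ (1 + ‖L‖) ^ 2 := by nlinarith
    have e3 : 1 ≤ (1 + ‖L‖) ^ 2 := by nlinarith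
    have i1 := mul_le_mul_of_nonneg_left e1 (sq_nonneg ‖A‖)
    have i2 := mul_le_mul_of_nonneg_left e2 (mul_nonneg (norm_nonneg b) (norm_nonneg A))
    have i3 := mul_le_mul_of_nonneg_left e3 (norm_nonneg c)
    linarith
  rw [h, norm_mul, norm_pow]
  exact (mul_le_mul_of_nonneg_left h3 (pow_nonneg (norm_nonneg t) 4)).trans_eq (by ring)

lemma tendsto_log_neg_mul_inv (A : ℂ) :
    Tendsto (fun Z : ℂ => ‖A * Complex.log (-Z) * Z⁻¹‖) (comap Complex.re atBot) (𝓝 0) := by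
  refine squeeze_zero' (.of_forall fun _ => norm_nonneg _) ?_
    (by simpa using (tendsto_rpow_neg_re (s := 3 / 4) (by norm_num)).const_mul (‖A‖ * 9))
  refine eventually_comap_re_atBot.2 ⟨1, fun Z hZ => ?_⟩
  rw [mul_assoc, norm_mul, mul_assoc]
  exact mul_le_mul_of_nonneg_left (norm_log_neg_mul_inv_le (mem_leftHalfPlane.1 hZ).le)
    (norm_nonneg _)

lemma approxSol_eq (A Z : ℂ) :
    approxSol A Z = -Z⁻¹ + A * Complex.log (-Z) * Z⁻¹ * Z⁻¹ := by
  rw [approxSol]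
  ring

lemma norm_approxSol_le (A : ℂ) {η : ℝ} (hη : 0 < η) :
    ∀ᶠ Z in comap Complex.re atBot, ‖approxSol A Z‖ ≤ (1 + η) / (-Z.re) := by
  filter_upwards [(tendsto_log_neg_mul_inv A).eventually_le_const hη,
    eventually_comap_re_atBot.2 ⟨0, fun Z hZ => hZ⟩] with Z h1 h2
  rw [mem_leftHalfPlane] at h2
  rw [approxSol_eq]
  refine (norm_add_le _ _).trans ?_
  rw [norm_neg, norm_mul]
  have h3 := norm_inv_le (Z := Z) (by linarith)
  have h4 := mul_le_mul h1 h3 (norm_nonneg _) hη.le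
  rw [add_div, ← mul_one_div η]
  linarith

/-- The linear part of the recurrence, normalised. -/
noncomputable def normalizedDiff (δ : ℂ) (w : ℂ → ℂ) (Z : ℂ) : ℂ :=
  (w (Z + 1) - (1 + δ) * w Z + δ * w (Z - 1)) / (1 - δ)

lemma one_sub_ne_zero {δ : ℂ} (hδ : ‖δ‖ < 1) : 1 - δ ≠ 0 := by
  intro h
  rw [← sub_eq_zero.1 h] at hδ
  simp at hδ

lemma exists_residual_bound {q : Polynomial ℂ} (hq0 : q.eval 0 = 0)
    (hq1 : q.derivative.eval 0 = 0) (hq2 : q.derivative.derivative.eval 0 = 2) {δ : ℂ}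
    (hδ : ‖δ‖ < 1) :
    ∃ (A : ℂ) (C : ℝ), ∀ᶠ Z in comap Complex.re atBot,
      ‖normalizedDiff δ (approxSol A) Z - q.eval (approxSol A Z)‖ ≤
        C * (-Z.re) ^ (-(7 / 2) : ℝ) := by
  obtain ⟨b, r, hq⟩ := exists_eval_eq hq0 hq1 hq2
  have hδ1 := one_sub_ne_zero hδ
  set A : ℂ := (1 + δ) / (1 - δ) - b with hA
  have hA' : A * (1 - δ) = 1 + δ - b * (1 - δ) := by rw [hA]; field_simp
  obtain ⟨c, hc⟩ := (isCompact_closedBall (0 : ℂ) 1).exists_bound_of_continuousOn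
    r.continuous.continuousOn
  have hc0 : 0 ≤ c := (norm_nonneg _).trans (hc 0 (by simp))
  set B := 2 + 16 * ‖A‖ with hB
  set D := ‖A‖ ^ 2 + 7 * ‖b‖ * ‖A‖ + 16 * c with hD
  refine ⟨A, ((1 + ‖δ‖) * B / ‖1 - δ‖ + D) * 81, ?_⟩
  filter_upwards [(tendsto_log_neg_mul_inv A).eventually_le_const one_pos,
    eventually_comap_re_atBot.2 ⟨2, fun Z hZ => mem_leftHalfPlane.1 hZ⟩,
    norm_approxSol_le A one_pos] with Z hy hZ hw
  have hw1 : ‖approxSol A Z‖ ≤ 1 := by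
    refine hw.trans ((div_le_one (by linarith)).2 (by linarith))
  have e1 := norm_approxSol_shift_le A (Z := Z) (ε := 1) (.inl rfl) hZ
  have e2 := norm_approxSol_shift_le A (Z := Z) (ε := -1) (.inr rfl) hZ
  have e3 := norm_quadratic_remainder_le (b := b) (c := r.eval (approxSol A Z)) hy
  have e4 := norm_inv_pow_four_mul_log_sq_le (Z := Z) (by linarith)
  have e5 := hc _ (mem_closedBall_zero_iff.2 hw1)
  have hqw := hq (approxSol A Z)
  have hwZ : approxSol A Z = -Z⁻¹ + A * Complex.log (-Z) * Z⁻¹ ^ 2 := rfl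
  rw [← hwZ, ← hqw] at e3
  set L := Complex.log (-Z)
  set t := Z⁻¹
  rw [← sub_eq_add_neg] at e2
  set E1 := approxSol A (Z + 1) - _
  set E2 := approxSol A (Z - 1) - _
  set E3 := Polynomial.eval (approxSol A Z) q - _
  have h : normalizedDiff δ (approxSol A) Z - q.eval (approxSol A Z) =
      (E1 + δ * E2) / (1 - δ) - E3 := by
    rw [normalizedDiff]
    field_simp
    simp only [E1, E2, E3]
    rw [hwZ]
    linear_combination t ^ 3 * hA'
  have hLn := norm_nonneg L
  have hLL : ‖t‖ ^ 4 * (1 + ‖L‖) ≤ ‖t‖ ^ 4 * (1 + ‖L‖) ^ 2 := by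
    gcongr
    nlinarith
  have hB0 : 0 ≤ B := by positivity
  have hD0 : 0 ≤ D := by positivity
  have f1 := e1.trans (mul_le_mul_of_nonneg_left hLL hB0)
  have f2 := e2.trans (mul_le_mul_of_nonneg_left hLL hB0)
  rw [h]
  set T := ‖t‖ ^ 4 * (1 + ‖L‖) ^ 2
  have hT0 : 0 ≤ T := by positivity
  have f3 : ‖E3‖ ≤ D * T := e3.trans (by rw [hD]; gcongr)
  calc _ ≤ (‖E1‖ + ‖δ‖ * ‖E2‖) / ‖1 - δ‖ + ‖E3‖ := by
        refine (norm_sub_le _ _).trans ?_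
        rw [norm_div, ← norm_mul]
        gcongr
        exact norm_add_le _ _
    _ ≤ (B * T + ‖δ‖ * (B * T)) / ‖1 - δ‖ + D * T := by gcongr
    _ = ((1 + ‖δ‖) * B / ‖1 - δ‖ + D) * T := by ring
    _ ≤ _ := by
        rw [mul_assoc _ 81]
        gcongr

end residual

section invariantCurve

lemma neg_mem_slitPlane {Z : ℂ} (hZ : Z.re < 0) : -Z ∈ Complex.slitPlane :=
  .inl (by simpa using hZ)

lemma hasDerivAt_log_term (A : ℂ) {Z : ℂ} (hZ : Z.re < 0) :
    HasDerivAt (fun Z : ℂ => A * Complex.log (-Z) * Z⁻¹ ^ 2)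
      (A * Z⁻¹ ^ 3 * (1 - 2 * Complex.log (-Z))) Z := by
  have hZ0 : Z ≠ 0 := by rintro rfl; simp at hZ
  refine ((((hasDerivAt_neg Z).clog (neg_mem_slitPlane hZ)).const_mul A).mul
    ((hasDerivAt_inv hZ0).pow 2)).congr_deriv ?_
  simp only [Pi.pow_apply, Nat.add_one_sub_one, pow_one]
  field_simp
  ring

lemma differentiableAt_approxSol (A : ℂ) {Z : ℂ} (hZ : Z.re < 0) :
    DifferentiableAt ℂ (approxSol A) Z := by
  have hZ0 : Z ≠ 0 := by rintro rfl; simp at hZ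
  exact (differentiableAt_inv hZ0).neg.add (hasDerivAt_log_term A hZ).differentiableAt

lemma differentiableOn_normalizedDiff_approxSol (A δ : ℂ) :
    DifferentiableOn ℂ (normalizedDiff δ (approxSol A)) (leftHalfPlane 1) := by
  intro Z hZ
  rw [mem_leftHalfPlane] at hZ
  have h0 := differentiableAt_approxSol A (Z := Z) (by linarith)
  have h1 := (differentiableAt_approxSol A (Z := Z + 1) (by simp; linarith)).comp Z
    (differentiableAt_id.add_const (1 : ℂ))
  have h2 := (differentiableAt_approxSol A (Z := Z - 1) (by simp; linarith)).comp Z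
    (differentiableAt_id.sub_const (1 : ℂ))
  exact (((h1.sub (h0.const_mul _)).add (h2.const_mul _)).div_const _).differentiableWithinAt

/-- A solution on a left half-plane of the second order recurrence satisfied by the quantity
`z + δ * x` along orbits of `F_δ`, together with its asymptotics. -/
structure IsRecurrenceSolution (q : Polynomial ℂ) (δ A : ℂ) (R K : ℝ) (h : ℂ → ℂ) : Prop where
  three_le : 3 ≤ R
  differentiableOn : DifferentiableOn ℂ (fun Z => approxSol A Z + h Z) (leftHalfPlane R)
  recurrence : ∀ Z, Z + 1 ∈ leftHalfPlane R →
    normalizedDiff δ (fun Z => approxSol A Z + h Z) Z = q.eval (approxSol A Z + h Z)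
  bound : ∀ Z ∈ leftHalfPlane R, ‖h Z‖ ≤ K * (-Z.re) ^ (-(5 / 2) : ℝ)
  norm_le : ∀ Z ∈ leftHalfPlane R, ‖approxSol A Z + h Z‖ ≤ 26 / 25 / (-Z.re)
  lipschitz : ∀ Z ∈ leftHalfPlane R, ∀ a b : ℂ, ‖a‖ ≤ 26 / 25 / (-Z.re) →
    ‖b‖ ≤ 26 / 25 / (-Z.re) → ‖q.eval a - q.eval b‖ ≤ 11 / 5 / (-Z.re) * ‖a - b‖

theorem exists_isRecurrenceSolution {q : Polynomial ℂ} (hq0 : q.eval 0 = 0)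
    (hq1 : q.derivative.eval 0 = 0) (hq2 : q.derivative.derivative.eval 0 = 2) {δ : ℂ}
    (hδ : ‖δ‖ < 1) : ∃ A R K h, IsRecurrenceSolution q δ A R K h := by
  obtain ⟨A, C, hC⟩ := exists_residual_bound hq0 hq1 hq2 hδ
  obtain ⟨ρ₀, hρ₀, hlip⟩ := exists_lipschitz_near_zero hq1 hq2
  have hsmall : ∀ᶠ Z : ℂ in comap Complex.re atBot, 45 * C * (-Z.re) ^ (-(3 / 2) : ℝ) ≤ 1 / 50 := by
    have := (tendsto_rpow_neg_re (s := 3 / 2) (by norm_num)).const_mul (45 * C)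
    rw [mul_zero] at this
    exact this.eventually_le_const (by norm_num)
  have hrho : ∀ᶠ Z : ℂ in comap Complex.re atBot, 26 / 25 / (-Z.re) ≤ ρ₀ := by
    have := (tendsto_rpow_neg_re (s := 1) (by norm_num)).const_mul (26 / 25)
    rw [mul_zero] at this
    filter_upwards [this.eventually_le_const hρ₀] with Z hZ
    rwa [Real.rpow_neg_one, ← div_eq_mul_inv] at hZ
  obtain ⟨R₀, hR₀⟩ := eventually_comap_re_atBot.1
    (((hC.and hsmall).and hrho).and (norm_approxSol_le A (by norm_num : (0 : ℝ) < 1 / 50)))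
  set R := max R₀ (max 3 (20 / (1 - ‖δ‖))) with hR
  have hR3 : 3 ≤ R := (le_max_left _ _).trans (le_max_right _ _)
  have hRδ : 20 ≤ R * (1 - ‖δ‖) := by
    rw [← div_le_iff₀ (by linarith)]
    exact (le_max_right _ _).trans (le_max_right _ _)
  have hmem : ∀ Z ∈ leftHalfPlane R, Z ∈ leftHalfPlane R₀ := fun Z hZ => by
    rw [mem_leftHalfPlane] at hZ ⊢
    linarith [le_max_left R₀ (max 3 (20 / (1 - ‖δ‖)))]
  have hpos : ∀ Z ∈ leftHalfPlane R, 0 < -Z.re := fun Z hZ => by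
    rw [mem_leftHalfPlane] at hZ; linarith
  have hball : ∀ Z ∈ leftHalfPlane R, ∀ a : ℂ, ‖a‖ ≤ 45 * C * (-Z.re) ^ (-(5 / 2) : ℝ) →
      ‖approxSol A Z + a‖ ≤ 26 / 25 / (-Z.re) := by
    intro Z hZ a ha
    obtain ⟨⟨⟨-, h1⟩, -⟩, h2⟩ := hR₀ Z (hmem Z hZ)
    have hu := hpos Z hZ
    have h3 : (-Z.re) ^ (-(5 / 2) : ℝ) = (-Z.re) ^ (-(3 / 2) : ℝ) / (-Z.re) := by
      rw [eq_div_iff hu.ne', ← Real.rpow_add_one hu.ne']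
      norm_num
    rw [h3, ← mul_div_assoc] at ha
    have h4 := div_le_div_of_nonneg_right h1 hu.le
    calc _ ≤ ‖approxSol A Z‖ + ‖a‖ := norm_add_le _ _
      _ ≤ (1 + 1 / 50) / (-Z.re) + 1 / 50 / (-Z.re) := add_le_add h2 (ha.trans h4)
      _ = _ := by ring
  have hlip' : ∀ Z ∈ leftHalfPlane R, ∀ a b : ℂ, ‖a‖ ≤ 26 / 25 / (-Z.re) →
      ‖b‖ ≤ 26 / 25 / (-Z.re) → ‖q.eval a - q.eval b‖ ≤ 11 / 5 / (-Z.re) * ‖a - b‖ := by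
    intro Z hZ a b ha hb
    have hu := hpos Z hZ
    refine (hlip _ (hR₀ Z (hmem Z hZ)).1.2 a b ha hb).trans ?_
    gcongr
    rw [← mul_div_assoc]
    gcongr
    norm_num
  have hdw : DifferentiableOn ℂ (approxSol A) (leftHalfPlane R) := fun Z hZ =>
    (differentiableAt_approxSol A (by linarith [hpos Z hZ])).differentiableWithinAt
  obtain ⟨h, hadm, hrec⟩ := exists_recurrence_solution (δ := δ) (R := R) (C := C)
    (G := fun Z a => q.eval (approxSol A Z + a) - normalizedDiff δ (approxSol A) Z) hδ
    (by linarith) hRδ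
    (fun h hh => (q.differentiable.comp_differentiableOn (hdw.add hh)).sub
      ((differentiableOn_normalizedDiff_approxSol A δ).mono fun Z hZ => by
        rw [mem_leftHalfPlane] at hZ ⊢; linarith))
    (fun Z hZ => by
      rw [add_zero, norm_sub_rev]
      exact (hR₀ Z (hmem Z hZ)).1.1.1)
    (fun Z hZ a b ha hb => by
      have := hlip' Z hZ _ _ (hball Z hZ a ha) (hball Z hZ b hb)
      simpa using this)
  refine ⟨A, R, 45 * C, h, hR3, hdw.add hadm.differentiableOn, fun Z hZ => ?_, hadm.bound,
    fun Z hZ => hball Z hZ _ (hadm.bound Z hZ), hlip'⟩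
  have hδ1 := one_sub_ne_zero hδ
  have h1 := hrec Z hZ
  have h2 : (1 - δ) * normalizedDiff δ (approxSol A) Z =
      approxSol A (Z + 1) - (1 + δ) * approxSol A Z + δ * approxSol A (Z - 1) :=
    mul_div_cancel₀ _ hδ1
  rw [normalizedDiff, div_eq_iff hδ1]
  linear_combination h1 - h2

lemma norm_log_term_sub_le_rpow (A : ℂ) {n : ℕ} (hn : 1 ≤ n) {Z Z' : ℂ}
    (hZ : Z ∈ leftHalfPlane n) (hZ' : Z' ∈ leftHalfPlane n) :
    ‖A * Complex.log (-Z) * Z⁻¹ ^ 2 - A * Complex.log (-Z') * Z'⁻¹ ^ 2‖ ≤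
      18 * ‖A‖ * (n : ℝ) ^ (-(5 / 2) : ℝ) * ‖Z - Z'‖ := by
  have hn1 : (1 : ℝ) ≤ n := by exact_mod_cast hn
  refine Convex.norm_image_sub_le_of_norm_hasDerivWithin_le
    (f := fun Z : ℂ => A * Complex.log (-Z) * Z⁻¹ ^ 2) (s := leftHalfPlane n) (fun Y hY =>
      (hasDerivAt_log_term A (by rw [mem_leftHalfPlane] at hY; linarith)).hasDerivWithinAt)
    (fun Y hY => ?_) (convex_leftHalfPlane _) hZ' hZ
  rw [mem_leftHalfPlane] at hY
  have hY1 : (n : ℝ) ≤ ‖Y‖ := by linarith [neg_re_le_norm Y]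
  have h0 : 0 < ‖Y‖ := by linarith
  have h1 : ‖1 - 2 * Complex.log (-Y)‖ ≤ 2 * (1 + ‖Complex.log (-Y)‖) := by
    refine (norm_sub_le _ _).trans ?_
    rw [norm_mul, Complex.norm_ofNat, norm_one]
    linarith
  have h2 := one_add_norm_log_neg_le (Z := Y) (by linarith)
  have h3 : ‖Y‖⁻¹ ^ 3 * ‖Y‖ ^ (1 / 4 : ℝ) ≤ (n : ℝ) ^ (-(5 / 2) : ℝ) := by
    rw [← Real.rpow_neg_one, ← Real.rpow_natCast, ← Real.rpow_mul h0.le, ← Real.rpow_add h0]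
    calc _ ≤ ‖Y‖ ^ (-(5 / 2) : ℝ) :=
          Real.rpow_le_rpow_of_exponent_le (by linarith) (by norm_num)
      _ ≤ _ := Real.rpow_le_rpow_of_nonpos (by linarith) hY1 (by norm_num)
  rw [norm_mul, norm_mul, norm_pow, norm_inv]
  calc _ ≤ ‖A‖ * ‖Y‖⁻¹ ^ 3 * (2 * (9 * ‖Y‖ ^ (1 / 4 : ℝ))) := by
        gcongr
        linarith
    _ = 18 * ‖A‖ * (‖Y‖⁻¹ ^ 3 * ‖Y‖ ^ (1 / 4 : ℝ)) := by ring
    _ ≤ _ := by gcongr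

variable {q : Polynomial ℂ} {δ A : ℂ} {R K : ℝ} {h : ℂ → ℂ}

lemma IsRecurrenceSolution.eq_of_add_eval_eq (hs : IsRecurrenceSolution q δ A R K h) {Z Z' : ℂ}
    (hZ : Z ∈ leftHalfPlane R) (hZ' : Z' ∈ leftHalfPlane R)
    (heq : approxSol A Z + h Z + q.eval (approxSol A Z + h Z) =
      approxSol A Z' + h Z' + q.eval (approxSol A Z' + h Z')) :
    approxSol A Z + h Z = approxSol A Z' + h Z' := by
  wlog hle : Z.re ≤ Z'.re generalizing Z Z'
  · exact (this hZ' hZ heq.symm (le_of_not_ge hle)).symm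
  have hR := hs.three_le
  have hZ'' := mem_leftHalfPlane.1 hZ'
  have h1 := hs.norm_le Z hZ
  have h2 := hs.norm_le Z' hZ'
  set a := approxSol A Z + h Z
  set b := approxSol A Z' + h Z'
  have h3 : 26 / 25 / (-Z.re) ≤ 26 / 25 / (-Z'.re) :=
    div_le_div_of_nonneg_left (by norm_num) (by linarith) (by linarith)
  have h4 := hs.lipschitz Z' hZ' a b (h1.trans h3) h2
  have h5 : 11 / 5 / (-Z'.re) ≤ 11 / 15 := by
    rw [div_le_iff₀ (by linarith)]
    linarith
  have h6 : ‖a - b‖ = ‖q.eval a - q.eval b‖ := by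
    rw [← norm_neg]
    congr 1
    linear_combination -heq
  have h7 := mul_le_mul_of_nonneg_right h5 (norm_nonneg (a - b))
  exact sub_eq_zero.1 (norm_le_zero_iff.1 (by linarith))

lemma IsRecurrenceSolution.tendsto_zero (hs : IsRecurrenceSolution q δ A R K h) :
    Tendsto (fun Z => approxSol A Z + h Z) (comap Complex.re atBot) (𝓝 0) := by
  have hlim := (tendsto_rpow_neg_re (s := 1) (by norm_num)).const_mul (26 / 25)
  rw [mul_zero] at hlim
  refine squeeze_zero_norm' (eventually_comap_re_atBot.2 ⟨R, fun Z hZ => ?_⟩) hlim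
  rw [Real.rpow_neg_one, ← div_eq_mul_inv]
  exact hs.norm_le Z hZ

lemma IsRecurrenceSolution.eq_of_forall_eq (hs : IsRecurrenceSolution q δ A R K h) {Z Z' : ℂ}
    (hZ : Z ∈ leftHalfPlane R) (hZ' : Z' ∈ leftHalfPlane R)
    (heq : ∀ n : ℕ, approxSol A (Z - n) + h (Z - n) = approxSol A (Z' - n) + h (Z' - n)) :
    Z = Z' := by
  have hR := hs.three_le
  have hK : ∀ Y ∈ leftHalfPlane R, ∀ n : ℕ, 1 ≤ n → ‖h (Y - n)‖ ≤ |K| * (n : ℝ) ^ (-(5 / 2) : ℝ) := by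
    intro Y hY n hn
    have hn1 : (1 : ℝ) ≤ n := by exact_mod_cast hn
    have h1 := hs.bound _ (sub_mem_leftHalfPlane hY n)
    rw [mem_leftHalfPlane] at hY
    have h2 : (n : ℝ) ≤ -(Y - n).re := by simp; linarith
    refine h1.trans (mul_le_mul (le_abs_self K) ?_ (Real.rpow_nonneg (by linarith) _)
      (abs_nonneg K))
    exact Real.rpow_le_rpow_of_nonpos (by linarith) h2 (by norm_num)
  set M := ‖Z‖ + ‖Z'‖ with hM
  set D := 2 * |K| + 18 * ‖A‖ * ‖Z - Z'‖ with hD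
  have key : ∀ n : ℕ, 1 ≤ n →
      ‖Z - Z'‖ ≤ (1 + M) ^ 2 * D * (n : ℝ) ^ (-(1 / 2) : ℝ) := by
    intro n hn
    have hn1 : (1 : ℝ) ≤ n := by exact_mod_cast hn
    have hmem : ∀ Y ∈ leftHalfPlane R, Y - n ∈ leftHalfPlane n := fun Y hY => by
      simp only [mem_leftHalfPlane, Complex.sub_re, Complex.natCast_re] at hY ⊢
      linarith
    have hne : ∀ Y ∈ leftHalfPlane R, Y - n ≠ 0 := fun Y hY h0 => by
      have := hmem Y hY
      rw [h0, mem_leftHalfPlane, Complex.zero_re] at this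
      linarith
    have h1 := norm_log_term_sub_le_rpow A hn (hmem Z hZ) (hmem Z' hZ')
    have h2 := hK Z hZ n hn
    have h3 := hK Z' hZ' n hn
    have h4 := heq n
    rw [approxSol, approxSol] at h4
    rw [sub_sub_sub_cancel_right] at h1
    set V := A * Complex.log (-(Z - n)) * (Z - n)⁻¹ ^ 2
    set V' := A * Complex.log (-(Z' - n)) * (Z' - n)⁻¹ ^ 2
    have h5 : Z - Z' = (Z - n) * (Z' - n) * (h (Z' - n) - h (Z - n) - (V - V')) := by
      have e1 := hne Z hZ
      have e2 := hne Z' hZ'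
      have e3 : h (Z' - n) - h (Z - n) - (V - V') = (Z' - n)⁻¹ - (Z - n)⁻¹ := by
        linear_combination -h4
      rw [e3]
      field_simp
      ring
    have h6 : ∀ Y : ℂ, ‖Y‖ ≤ M → ‖Y - n‖ ≤ (1 + M) * n := fun Y hY => by
      refine (norm_sub_le _ _).trans ?_
      rw [Complex.norm_natCast]
      have hM0 : 0 ≤ M := by positivity
      nlinarith
    have h7 : ‖h (Z' - n) - h (Z - n) - (V - V')‖ ≤ D * (n : ℝ) ^ (-(5 / 2) : ℝ) := by
      have e1 := norm_sub_le (h (Z' - n) - h (Z - n)) (V - V')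
      have e2 := norm_sub_le (h (Z' - n)) (h (Z - n))
      rw [hD]
      linarith
    have h8 : (n : ℝ) ^ 2 * (n : ℝ) ^ (-(5 / 2) : ℝ) = (n : ℝ) ^ (-(1 / 2) : ℝ) := by
      rw [← Real.rpow_natCast, ← Real.rpow_add (by linarith)]
      norm_num
    calc ‖Z - Z'‖ = ‖Z - n‖ * ‖Z' - n‖ * ‖h (Z' - n) - h (Z - n) - (V - V')‖ := by
          rw [← norm_mul, ← norm_mul, ← h5]
      _ ≤ ((1 + M) * n) * ((1 + M) * n) * (D * (n : ℝ) ^ (-(5 / 2) : ℝ)) := by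
          gcongr
          · exact h6 Z (by rw [hM]; linarith [norm_nonneg Z'])
          · exact h6 Z' (by rw [hM]; linarith [norm_nonneg Z])
      _ = (1 + M) ^ 2 * D * ((n : ℝ) ^ 2 * (n : ℝ) ^ (-(5 / 2) : ℝ)) := by ring
      _ = _ := by rw [h8]
  have hlim : Tendsto (fun n : ℕ => (1 + M) ^ 2 * D * (n : ℝ) ^ (-(1 / 2) : ℝ)) atTop (𝓝 0) := by
    simpa using ((tendsto_rpow_neg_atTop (by norm_num : (0 : ℝ) < 1 / 2)).comp
      tendsto_natCast_atTop_atTop).const_mul ((1 + M) ^ 2 * D)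
  have := ge_of_tendsto hlim (eventually_atTop.2 ⟨1, key⟩)
  exact sub_eq_zero.1 (norm_le_zero_iff.1 this)

end invariantCurve

section extension

lemma iterate_eq_of_le {E : Type*} {F : E → E} {ψ : ℂ → E} {R : ℝ}
    (heq : ∀ Z, Z + 1 ∈ leftHalfPlane R → F (ψ Z) = ψ (Z + 1)) {Z : ℂ}
    {m n : ℕ} (hmn : m ≤ n) (hm : Z - m ∈ leftHalfPlane R) :
    F^[n] (ψ (Z - n)) = F^[m] (ψ (Z - m)) := by
  induction n, hmn using Nat.le_induction with
  | base => rfl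
  | succ n hmn ih =>
    have hn : Z - n ∈ leftHalfPlane R := by
      have := sub_mem_leftHalfPlane hm (n - m)
      rwa [Nat.cast_sub hmn, sub_sub_sub_cancel_right] at this
    have e : Z - (n + 1 : ℕ) + 1 = Z - n := by push_cast; ring
    rw [← ih, Function.iterate_succ_apply, heq _ (by rwa [e]), e]

theorem exists_entire_extension {E : Type*} [NormedAddCommGroup E] [NormedSpace ℂ E] {F : E → E}
    {ψ : ℂ → E} {R : ℝ} (hF : Differentiable ℂ F)
    (hψ : DifferentiableOn ℂ ψ (leftHalfPlane R))
    (heq : ∀ Z, Z + 1 ∈ leftHalfPlane R → F (ψ Z) = ψ (Z + 1)) :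
    ∃ Ψ : ℂ → E, Differentiable ℂ Ψ ∧ (∀ Z, F (Ψ Z) = Ψ (Z + 1)) ∧
      Set.EqOn Ψ ψ (leftHalfPlane R) := by
  have hex : ∀ Z : ℂ, ∃ n : ℕ, Z - n ∈ leftHalfPlane R := fun Z => by
    obtain ⟨n, hn⟩ := exists_nat_gt (Z.re + R)
    refine ⟨n, ?_⟩
    simp only [mem_leftHalfPlane, Complex.sub_re, Complex.natCast_re]
    linarith
  choose N hN using hex
  have hΨ : ∀ (Z : ℂ) (n : ℕ), Z - n ∈ leftHalfPlane R →
      F^[N Z] (ψ (Z - N Z)) = F^[n] (ψ (Z - n)) := fun Z n hn => by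
    rcases le_total n (N Z) with h | h
    · exact iterate_eq_of_le heq h hn
    · exact (iterate_eq_of_le heq h (hN Z)).symm
  refine ⟨fun Z => F^[N Z] (ψ (Z - N Z)), fun Z => ?_, fun Z => ?_, fun Z hZ => ?_⟩
  · have hopen : IsOpen {Y : ℂ | Y - N Z ∈ leftHalfPlane R} :=
      (isOpen_leftHalfPlane R).preimage (continuous_id.sub continuous_const)
    have hd : DifferentiableAt ℂ (fun Y => F^[N Z] (ψ (Y - N Z))) Z :=
      (hF.iterate (N Z)).differentiableAt.comp Z
        ((hψ.differentiableAt ((isOpen_leftHalfPlane R).mem_nhds (hN Z))).comp Z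
          (differentiableAt_id.sub_const _))
    refine hd.congr_of_eventuallyEq ?_
    filter_upwards [hopen.mem_nhds (hN Z)] with Y hY
    exact hΨ Y (N Z) hY
  · have e : Z + 1 - (N Z + 1 : ℕ) = Z - N Z := by push_cast; ring
    have := hΨ (Z + 1) (N Z + 1) (by rw [e]; exact hN Z)
    rw [e, Function.iterate_succ_apply'] at this
    exact this.symm
  · simpa using hΨ Z 0 (by simpa using hZ)

end extension

end FatouCoordinate

open FatouCoordinate in
/-- For a polynomial `q(z) = z² + O(z³)` and `|δ| < 1`, there exist `R > 0` and a
holomorphic repelling Fatou coordinate `Ψ : ℂ → ℂ²` with `F_δ(Ψ(Z)) = Ψ(Z+1)` for all `Z`,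
`Ψ` injective on the half-plane `{Re Z < −R}`, and `Ψ(Z) → (0,0)` as `Re Z → −∞`. -/
theorem stmt_5 (q : Polynomial ℂ)
    (hq0 : q.eval 0 = 0) (hq1 : q.derivative.eval 0 = 0)
    (hq2 : q.derivative.derivative.eval 0 = 2)
    (δ : ℂ) (hδ : ‖δ‖ < 1)
    (F : ℂ × ℂ → ℂ × ℂ)
    (hF : F = fun p => (p.1 + q.eval (p.1 + δ * p.2), δ * p.2 - q.eval (p.1 + δ * p.2))) :
    ∃ (R : ℝ) (Ψ : ℂ → ℂ × ℂ), 0 < R ∧ Differentiable ℂ Ψ ∧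
      (∀ Z : ℂ, F (Ψ Z) = Ψ (Z + 1)) ∧
      Set.InjOn Ψ {Z : ℂ | Z.re < -R} ∧
      Filter.Tendsto Ψ (Filter.comap Complex.re Filter.atBot) (nhds ((0, 0) : ℂ × ℂ)) := by
  obtain ⟨A, R, K, h, hs⟩ := exists_isRecurrenceSolution hq0 hq1 hq2 hδ
  have hR := hs.three_le
  have hδ1 := one_sub_ne_zero hδ
  set w : ℂ → ℂ := fun Z => approxSol A Z + h Z with hw
  have hwd : DifferentiableOn ℂ w (leftHalfPlane R) := hs.differentiableOn
  have hpred : ∀ {Z : ℂ}, Z ∈ leftHalfPlane R → Z - 1 ∈ leftHalfPlane R := fun {Z} hZ => by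
    simpa using sub_mem_leftHalfPlane hZ 1
  have hrec : ∀ Z ∈ leftHalfPlane R,
      w Z - (1 + δ) * w (Z - 1) + δ * w (Z - 1 - 1) = q.eval (w (Z - 1)) * (1 - δ) :=
    fun Z hZ => by
      have := hs.recurrence (Z - 1) (by simpa using hZ)
      rw [normalizedDiff, div_eq_iff hδ1, sub_add_cancel] at this
      exact this
  have hw1 : DifferentiableOn ℂ (fun Z => w (Z - 1)) (leftHalfPlane R) :=
    DifferentiableOn.comp hwd (by fun_prop) fun Z hZ => hpred hZ
  set z : ℂ → ℂ := fun Z => (w Z - δ * w (Z - 1)) / (1 - δ) with hz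
  set ψ : ℂ → ℂ × ℂ := fun Z => (z Z, w (Z - 1) - z Z) with hψ
  have hzd : DifferentiableOn ℂ z (leftHalfPlane R) := (hwd.sub (hw1.const_mul _)).div_const _
  have hψd : DifferentiableOn ℂ ψ (leftHalfPlane R) := hzd.prodMk (hw1.sub hzd)
  have hFd : Differentiable ℂ F := by
    have hq := q.differentiable
    rw [hF]
    have hlin : Differentiable ℂ fun p : ℂ × ℂ => p.1 + δ * p.2 := by fun_prop
    have hc := hq.comp hlin
    exact (differentiable_fst.add hc).prodMk ((differentiable_snd.const_mul δ).sub hc)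
  have hzx : ∀ Z, z Z + δ * (w (Z - 1) - z Z) = w Z := fun Z => by
    simp only [hz]
    field_simp
    ring
  have hzsucc : ∀ Z, Z + 1 ∈ leftHalfPlane R → z Z + q.eval (w Z) = z (Z + 1) := fun Z hZ => by
    have := hrec (Z + 1) hZ
    simp only [add_sub_cancel_right] at this
    simp only [hz, add_sub_cancel_right]
    field_simp
    linear_combination -this
  have heq : ∀ Z, Z + 1 ∈ leftHalfPlane R → F (ψ Z) = ψ (Z + 1) := fun Z hZ => by
    rw [hF]
    simp only [hψ, hzx, add_sub_cancel_right, Prod.mk.injEq]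
    refine ⟨hzsucc Z hZ, ?_⟩
    linear_combination hzx Z - hzsucc Z hZ
  obtain ⟨Ψ, hΨd, hΨF, hΨ⟩ := exists_entire_extension hFd hψd heq
  refine ⟨R, Ψ, by linarith, hΨd, hΨF, fun Z hZ Z' hZ' hZZ' => ?_, ?_⟩
  · have hZ : Z ∈ leftHalfPlane R := hZ
    have hZ' : Z' ∈ leftHalfPlane R := hZ'
    rw [hΨ hZ, hΨ hZ'] at hZZ'
    obtain ⟨h1, h2⟩ := Prod.mk.inj hZZ'
    have hstep : ∀ n : ℕ, w (Z - n) = w (Z' - n) ∧ w (Z - n - 1) = w (Z' - n - 1) := by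
      intro n
      induction n with
      | zero =>
        have e1 : w (Z - 1) = w (Z' - 1) := by linear_combination h1 + h2
        refine ⟨?_, by simpa using e1⟩
        have := hzx Z
        rw [h1, e1, hzx Z'] at this
        simpa using this.symm
      | succ n ih =>
        have hY := sub_mem_leftHalfPlane hZ n
        have hY' := sub_mem_leftHalfPlane hZ' n
        push_cast
        rw [← sub_sub, ← sub_sub]
        set Y := Z - n
        set Y' := Z' - n
        refine ⟨ih.2, ?_⟩
        by_cases hδ0 : δ = 0
        · have e1 := hrec _ (hpred hY)
          have e2 := hrec _ (hpred hY')
          rw [hδ0] at e1 e2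
          refine hs.eq_of_add_eval_eq (hpred (hpred hY)) (hpred (hpred hY')) ?_
          linear_combination e2 - e1 + ih.2
        · have e1 := hrec Y hY
          have e2 := hrec Y' hY'
          rw [ih.1, ih.2] at e1
          refine mul_left_cancel₀ hδ0 ?_
          linear_combination e1 - e2
    exact hs.eq_of_forall_eq hZ hZ' fun n => (hstep n).1
  · have hw0 := hs.tendsto_zero
    have hshift : Filter.Tendsto (fun Z : ℂ => Z - 1) (Filter.comap Complex.re Filter.atBot)
        (Filter.comap Complex.re Filter.atBot) :=
      Filter.tendsto_comap_iff.2
        ((Filter.tendsto_atBot_add_const_right _ (-1) Filter.tendsto_comap).congr fun Z => by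
          simp [sub_eq_add_neg])
    have hw1 : Filter.Tendsto (fun Z => w (Z - 1)) (Filter.comap Complex.re Filter.atBot)
        (nhds 0) := hw0.comp hshift
    have hz0 : Filter.Tendsto z (Filter.comap Complex.re Filter.atBot) (nhds 0) := by
      simpa using (hw0.sub (hw1.const_mul δ)).div_const (1 - δ)
    have hx0 := hw1.sub hz0
    rw [sub_zero] at hx0
    exact (hz0.prodMk_nhds hx0).congr' (eventually_comap_re_atBot.2 ⟨R, fun Z hZ => (hΨ hZ).symm⟩)
end

section
/- Let Ω ⊆ ℂ be open, let φ : Ω → ℂ and Ψ : ℂ → ℂ² be holomorphic, and set ψ := π₁ ∘ Ψ. Suppose ẑ ∈ Ω satisfies ψ(φ(ẑ)) = ẑ and |(ψ ∘ φ)'(ẑ)| < 1. Define L : Ω × ℂ → ℂ² by L(z, x) := Ψ(φ(z)) and put x̂ := π₂(Ψ(φ(ẑ))). Then L(ẑ, x̂) = (ẑ, x̂), and there exists an open neighborhood V ⊆ Ω × ℂ of (ẑ, x̂) with L(V) ⊆ V and such that for every p ∈ V the iterates Lⁿ(p) converge to (ẑ, x̂); that is, (ẑ, x̂) is an attracting fixed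 point of L. -/
open Filter Topology in
/-- Near a fixed point whose multiplier has norm less than one, a map contracts the distance to
that point by a constant factor. -/
theorem HasDerivAt.exists_eventually_norm_sub_le_of_isFixedPt {𝕜 : Type*}
    [NontriviallyNormedField 𝕜] {g : 𝕜 → 𝕜} {g' a : 𝕜} (hg : HasDerivAt g g' a)
    (hfix : Function.IsFixedPt g a) (hlt : ‖g'‖ < 1) :
    ∃ c : ℝ, 0 ≤ c ∧ c < 1 ∧ ∀ᶠ z in 𝓝 a, ‖g z - a‖ ≤ c * ‖z - a‖ := by
  obtain ⟨c, hc, hc1⟩ := exists_between hlt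
  refine ⟨c, (norm_nonneg g').trans hc.le, hc1, ?_⟩
  filter_upwards [(hasDerivAt_iff_isLittleO.1 hg).def (sub_pos.2 hc)] with z hz
  rw [hfix.eq, smul_eq_mul] at hz
  calc ‖g z - a‖ = ‖(g z - a - (z - a) * g') + (z - a) * g'‖ := by rw [sub_add_cancel]
    _ ≤ ‖g z - a - (z - a) * g'‖ + ‖(z - a) * g'‖ := norm_add_le _ _
    _ ≤ (c - ‖g'‖) * ‖z - a‖ + ‖z - a‖ * ‖g'‖ := add_le_add hz (norm_mul_le _ _)
    _ = c * ‖z - a‖ := by ring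


/-- If `ψ ∘ φ` (with `ψ = π₁ ∘ Ψ`) has an attracting fixed point `ẑ ∈ Ω`, then
the map `L(z,x) = Ψ(φ(z))` has the attracting fixed point `(ẑ, x̂)` with `x̂ = π₂(Ψ(φ(ẑ)))`:
there is an open neighborhood `V ⊆ Ω × ℂ` of `(ẑ, x̂)` with `L(V) ⊆ V` on which all orbits of
`L` converge to `(ẑ, x̂)`. -/
theorem stmt_7 (Ω : Set ℂ) (hΩ : IsOpen Ω)
    (φ : ℂ → ℂ) (hφ : DifferentiableOn ℂ φ Ω)
    (Ψ : ℂ → ℂ × ℂ) (hΨ : Differentiable ℂ Ψ)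
    (ψ : ℂ → ℂ) (hψ : ψ = fun Z => (Ψ Z).1)
    (zhat : ℂ) (hz : zhat ∈ Ω) (hfix : ψ (φ zhat) = zhat)
    (hattr : ‖deriv (fun z => ψ (φ z)) zhat‖ < 1)
    (L : ℂ × ℂ → ℂ × ℂ) (hL : L = fun p => Ψ (φ p.1))
    (xhat : ℂ) (hx : xhat = (Ψ (φ zhat)).2) :
    L (zhat, xhat) = (zhat, xhat) ∧
      ∃ V : Set (ℂ × ℂ), IsOpen V ∧ (zhat, xhat) ∈ V ∧ V ⊆ Ω ×ˢ (Set.univ : Set ℂ) ∧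
        Set.MapsTo L V V ∧
        ∀ p ∈ V, Filter.Tendsto (fun n => L^[n] p) Filter.atTop (nhds (zhat, xhat)) := by
  subst hψ hL hx
  have hφd : DifferentiableAt ℂ φ zhat := hφ.differentiableAt (hΩ.mem_nhds hz)
  have hL0 : Ψ (φ zhat) = (zhat, (Ψ (φ zhat)).2) := Prod.ext hfix rfl
  have hd : DifferentiableAt ℂ (fun z => (Ψ (φ z)).1) zhat :=
    ((hΨ _).comp zhat hφd).fst
  obtain ⟨c, hc0, hc1, hc⟩ :=
    hd.hasDerivAt.exists_eventually_norm_sub_le_of_isFixedPt hfix hattr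
  obtain ⟨r, hr, hball⟩ := Metric.eventually_nhds_iff_ball.1 (hc.and (hΩ.mem_nhds hz))
  have hmaps : Set.MapsTo (fun p : ℂ × ℂ => Ψ (φ p.1))
      (Metric.ball zhat r ×ˢ Set.univ) (Metric.ball zhat r ×ˢ Set.univ) := by
    rintro p ⟨hp, -⟩
    refine ⟨?_, Set.mem_univ _⟩
    have hle := (hball _ hp).1
    rw [mem_ball_iff_norm] at hp ⊢
    exact (hle.trans (mul_le_of_le_one_left (norm_nonneg _) hc1.le)).trans_lt hp
  refine ⟨hL0, Metric.ball zhat r ×ˢ Set.univ, Metric.isOpen_ball.prod isOpen_univ,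
    ⟨Metric.mem_ball_self hr, Set.mem_univ _⟩,
    Set.prod_mono_left fun z hz => (hball z hz).2, hmaps, fun p hp => ?_⟩
  have hbound : ∀ n : ℕ, ‖((fun p : ℂ × ℂ => Ψ (φ p.1))^[n] p).1 - zhat‖
      ≤ c ^ n * ‖p.1 - zhat‖ := by
    intro n
    induction n with
    | zero => simp
    | succ n ih =>
      rw [Function.iterate_succ_apply', pow_succ', mul_assoc]
      exact (hball _ (hmaps.iterate n hp).1).1.trans (mul_le_mul_of_nonneg_left ih hc0)
  have hfst : Filter.Tendsto (fun n => ((fun p : ℂ × ℂ => Ψ (φ p.1))^[n] p).1)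
      Filter.atTop (nhds zhat) := by
    refine tendsto_iff_norm_sub_tendsto_zero.2 (squeeze_zero (fun _ => norm_nonneg _) hbound ?_)
    simpa using (tendsto_pow_atTop_nhds_zero_of_lt_one hc0 hc1).mul_const ‖p.1 - zhat‖
  rw [← Filter.tendsto_add_atTop_iff_nat 1]
  simp only [Function.iterate_succ_apply']
  rw [← hL0]
  exact ((hΨ _).comp zhat hφd).continuousAt.tendsto.comp hfst
end

section
/- Let δ ∈ ℂ, let q be a polynomial with q(0) = 0 and q'(0) = 0, and for w ∈ ℂ set F_{δ,w}(z, x) := F_δ(z, x) + ((π²/4)·w, 0). Let ρ > 0 and let U : D(0,ρ)² → ℂ² be a holomorphic map of the form U(z, x) = (z + h(z, x), x) with h(z, 0) = 0 for all z and ∂h/∂x(0,0) = 0. Then there exist ρ' > 0 and K > 0 such that for all w ∈ ℂ with |w| ≤ ρ' and all (ζ, ξ) ∈ D(0,ρ')², the points F_δ(ζ, ξ) and F_{δ,w}(ζ, ξ) lie in D(0,ρ)², the second coordinates of U(F_{δ,w}(ζ, ξ)) and U(F_δ(ζ, ξ)) coincide, and |π₁(U(F_{δ,w}(ζ, ξ)))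 − π₁(U(F_δ(ζ, ξ))) − (π²/4)·w| ≤ K·|w|·(|ξ| + |ζ|²). -/
/-- A holomorphic function on a bidisk that is bounded by `1` and vanishes on the axis `x = 0` is
Lipschitz in its first variable on a smaller bidisk, with a constant proportional to `‖x‖`. -/
theorem norm_sub_le_of_vanishing_on_axis {h : ℂ × ℂ → ℂ} {r : ℝ}
    (hd : DifferentiableOn ℂ h (Metric.ball 0 r)) (hb : ∀ p ∈ Metric.ball 0 r, ‖h p‖ ≤ 1)
    (h0 : ∀ z : ℂ, ‖z‖ < r → h (z, 0) = 0) {a b x : ℂ}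
    (ha : ‖a‖ < r / 4) (hb' : ‖b‖ < r / 4) (hx : ‖x‖ < r) :
    ‖h (a, x) - h (b, x)‖ ≤ 4 / r ^ 2 * ‖x‖ * ‖a - b‖ := by
  have hr : 0 < r := (norm_nonneg x).trans_lt hx
  have mem : ∀ z y : ℂ, ‖z‖ < r → ‖y‖ < r → (z, y) ∈ Metric.ball (0 : ℂ × ℂ) r := by
    intro z y hz hy
    simpa [Prod.norm_def] using And.intro hz hy
  have hbound : ∀ z : ℂ, ‖z‖ < r → ‖h (z, x)‖ ≤ 1 / r * ‖x‖ := by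
    intro z hz
    have key := Complex.dist_le_div_mul_dist_of_mapsTo_ball (f := fun y => h (z, y)) (c := 0)
      (R₁ := r) (R₂ := 1) (z := x)
      (hd.comp (by fun_prop) fun y hy => mem z y hz (by simpa using hy))
      (fun y hy => by simpa [h0 z hz] using hb _ (mem z y hz (by simpa using hy)))
      (by simpa using hx)
    simpa [h0 z hz] using key
  have hlt : ∀ z ∈ Metric.ball b (r / 2), ‖z‖ < r := by
    intro z hz
    rw [mem_ball_iff_norm] at hz
    have := norm_add_le (z - b) b
    rw [sub_add_cancel] at this
    linarith
  have key := Complex.dist_le_div_mul_dist_of_mapsTo_ball (f := fun z => h (z, x)) (c := b)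
    (R₁ := r / 2) (R₂ := 1 / r * ‖x‖ + 1 / r * ‖x‖) (z := a)
    (hd.comp (by fun_prop) fun z hz => mem z x (hlt z hz) hx)
    (fun z hz => mem_closedBall_iff_norm.2 <| (norm_sub_le _ _).trans <|
      add_le_add (hbound z (hlt z hz)) (hbound b (by linarith)))
    (mem_ball_iff_norm.2 <| (norm_sub_le _ _).trans_lt (by linarith))
  rw [dist_eq_norm, dist_eq_norm] at key
  refine key.trans_eq ?_
  field_simp
  ring

/-- A polynomial vanishing to second order at `0` is `O(y ^ 2)` there. -/
theorem Polynomial.exists_norm_eval_le_sq {q : Polynomial ℂ} (hq0 : q.eval 0 = 0)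
    (hq1 : q.derivative.eval 0 = 0) :
    ∃ B : ℝ, 0 < B ∧ ∀ᶠ y in nhds (0 : ℂ), ‖q.eval y‖ ≤ B * ‖y‖ ^ 2 := by
  have hdvd : (X : Polynomial ℂ) ^ 2 ∣ q := by
    rw [X_pow_dvd_iff]
    intro d hd
    interval_cases d
    · rwa [coeff_zero_eq_eval_zero]
    · simpa [← coeff_zero_eq_eval_zero, coeff_derivative] using hq1
  obtain ⟨p, rfl⟩ := hdvd
  refine ⟨‖p.eval 0‖ + 1, by positivity, ?_⟩
  have hc : Continuous fun y : ℂ => ‖p.eval y‖ := p.continuous.norm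
  filter_upwards [hc.continuousAt.eventually_lt continuousAt_const (lt_add_one ‖p.eval 0‖)]
    with y hy
  rw [eval_mul, eval_pow, eval_X, norm_mul, norm_pow, mul_comm]
  gcongr


/-- Lemma 4.1: In local coordinates given by a change of variables
`U(z,x) = (z + h(z,x), x)` with `h(z,0) = 0` and `∂h/∂x(0,0) = 0`, the perturbed map
`F_{δ,w} = F_δ + ((π²/4)w, 0)` transforms into `F̃ + ((π²/4)w + O(wx, wz²), 0)`:
there are `ρ', K > 0` such that for `|w| ≤ ρ'` and `(ζ,ξ) ∈ D(0,ρ')²`, the points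
`F_δ(ζ,ξ)` and `F_{δ,w}(ζ,ξ)` lie in `D(0,ρ)²`, the second coordinates of
`U(F_{δ,w}(ζ,ξ))` and `U(F_δ(ζ,ξ))` agree, and
`|π₁(U(F_{δ,w}(ζ,ξ))) − π₁(U(F_δ(ζ,ξ))) − (π²/4)w| ≤ K|w|(|ξ| + |ζ|²)`. -/
theorem stmt_9 (δ : ℂ) (q : Polynomial ℂ)
    (hq0 : q.eval 0 = 0) (hq1 : q.derivative.eval 0 = 0)
    (F : ℂ × ℂ → ℂ × ℂ)
    (hF : F = fun p => (p.1 + q.eval (p.1 + δ * p.2), δ * p.2 - q.eval (p.1 + δ * p.2)))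
    (Fw : ℂ → ℂ × ℂ → ℂ × ℂ)
    (hFw : Fw = fun w p => F p + ((Real.pi : ℂ) ^ 2 / 4 * w, 0))
    (ρ : ℝ) (hρ : 0 < ρ)
    (U : ℂ × ℂ → ℂ × ℂ)
    (hU : DifferentiableOn ℂ U (Metric.ball ((0, 0) : ℂ × ℂ) ρ))
    (hU2 : ∀ p ∈ Metric.ball ((0, 0) : ℂ × ℂ) ρ, (U p).2 = p.2)
    (hUz : ∀ z : ℂ, ‖z‖ < ρ → (U (z, 0)).1 = z)
    (hUx : deriv (fun x : ℂ => (U (0, x)).1) 0 = 0) :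
    ∃ ρ' K : ℝ, 0 < ρ' ∧ 0 < K ∧
      ∀ w : ℂ, ‖w‖ ≤ ρ' → ∀ ζ ξ : ℂ, ‖ζ‖ < ρ' → ‖ξ‖ < ρ' →
        F (ζ, ξ) ∈ Metric.ball ((0, 0) : ℂ × ℂ) ρ ∧
        Fw w (ζ, ξ) ∈ Metric.ball ((0, 0) : ℂ × ℂ) ρ ∧
        (U (Fw w (ζ, ξ))).2 = (U (F (ζ, ξ))).2 ∧
        ‖(U (Fw w (ζ, ξ))).1 - (U (F (ζ, ξ))).1 - (Real.pi : ℂ) ^ 2 / 4 * w‖ ≤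
          K * ‖w‖ * (‖ξ‖ + ‖ζ‖ ^ 2) := by
  set c : ℂ := (Real.pi : ℂ) ^ 2 / 4 with hc
  let h : ℂ × ℂ → ℂ := fun p => (U p).1 - p.1
  have hball : (((0, 0) : ℂ × ℂ)) = 0 := rfl
  rw [hball] at *
  have hd : DifferentiableOn ℂ h (Metric.ball 0 ρ) := by
    intro p hp
    exact (hU p hp).fst.sub differentiableWithinAt_fst
  have h0 : ∀ z : ℂ, ‖z‖ < ρ → h (z, 0) = 0 := fun z hz => sub_eq_zero.2 (hUz z hz)
  have h00 : h 0 = 0 := h0 0 (by simpa using hρ)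
  have hcont : ContinuousAt h 0 := hd.continuousOn.continuousAt (Metric.ball_mem_nhds _ hρ)
  have hev : ∀ᶠ p in nhds 0, ‖h p‖ < 1 :=
    hcont.norm.eventually_lt continuousAt_const (by simp [h00])
  obtain ⟨s, hs, hs1⟩ := Metric.eventually_nhds_iff_ball.1 hev
  obtain ⟨r, hr, hrs, hrρ⟩ : ∃ r : ℝ, 0 < r ∧ r ≤ s ∧ r ≤ ρ :=
    ⟨min s ρ, lt_min hs hρ, min_le_left _ _, min_le_right _ _⟩
  obtain ⟨B, hB, hqB⟩ := Polynomial.exists_norm_eval_le_sq hq0 hq1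
  have hlin : ContinuousAt (fun p : ℂ × ℂ => p.1 + δ * p.2) 0 := by fun_prop
  have hqB' : ∀ᶠ p : ℂ × ℂ in nhds 0,
      ‖q.eval (p.1 + δ * p.2)‖ ≤ B * ‖p.1 + δ * p.2‖ ^ 2 :=
    hlin.eventually (by simpa using hqB)
  have hFc : Continuous fun t : ℂ × ℂ × ℂ => Fw t.1 t.2 := by
    rw [hFw, hF]
    fun_prop
  have hF0 : Fw 0 0 = 0 := by simp [hFw, hF, hq0]
  have hFw_mem : ∀ᶠ t : ℂ × ℂ × ℂ in nhds 0, Fw t.1 t.2 ∈ Metric.ball 0 (r / 4) :=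
    hFc.continuousAt.eventually_mem (by
      simpa [hF0] using Metric.ball_mem_nhds (0 : ℂ × ℂ) (by positivity : 0 < r / 4))
  obtain ⟨s₁, hs₁, hs₁F⟩ := Metric.eventually_nhds_iff_ball.1 hFw_mem
  obtain ⟨s₂, hs₂, hs₂q⟩ := Metric.eventually_nhds_iff_ball.1 hqB'
  set A : ℝ := ‖δ‖ + B * (2 * (1 + ‖δ‖ ^ 2)) with hA
  have hApos : 0 < A := by positivity
  have hcpos : 0 < ‖c‖ := norm_pos_iff.2 (by simp [hc, Real.pi_ne_zero])
  obtain ⟨ρ', hρ', h₁, h₂, h₃⟩ : ∃ ρ' : ℝ, 0 < ρ' ∧ ρ' < s₁ ∧ ρ' ≤ s₂ ∧ ρ' ≤ 1 := by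
    refine ⟨min (s₁ / 2) (min s₂ 1), by positivity, ?_, ?_, ?_⟩
    · exact (min_le_left _ _).trans_lt (by linarith)
    · exact (min_le_right _ _).trans (min_le_left _ _)
    · exact (min_le_right _ _).trans (min_le_right _ _)
  refine ⟨ρ', 4 / r ^ 2 * A * ‖c‖, hρ', by positivity, fun w hw ζ ξ hζ hξ => ?_⟩
  have hmem : ∀ v : ℂ, ‖v‖ ≤ ρ' → Fw v (ζ, ξ) ∈ Metric.ball 0 (r / 4) := by
    intro v hv
    refine hs₁F (v, ζ, ξ) ?_
    simpa [Prod.norm_def] using And.intro (hv.trans_lt h₁) ⟨hζ.trans h₁, hξ.trans h₁⟩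
  have hw_mem := hmem w hw
  have hF_mem : F (ζ, ξ) ∈ Metric.ball 0 (r / 4) := by
    have hFw0 : Fw 0 (ζ, ξ) = F (ζ, ξ) := by ext <;> simp [hFw]
    exact hFw0 ▸ hmem 0 (by simpa using hρ'.le)
  have hsub : Metric.ball (0 : ℂ × ℂ) (r / 4) ⊆ Metric.ball 0 ρ :=
    Metric.ball_subset_ball (by linarith)
  have hsnd : (Fw w (ζ, ξ)).2 = (F (ζ, ξ)).2 := by simp [hFw]
  have hfst : (Fw w (ζ, ξ)).1 - (F (ζ, ξ)).1 = c * w := by simp [hFw]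
  refine ⟨hsub hF_mem, hsub hw_mem, ?_, ?_⟩
  · rw [hU2 _ (hsub hw_mem), hU2 _ (hsub hF_mem), hsnd]
  have hx : ‖(F (ζ, ξ)).2‖ ≤ A * (‖ξ‖ + ‖ζ‖ ^ 2) := by
    have hq := hs₂q (ζ, ξ) (by
      simpa [Prod.norm_def] using And.intro (hζ.trans_le h₂) (hξ.trans_le h₂))
    have hsq : ‖ζ + δ * ξ‖ ^ 2 ≤ 2 * (1 + ‖δ‖ ^ 2) * (‖ξ‖ + ‖ζ‖ ^ 2) := by
      have htri : ‖ζ + δ * ξ‖ ≤ ‖ζ‖ + ‖δ‖ * ‖ξ‖ := by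
        simpa using norm_add_le ζ (δ * ξ)
      have hξ2 : ‖ξ‖ ^ 2 ≤ ‖ξ‖ := by nlinarith [norm_nonneg ξ]
      calc ‖ζ + δ * ξ‖ ^ 2 ≤ (‖ζ‖ + ‖δ‖ * ‖ξ‖) ^ 2 := by gcongr
        _ ≤ 2 * (‖ζ‖ ^ 2 + ‖δ‖ ^ 2 * ‖ξ‖ ^ 2) := by
          nlinarith [sq_nonneg (‖ζ‖ - ‖δ‖ * ‖ξ‖)]
        _ ≤ 2 * (‖ζ‖ ^ 2 + ‖δ‖ ^ 2 * ‖ξ‖) := by gcongr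
        _ ≤ 2 * (1 + ‖δ‖ ^ 2) * (‖ξ‖ + ‖ζ‖ ^ 2) := by
          nlinarith [norm_nonneg ξ, mul_nonneg (sq_nonneg ‖δ‖) (sq_nonneg ‖ζ‖)]
    calc ‖(F (ζ, ξ)).2‖ = ‖δ * ξ - q.eval (ζ + δ * ξ)‖ := by rw [hF]
      _ ≤ ‖δ * ξ‖ + ‖q.eval (ζ + δ * ξ)‖ := norm_sub_le _ _
      _ ≤ ‖δ‖ * (‖ξ‖ + ‖ζ‖ ^ 2) + B * (2 * (1 + ‖δ‖ ^ 2) * (‖ξ‖ + ‖ζ‖ ^ 2)) := by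
        rw [norm_mul]
        refine add_le_add ?_ (hq.trans ?_)
        · gcongr
          exact le_add_of_nonneg_right (sq_nonneg _)
        · gcongr
      _ = A * (‖ξ‖ + ‖ζ‖ ^ 2) := by rw [hA]; ring
  have hcoord : ∀ p ∈ Metric.ball (0 : ℂ × ℂ) (r / 4), ‖p.1‖ < r / 4 ∧ ‖p.2‖ < r / 4 := by
    intro p hp
    simpa [Prod.norm_def] using hp
  have key := norm_sub_le_of_vanishing_on_axis (hd.mono (Metric.ball_subset_ball hrρ))
    (fun p hp => (hs1 p (Metric.ball_subset_ball hrs hp)).le)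
    (fun z hz => h0 z (hz.trans_le hrρ)) (hcoord _ hw_mem).1 (hcoord _ hF_mem).1
    ((hcoord _ hF_mem).2.trans (by linarith))
  rw [hfst, ← hsnd, Prod.mk.eta, hsnd, Prod.mk.eta, norm_mul] at key
  calc ‖(U (Fw w (ζ, ξ))).1 - (U (F (ζ, ξ))).1 - c * w‖
      = ‖h (Fw w (ζ, ξ)) - h (F (ζ, ξ))‖ := by
        rw [← hfst]
        congr 1
        ring
    _ ≤ 4 / r ^ 2 * ‖(F (ζ, ξ)).2‖ * (‖c‖ * ‖w‖) := key
    _ ≤ 4 / r ^ 2 * (A * (‖ξ‖ + ‖ζ‖ ^ 2)) * (‖c‖ * ‖w‖) := by gcongr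
    _ = 4 / r ^ 2 * A * ‖c‖ * ‖w‖ * (‖ξ‖ + ‖ζ‖ ^ 2) := by ring
end

section
/- Let δ ∈ ℂ, M > 0 and C > 1 satisfy (4|δ| + 1/2)·C + 4M < C and 4|δ|π⁴·C + 12Mπ⁴ < C, and let 0 < s ≤ 1/(16M). Let w, w' ∈ ℂ with |w| < 1/(π²C) and |w| ≤ 2|w'|, and let z, x, z', x' ∈ ℂ satisfy |z| < s, |x| < s, |x| < C·max(|z|², |w|²), together with the estimates |z'| ≥ |z| − (π²/4)|w| − M(|z|² + |w||x|) and |x'| ≤ |δ||x| + M(|z|² + |z||x| + |x|²). Then |x'| < C·max(|z'|², |w'|²). -/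
/-- quantitative core of Lemma 4.2: invariance of the regions
`Ω_w = {(z,x) : |x| < C·max(|z|², |w|²)}` under maps satisfying the normal-form estimates
`|z'| ≥ |z| − (π²/4)|w| − M(|z|² + |w||x|)` and `|x'| ≤ |δ||x| + M(|z|² + |z||x| + |x|²)`. -/
theorem stmt_10 (δ : ℂ) (M C : ℝ) (hM : 0 < M) (hC : 1 < C)
    (hC1 : (4 * ‖δ‖ + 1 / 2) * C + 4 * M < C)
    (hC2 : 4 * ‖δ‖ * Real.pi ^ 4 * C + 12 * M * Real.pi ^ 4 < C)
    (s : ℝ) (hs0 : 0 < s) (hs : s ≤ 1 / (16 * M))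
    (w w' z x z' x' : ℂ)
    (hw : ‖w‖ < 1 / (Real.pi ^ 2 * C)) (hww' : ‖w‖ ≤ 2 * ‖w'‖)
    (hz : ‖z‖ < s) (hx : ‖x‖ < s)
    (hΩ : ‖x‖ < C * max (‖z‖ ^ 2) (‖w‖ ^ 2))
    (hz' : ‖z‖ - Real.pi ^ 2 / 4 * ‖w‖ - M * (‖z‖ ^ 2 + ‖w‖ * ‖x‖) ≤ ‖z'‖)
    (hx' : ‖x'‖ ≤ ‖δ‖ * ‖x‖ + M * (‖z‖ ^ 2 + ‖z‖ * ‖x‖ + ‖x‖ ^ 2)) :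
    ‖x'‖ < C * max (‖z'‖ ^ 2) (‖w'‖ ^ 2) := by
  have hP : 9 < Real.pi ^ 2 := by nlinarith [Real.pi_gt_three]
  rw [show Real.pi ^ 4 = (Real.pi ^ 2) ^ 2 by ring] at hC2
  generalize Real.pi ^ 2 = P at *
  have ha := norm_nonneg z
  have hb := norm_nonneg w
  have hX := norm_nonneg x
  have hd := norm_nonneg δ
  generalize ‖z‖ = a at *
  generalize ‖w‖ = b at *
  generalize ‖x‖ = X at *
  generalize ‖δ‖ = d at *
  generalize ‖x'‖ = X' at *
  generalize ‖z'‖ = a' at *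
  generalize ‖w'‖ = b' at *
  have hMs : M * s ≤ 1 / 16 := by
    rw [le_div_iff₀ (by positivity)] at hs
    linarith
  have hMa : M * a ≤ 1 / 16 := (mul_le_mul_of_nonneg_left hz.le hM.le).trans hMs
  have hMX : M * X ≤ 1 / 16 := (mul_le_mul_of_nonneg_left hx.le hM.le).trans hMs
  have hMaX : M * (a * X) ≤ X / 16 := by linarith [mul_le_mul_of_nonneg_right hMa hX]
  have hMXX : M * X ^ 2 ≤ X / 16 := by linarith [mul_le_mul_of_nonneg_right hMX hX]
  have hMaa : M * a ^ 2 ≤ a / 16 := by linarith [mul_le_mul_of_nonneg_right hMa ha]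
  have hMbX : M * (b * X) ≤ b / 16 := by linarith [mul_le_mul_of_nonneg_right hMX hb]
  have hX'_le : X' ≤ (d + 1 / 8) * X + M * a ^ 2 := by linarith
  -- It suffices to bound `X'` by a quarter of `C * b ^ 2`, since `b ≤ 2 * b'`.
  have of_lt_b (h : X' < C * b ^ 2 / 4) : X' < C * max (a' ^ 2) (b' ^ 2) := by
    have h1 : b ^ 2 ≤ 4 * b' ^ 2 := by linarith [pow_le_pow_left₀ hb hww' 2]
    have h2 := mul_le_mul_of_nonneg_left (h1.trans
      (mul_le_mul_of_nonneg_left (le_max_right (a' ^ 2) (b' ^ 2)) (by norm_num)))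
      (by linarith : 0 ≤ C)
    linarith
  rcases le_or_gt a b with hab | hab
  · have hsq : a ^ 2 ≤ b ^ 2 := by gcongr
    rw [max_eq_right hsq] at hΩ
    have hb2 : 0 < b ^ 2 := pos_of_mul_pos_right (hX.trans_lt hΩ) (by linarith)
    apply of_lt_b
    have h1 := mul_le_mul_of_nonneg_left hΩ.le (by linarith : 0 ≤ d + 1 / 8)
    have h2 := mul_le_mul_of_nonneg_left hsq hM.le
    have h3 := mul_lt_mul_of_pos_right hC1 hb2
    linarith
  have ha_pos : 0 < a := hb.trans_lt hab
  have hsq : b ^ 2 ≤ a ^ 2 := by gcongr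
  rw [max_eq_left hsq] at hΩ
  rcases le_or_gt a (P * b) with haP | haP
  · apply of_lt_b
    have hb_pos : 0 < b := pos_of_mul_pos_right (ha_pos.trans_le haP) (by linarith)
    have hCa : C * a ≤ 1 := by
      rw [lt_div_iff₀ (mul_pos (by linarith) (by linarith))] at hw
      have h := mul_le_mul_of_nonneg_left haP (by linarith : 0 ≤ C)
      linarith
    have hXa : X ≤ a := by
      have h := mul_le_mul_of_nonneg_right hCa ha
      linarith
    have h1 : a * X ≤ a ^ 2 := by
      rw [sq]
      gcongr
    have h2 : X ^ 2 ≤ a ^ 2 := by gcongr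
    have h3 : a ^ 2 ≤ P ^ 2 * b ^ 2 := by
      rw [← mul_pow]
      gcongr
    have h4 := mul_le_mul_of_nonneg_left hΩ.le hd
    have h5 : M * (a ^ 2 + a * X + X ^ 2) ≤ M * (3 * a ^ 2) :=
      mul_le_mul_of_nonneg_left (by linarith) hM.le
    have h6 : (d * C + 3 * M) * a ^ 2 ≤ (d * C + 3 * M) * (P ^ 2 * b ^ 2) := by gcongr
    have h7 := mul_lt_mul_of_pos_right hC2 (pow_pos hb_pos 2)
    linarith
  · have ha' : a / 2 ≤ a' := by linarith
    have h1 : a ^ 2 / 4 ≤ a' ^ 2 := by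
      linarith [pow_le_pow_left₀ (by positivity : 0 ≤ a / 2) ha' 2]
    have h2 := mul_le_mul_of_nonneg_left (h1.trans (le_max_left (a' ^ 2) (b' ^ 2)))
      (by linarith : 0 ≤ C)
    have h3 := mul_le_mul_of_nonneg_left hΩ.le (by linarith : 0 ≤ d + 1 / 8)
    have h4 := mul_lt_mul_of_pos_right hC1 (pow_pos ha_pos 2)
    linarith
end

section
/- Let δ ∈ ℂ with |δ| ≤ 1/8, let M > 0, let C ≥ max(24M, 1), and set s := min(1/(24M), 1/C). If w, y, w', y' ∈ ℂ satisfy |w| ≤ s, |y| ≤ C|w|², |w' − w| ≤ M(|w|² + |w||y| + |y|²) and |y'| ≤ |δ||y| + M(|w|² + |w||y| + |y|²), then |y'| ≤ C|w'|². -/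
/-- quantitative core of Lemma 4.3: forward invariance of the region
`{(w,y) : |y| ≤ C|w|²}` for maps satisfying `|w' − w| ≤ M(|w|² + |w||y| + |y|²)` and
`|y'| ≤ |δ||y| + M(|w|² + |w||y| + |y|²)`, for `|δ| ≤ 1/8`, `C ≥ max(24M, 1)` and
`s = min(1/(24M), 1/C)`. -/
theorem stmt_11 (δ : ℂ) (hδ : ‖δ‖ ≤ 1 / 8) (M : ℝ) (hM : 0 < M)
    (C : ℝ) (hC : max (24 * M) 1 ≤ C)
    (s : ℝ) (hs : s = min (1 / (24 * M)) (1 / C))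
    (w y w' y' : ℂ)
    (hw : ‖w‖ ≤ s) (hy : ‖y‖ ≤ C * ‖w‖ ^ 2)
    (hw' : ‖w' - w‖ ≤ M * (‖w‖ ^ 2 + ‖w‖ * ‖y‖ + ‖y‖ ^ 2))
    (hy' : ‖y'‖ ≤ ‖δ‖ * ‖y‖ + M * (‖w‖ ^ 2 + ‖w‖ * ‖y‖ + ‖y‖ ^ 2)) :
    ‖y'‖ ≤ C * ‖w'‖ ^ 2 := by
  have h24 : 24 * M ≤ C := (le_max_left _ _).trans hC
  have hC0 : 0 < C := by linarith
  have hMw : ‖w‖ * (24 * M) ≤ 1 :=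
    (le_div_iff₀ (by positivity)).1 (hw.trans (hs ▸ min_le_left _ _))
  have hCw : ‖w‖ * C ≤ 1 :=
    (le_div_iff₀ hC0).1 (hw.trans (hs ▸ min_le_right _ _))
  have hw0 := norm_nonneg w
  have hy0 := norm_nonneg y
  have hyw : ‖y‖ ≤ ‖w‖ := by nlinarith
  have hsum : M * (‖w‖ ^ 2 + ‖w‖ * ‖y‖ + ‖y‖ ^ 2) ≤ M * (3 * ‖w‖ ^ 2) := by
    gcongr
    nlinarith
  have hdiff : ‖w' - w‖ ≤ ‖w‖ / 8 := by nlinarith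
  have hlow : 7 / 8 * ‖w‖ ≤ ‖w'‖ := by
    have := norm_sub_norm_le w w'
    rw [norm_sub_rev] at this
    linarith
  have hδy : ‖δ‖ * ‖y‖ ≤ 1 / 8 * (C * ‖w‖ ^ 2) := by gcongr
  have hMC : 24 * M * ‖w‖ ^ 2 ≤ C * ‖w‖ ^ 2 := by gcongr
  have hCw2 : 0 ≤ C * ‖w‖ ^ 2 := by positivity
  calc ‖y'‖ ≤ C * (7 / 8 * ‖w‖) ^ 2 := by linarith
    _ ≤ C * ‖w'‖ ^ 2 := by gcongr
end

section
/- For every β ∈ (0, 1/2] and every Z = x + iy ∈ ℂ with x ∈ [β, 1 − β] and y ∈ ℝ, one has sin(πZ) ≠ 0 and |cot(πZ)| ≤ max(1, 1/(πβ)). -/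
theorem Real.mul_cos_le_sin {x : ℝ} (h0 : 0 ≤ x) (h1 : x ≤ Real.pi / 2) :
    x * Real.cos x ≤ Real.sin x := by
  rcases h1.lt_or_eq with h | rfl
  · have hc : 0 < Real.cos x := Real.cos_pos_of_mem_Ioo ⟨by linarith [Real.pi_pos], h⟩
    rw [← le_div_iff₀ hc, ← Real.tan_eq_sin_div_cos]
    exact Real.le_tan h0 h
  · simp

theorem Real.mul_abs_cos_le_sin {b x : ℝ} (hb : 0 ≤ b) (h1 : b ≤ x) (h2 : x ≤ Real.pi - b) :
    b * |Real.cos x| ≤ Real.sin x := by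
  rcases le_total x (Real.pi / 2) with h | h
  · have hc : 0 ≤ Real.cos x := Real.cos_nonneg_of_mem_Icc ⟨by linarith, h⟩
    rw [abs_of_nonneg hc]
    exact (mul_le_mul_of_nonneg_right h1 hc).trans (Real.mul_cos_le_sin (hb.trans h1) h)
  · have hc : 0 ≤ Real.cos (Real.pi - x) :=
      Real.cos_nonneg_of_mem_Icc ⟨by linarith, by linarith⟩
    rw [← Real.sin_pi_sub, ← abs_neg, ← Real.cos_pi_sub, abs_of_nonneg hc]
    exact (mul_le_mul_of_nonneg_right (by linarith) hc).trans
      (Real.mul_cos_le_sin (by linarith) (by linarith))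

theorem Complex.sq_norm_sin (z : ℂ) :
    ‖Complex.sin z‖ ^ 2 = Real.sin z.re ^ 2 + Real.sinh z.im ^ 2 := by
  rw [Complex.sin_eq, ← Complex.ofReal_sin, ← Complex.ofReal_cos, ← Complex.ofReal_sinh,
    ← Complex.ofReal_cosh, ← Complex.ofReal_mul, ← Complex.ofReal_mul, Complex.sq_norm,
    Complex.normSq_add_mul_I, mul_pow, mul_pow, Real.cosh_sq, Real.cos_sq']
  ring

theorem Complex.sq_norm_cos (z : ℂ) :
    ‖Complex.cos z‖ ^ 2 = Real.cos z.re ^ 2 + Real.sinh z.im ^ 2 := by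
  rw [Complex.cos_eq, ← Complex.ofReal_sin, ← Complex.ofReal_cos, ← Complex.ofReal_sinh,
    ← Complex.ofReal_cosh, ← Complex.ofReal_mul, ← Complex.ofReal_mul, sub_eq_add_neg,
    ← neg_mul, ← Complex.ofReal_neg, Complex.sq_norm,
    Complex.normSq_add_mul_I, neg_sq, mul_pow, mul_pow, Real.cosh_sq, Real.cos_sq']
  ring

/-- For `β ∈ (0, 1/2]` and `Z ∈ ℂ` with `Re Z ∈ [β, 1 − β]`, one has
`sin(πZ) ≠ 0` and `|cot(πZ)| ≤ max(1, 1/(πβ))`. -/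
theorem stmt_13 (β : ℝ) (hβ0 : 0 < β) (hβ : β ≤ 1 / 2)
    (Z : ℂ) (h1 : β ≤ Z.re) (h2 : Z.re ≤ 1 - β) :
    Complex.sin ((Real.pi : ℂ) * Z) ≠ 0 ∧
      ‖Complex.cot ((Real.pi : ℂ) * Z)‖ ≤ max 1 (1 / (Real.pi * β)) := by
  have hpi := Real.pi_pos
  have hb : 0 < Real.pi * β := by positivity
  have hl : Real.pi * β ≤ Real.pi * Z.re := by gcongr
  have hr : Real.pi * Z.re ≤ Real.pi - Real.pi * β := by nlinarith
  have hsin : 0 < Real.sin (Real.pi * Z.re) :=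
    Real.sin_pos_of_pos_of_lt_pi (by linarith) (by linarith)
  have hcos := Real.mul_abs_cos_le_sin hb.le hl hr
  have hS := Complex.sq_norm_sin ((Real.pi : ℂ) * Z)
  have hC := Complex.sq_norm_cos ((Real.pi : ℂ) * Z)
  rw [Complex.re_ofReal_mul, Complex.im_ofReal_mul] at hS hC
  have hne : Complex.sin ((Real.pi : ℂ) * Z) ≠ 0 := by
    intro h
    rw [h, norm_zero] at hS
    nlinarith [sq_nonneg (Real.sinh (Real.pi * Z.im))]
  refine ⟨hne, ?_⟩
  set M := max 1 (1 / (Real.pi * β))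
  have hM1 : 1 ≤ M := le_max_left _ _
  have hcM : |Real.cos (Real.pi * Z.re)| ≤ M * Real.sin (Real.pi * Z.re) := by
    calc |Real.cos (Real.pi * Z.re)| ≤ 1 / (Real.pi * β) * Real.sin (Real.pi * Z.re) := by
          rw [one_div_mul_eq_div, le_div_iff₀ hb, mul_comm]
          exact hcos
      _ ≤ M * Real.sin (Real.pi * Z.re) := by
          gcongr
          exact le_max_right _ _
  rw [Complex.cot, norm_div, div_le_iff₀ (norm_pos_iff.mpr hne)]
  refine le_of_sq_le_sq ?_ (by positivity)
  rw [mul_pow, hS, hC, mul_add, ← mul_pow, ← sq_abs (Real.cos _)]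
  gcongr
  exact le_mul_of_one_le_left (sq_nonneg _) (one_le_pow₀ hM1)
end

section
/- For every K > 0 there exist ρ ∈ (0, 1) and K' > 0 such that the following holds: for all w ∈ ℂ with 0 < |w| < ρ, all ζ⁺, ζ⁻ ∈ ℂ with |ζ⁺ − (πi/2)·√w| ≤ K|w| and |ζ⁻ + (πi/2)·√w| ≤ K|w| (√w the principal square root), and every Z ∈ ℂ with |w|^{1/4} ≤ Re Z ≤ 1 − |w|^{1/4}, one has e^{2πiZ} ≠ 1 and |(ζ⁻·e^{2πiZ} − ζ⁺)/(e^{2πiZ} − 1)| ≤ K'·|w|^{1/4}. -/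
/-- Concavity of sine: `sin (π x)` is at least twice the distance from `x` to `{0, 1}`. -/
lemma two_mul_le_sin_pi_mul {t x : ℝ} (ht : 0 ≤ t) (h₁ : t ≤ x) (h₂ : x ≤ 1 - t) :
    2 * t ≤ Real.sin (Real.pi * x) := by
  have hπ := Real.pi_pos
  have key : ∀ y : ℝ, t ≤ y → y ≤ 1 / 2 → 2 * t ≤ Real.sin (Real.pi * y) := by
    intro y hy hy'
    have h := Real.mul_le_sin (x := Real.pi * y) (mul_nonneg hπ.le (ht.trans hy)) (by nlinarith)
    have e : 2 / Real.pi * (Real.pi * y) = 2 * y := by field_simp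
    linarith
  rcases le_total x (1 / 2) with hx | hx
  · exact key x h₁ hx
  · have h := key (1 - x) (by linarith) (by linarith)
    rwa [show Real.pi * (1 - x) = Real.pi - Real.pi * x by ring, Real.sin_pi_sub] at h

/-- Lower bound for `e^{2πiZ} - 1` in terms of `sin (π Re Z)`, uniform in `Im Z`. -/
lemma one_add_norm_exp_mul_sin_le (Z : ℂ) :
    (1 + ‖Complex.exp (2 * (Real.pi : ℂ) * Complex.I * Z)‖) * Real.sin (Real.pi * Z.re) ≤
      ‖Complex.exp (2 * (Real.pi : ℂ) * Complex.I * Z) - 1‖ := by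
  have him : (2 * (Real.pi : ℂ) * Complex.I * Z).im = 2 * (Real.pi * Z.re) := by
    simp [mul_assoc]
  refine le_of_sq_le_sq ?_ (norm_nonneg _)
  rw [← Complex.normSq_eq_norm_sq, Complex.normSq_apply, Complex.sub_re, Complex.sub_im,
    Complex.exp_re, Complex.exp_im, Complex.norm_exp, him, Complex.one_re, Complex.one_im,
    Real.cos_two_mul, Real.sin_two_mul]
  generalize Real.exp (2 * (Real.pi : ℂ) * Complex.I * Z).re = r
  have hsc := Real.sin_sq_add_cos_sq (Real.pi * Z.re)
  generalize Real.sin (Real.pi * Z.re) = s at *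
  generalize Real.cos (Real.pi * Z.re) = c at *
  have hs : s ^ 2 = 1 - c ^ 2 := by linarith
  have e : (r * (2 * c ^ 2 - 1) - 1) * (r * (2 * c ^ 2 - 1) - 1) +
      (r * (2 * s * c) - 0) * (r * (2 * s * c) - 0) - ((1 + r) * s) ^ 2 =
      ((1 - r) * c) ^ 2 := by
    linear_combination (4 * r ^ 2 * c ^ 2 - (1 + r) ^ 2) * hs
  linarith [sq_nonneg ((1 - r) * c)]

/-- The Möbius expression `(b E - a) / (E - 1)` is small when `a`, `b` are and `E` is far from `1`
relative to `1 + ‖E‖`. -/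
lemma norm_mul_sub_div_sub_one_le {a b E : ℂ} {M δ : ℝ} (hδ : 0 < δ) (ha : ‖a‖ ≤ M)
    (hb : ‖b‖ ≤ M) (hE : (1 + ‖E‖) * δ ≤ ‖E - 1‖) : ‖(b * E - a) / (E - 1)‖ ≤ M / δ := by
  have hM : 0 ≤ M := (norm_nonneg a).trans ha
  have hpos : 0 < ‖E - 1‖ := lt_of_lt_of_le (by positivity) hE
  rw [norm_div, div_le_div_iff₀ hpos hδ]
  have hnum : ‖b * E - a‖ ≤ M * (1 + ‖E‖) := by
    have h := norm_sub_le (b * E) a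
    rw [norm_mul] at h
    nlinarith [mul_le_mul_of_nonneg_right hb (norm_nonneg E)]
  calc ‖b * E - a‖ * δ ≤ M * (1 + ‖E‖) * δ := by gcongr
    _ = M * ((1 + ‖E‖) * δ) := by ring
    _ ≤ M * ‖E - 1‖ := by gcongr

/-- `sup_{z ∈ V_w} |z| = O(|w|^{1/4})`. For every `K > 0` there are `ρ ∈ (0,1)`
and `K' > 0` such that for `0 < |w| < ρ`, curves `ζ⁺, ζ⁻` with
`|ζ⁺ − (πi/2)√w| ≤ K|w|`, `|ζ⁻ + (πi/2)√w| ≤ K|w|`, and any `Z` in the closed strip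
`|w|^{1/4} ≤ Re Z ≤ 1 − |w|^{1/4}`, one has `e^{2πiZ} ≠ 1` and
`|(ζ⁻·e^{2πiZ} − ζ⁺)/(e^{2πiZ} − 1)| ≤ K'·|w|^{1/4}`. -/
theorem stmt_14 (K : ℝ) (hK : 0 < K) :
    ∃ ρ K' : ℝ, 0 < ρ ∧ ρ < 1 ∧ 0 < K' ∧
      ∀ w : ℂ, 0 < ‖w‖ → ‖w‖ < ρ →
        ∀ ζp ζm : ℂ,
          ‖ζp - (Real.pi : ℂ) * Complex.I / 2 * w ^ ((1 : ℂ) / 2)‖ ≤ K * ‖w‖ →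
          ‖ζm + (Real.pi : ℂ) * Complex.I / 2 * w ^ ((1 : ℂ) / 2)‖ ≤ K * ‖w‖ →
          ∀ Z : ℂ, ‖w‖ ^ ((1 : ℝ) / 4) ≤ Z.re → Z.re ≤ 1 - ‖w‖ ^ ((1 : ℝ) / 4) →
            Complex.exp (2 * (Real.pi : ℂ) * Complex.I * Z) ≠ 1 ∧
            ‖(ζm * Complex.exp (2 * (Real.pi : ℂ) * Complex.I * Z) - ζp) /
                (Complex.exp (2 * (Real.pi : ℂ) * Complex.I * Z) - 1)‖ ≤
              K' * ‖w‖ ^ ((1 : ℝ) / 4) := by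
  refine ⟨1 / 2, (2 + K) / 2, by norm_num, by norm_num, by positivity, ?_⟩
  intro w hw _ ζp ζm hp hm Z h₁ h₂
  set t : ℝ := ‖w‖ ^ ((1 : ℝ) / 4) with ht
  have ht0 : 0 < t := Real.rpow_pos_of_pos hw _
  have ht2 : ‖w‖ ^ ((1 : ℝ) / 2) = t ^ 2 := by
    rw [ht, ← Real.rpow_mul_natCast hw.le]; norm_num
  have ht4 : ‖w‖ = t ^ 4 := by
    rw [ht, ← Real.rpow_mul_natCast hw.le]; norm_num
  have hroot : ‖(Real.pi : ℂ) * Complex.I / 2 * w ^ ((1 : ℂ) / 2)‖ ≤ 2 * t ^ 2 := by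
    have h := Complex.norm_cpow_real w (1 / 2)
    push_cast at h
    rw [norm_mul, h, ht2]
    have hπ : ‖(Real.pi : ℂ) * Complex.I / 2‖ = Real.pi / 2 := by
      simp [abs_of_pos Real.pi_pos]
    rw [hπ]
    gcongr
    linarith [Real.pi_le_four]
  have hsmall : K * ‖w‖ ≤ K * t ^ 2 := by
    rw [ht4]
    gcongr K * ?_
    exact pow_le_pow_of_le_one ht0.le (by linarith) (by norm_num)
  have hζp : ‖ζp‖ ≤ (2 + K) * t ^ 2 := by
    have h := norm_le_norm_add_norm_sub' ζp ((Real.pi : ℂ) * Complex.I / 2 * w ^ ((1 : ℂ) / 2))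
    linarith
  have hζm : ‖ζm‖ ≤ (2 + K) * t ^ 2 := by
    have h := norm_sub_le (ζm + (Real.pi : ℂ) * Complex.I / 2 * w ^ ((1 : ℂ) / 2))
      ((Real.pi : ℂ) * Complex.I / 2 * w ^ ((1 : ℂ) / 2))
    rw [add_sub_cancel_right] at h
    linarith
  have hE : (1 + ‖Complex.exp (2 * (Real.pi : ℂ) * Complex.I * Z)‖) * (2 * t) ≤
      ‖Complex.exp (2 * (Real.pi : ℂ) * Complex.I * Z) - 1‖ :=
    (mul_le_mul_of_nonneg_left (two_mul_le_sin_pi_mul ht0.le h₁ h₂) (by positivity)).trans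
      (one_add_norm_exp_mul_sin_le Z)
  refine ⟨sub_ne_zero.mp (norm_pos_iff.mp (lt_of_lt_of_le (by positivity) hE)), ?_⟩
  refine (norm_mul_sub_div_sub_one_le (by positivity) hζp hζm hE).trans_eq ?_
  field_simp
end
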